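/- arXiv:2410.04394 — 2 statements merged into one kernel-verified Lean document; each statement's English description precedes it below -/
import Mathlib

section
/- Let d ≥ 3 be an integer, let G be a d-regular simple graph on [n] whose second largest adjacency eigenvalue satisfies λ_2(G) < d, let q ≥ 2, C ≥ 1, let k ≥ 1 and let ‖·‖_X be a 1-unconditional norm on ℝ^k that has cotype q with constant C. Then for every map f : [n] → ℝ^k, (1/n²)·∑_{v,w∈[n]} ‖f(v)−f(w)‖_X² ≤ (Γ/|E_G|)·∑_{{w,w'}∈E_G} ‖f(w)−f(w')‖_X², where Γ := 2^{3616q+450} · q^{384q+104} · C^{129q+4} · (d/(d−λ_2(G)))^8. -/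
open Finset

attribute [local instance] Classical.propDecidable

noncomputable section

/-- Distance (in `ℕ∞`) from a vertex to a finite set of vertices. -/
def vertexSetDist {n : ℕ} (G : SimpleGraph (Fin n)) (v : Fin n) (S : Finset (Fin n)) : ℕ∞ :=
  S.inf fun w => G.edist v w

/-- Distance (in `ℕ∞`) from a vertex to an (unordered) edge. -/
def edgeDist {n : ℕ} (G : SimpleGraph (Fin n)) (v : Fin n) (e : Sym2 (Fin n)) : ℕ∞ :=
  Sym2.lift ⟨fun a b => min (G.edist v a) (G.edist v b), fun _ _ => min_comm _ _⟩ e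

/-- Distance (in `ℕ∞`) from an (unordered) edge to a finite set of vertices. -/
def edgeSetDist {n : ℕ} (G : SimpleGraph (Fin n)) (e : Sym2 (Fin n)) (S : Finset (Fin n)) : ℕ∞ :=
  S.inf fun v => edgeDist G v e

/-- Part (A) of the long-range expansion property. -/
def ExpanA (n d : ℕ) (G : SimpleGraph (Fin n)) (α : ℝ) : Prop :=
  ∀ S : Finset (Fin n), S.Nonempty → ∀ ℓ : ℕ, 1 ≤ ℓ →
    min (3 * (n : ℝ) / 4) (α * ((d : ℝ) - 1) ^ ℓ * S.card) ≤
      ((univ.filter fun v => vertexSetDist G v S ≤ (ℓ : ℕ∞)).card : ℝ)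

/-- Part (B) of the long-range expansion property. -/
def ExpanB (n d : ℕ) (G : SimpleGraph (Fin n)) [DecidableRel G.Adj] (α ε L : ℝ) : Prop :=
  ∀ S : Finset (Fin n), S.Nonempty → ∀ ℓ : ℕ, 1 ≤ ℓ →
    α * ((d : ℝ) - 1) ^ (ℓ - 1) * S.card ≤ 3 * n / 4 →
    ∃ v ∈ S,
      (((G.edgeFinset.filter fun e =>
            L * ((d : ℝ) - 1 - ε) ^ ℓ ≤
              ((S.filter fun u => edgeDist G u e ≤ ((ℓ - 1 : ℕ) : ℕ∞)).card : ℝ)).filter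
          fun e => edgeDist G v e ≤ ((ℓ - 1 : ℕ) : ℕ∞)).card : ℝ) ≤
        L * ((d : ℝ) - 1 - ε) ^ ℓ

/-- The long-range expansion property `Expan(α, ε, L)`. -/
def Expan (n d : ℕ) (G : SimpleGraph (Fin n)) [DecidableRel G.Adj] (α ε L : ℝ) : Prop :=
  ExpanA n d G α ∧ ExpanB n d G α ε L

/-- `N` is a norm on `ℝ^k`. -/
def IsNorm (k : ℕ) (N : (Fin k → ℝ) → ℝ) : Prop :=
  (∀ x, N x = 0 ↔ x = 0) ∧ (∀ (c : ℝ) (x), N (c • x) = |c| * N x) ∧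
    ∀ x y, N (x + y) ≤ N x + N y

/-- The standard basis of `ℝ^k` is `K`-unconditional for `N`. -/
def UncondConst (k : ℕ) (N : (Fin k → ℝ) → ℝ) (K : ℝ) : Prop :=
  ∀ (σ : Fin k → Bool) (a : Fin k → ℝ),
    N (fun j => (if σ j then (1 : ℝ) else -1) * a j) ≤ K * N a

/-- `N` is a `1`-unconditional norm on `ℝ^k`: `‖y‖ = ‖|y|‖`. -/
def OneUnconditional (k : ℕ) (N : (Fin k → ℝ) → ℝ) : Prop :=
  ∀ y, N y = N fun j => |y j|

/-- `N` has cotype `q` with constant `C`. -/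
def HasCotype (k : ℕ) (N : (Fin k → ℝ) → ℝ) (q C : ℝ) : Prop :=
  ∀ (m : ℕ) (x : Fin m → Fin k → ℝ),
    1 / C ^ q * ∑ i, N (x i) ^ q ≤
      1 / 2 ^ m * ∑ σ : Fin m → Bool, N (∑ i, (if σ i then (1 : ℝ) else -1) • x i) ^ q

/-- The collection of vectors `Y` has restricted cotype `q` with constant `C` w.r.t. `N`. -/
def RestrictedCotype (k : ℕ) (N : (Fin k → ℝ) → ℝ) (q C : ℝ) (Y : Set (Fin k → ℝ)) : Prop :=
  ∀ (m : ℕ), 0 < m → ∀ y : Fin m → Fin k → ℝ, Function.Injective y → (∀ i, y i ∈ Y) →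
    1 / C ^ q * ∑ i, N (y i) ^ q ≤
      1 / 2 ^ m * ∑ σ : Fin m → Bool, N (∑ i, (if σ i then (1 : ℝ) else -1) • y i) ^ q

/-- For an edge `e = {a, b}`, the value `N (f a - f b)` (well-defined when `N` is a norm). -/
def edgeNorm {n k : ℕ} (N : (Fin k → ℝ) → ℝ) (f : Fin n → Fin k → ℝ) (e : Sym2 (Fin n)) : ℝ :=
  Sym2.lift ⟨fun a b => min (N (f a - f b)) (N (f b - f a)), fun _ _ => min_comm _ _⟩ e

/-- Coordinate projection `P_J`. -/
def proj {k : ℕ} (J : Finset (Fin k)) (y : Fin k → ℝ) : Fin k → ℝ :=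
  fun j => if j ∈ J then y j else 0

/-- Indicator vector `χ_J ∈ ℝ^k`. -/
def chi {k : ℕ} (J : Finset (Fin k)) : Fin k → ℝ := fun j => if j ∈ J then 1 else 0

/-- The sequence `a_ℓ = (6/π²) ℓ⁻²`. -/
def aseq (ℓ : ℕ) : ℝ := 6 / Real.pi ^ 2 * (1 / (ℓ : ℝ) ^ 2)

/-- The set of edges `E(S, j; ℓ)`: edges within distance `ℓ - 1` of `S` with a jump in the
`j`-th coordinate. -/
def jumpEdges {n k : ℕ} (G : SimpleGraph (Fin n)) [DecidableRel G.Adj]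
    (f : Fin n → Fin k → ℝ) (j : Fin k) (S : Finset (Fin n)) (ℓ : ℕ) :
    Finset (Sym2 (Fin n)) :=
  G.edgeFinset.filter fun e =>
    edgeSetDist G e S ≤ ((ℓ - 1 : ℕ) : ℕ∞) ∧
      Sym2.lift ⟨fun a b => f a j ≠ f b j, fun _ _ => propext ne_comm⟩ e

/-- The scale `ℓ_{v,j}`. -/
def lvj {n k : ℕ} (G : SimpleGraph (Fin n)) [DecidableRel G.Adj]
    (f : Fin n → Fin k → ℝ) (α : ℝ) (d : ℕ) (v : Fin n) (j : Fin k) : ℕ :=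
  sInf {ℓ : ℕ | 1 ≤ ℓ ∧
    α * aseq ℓ / 6 * ((d : ℝ) - 1) ^ (ℓ - 1) ≤ ((jumpEdges G f j {v} ℓ).card : ℝ)}

/-- The set `V_+(j; ℓ)`. -/
def Vplus {n k : ℕ} (G : SimpleGraph (Fin n)) [DecidableRel G.Adj]
    (f : Fin n → Fin k → ℝ) (α : ℝ) (d : ℕ) (j : Fin k) (ℓ : ℕ) : Finset (Fin n) :=
  univ.filter fun v => f v j = 1 ∧ lvj G f α d v j = ℓ

/-- The set `V_-(j; ℓ)`. -/
def Vminus {n k : ℕ} (G : SimpleGraph (Fin n)) [DecidableRel G.Adj]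
    (f : Fin n → Fin k → ℝ) (α : ℝ) (d : ℕ) (j : Fin k) (ℓ : ℕ) : Finset (Fin n) :=
  univ.filter fun v => f v j = -1 ∧ lvj G f α d v j = ℓ

/-- The scale-`ℓ` support `J(v, ℓ)`. -/
def Jset {n k : ℕ} (G : SimpleGraph (Fin n)) [DecidableRel G.Adj]
    (f : Fin n → Fin k → ℝ) (α : ℝ) (d : ℕ) (v : Fin n) (ℓ : ℕ) : Finset (Fin k) :=
  univ.filter fun j => f v j ≠ 0 ∧ lvj G f α d v j = ℓ

/-- The scale-`ℓ` mutual support `J(v, ℓ, e)`, relative to a family `Ẽ(v, j)` of edge sets. -/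
def JsetE {n k : ℕ} (G : SimpleGraph (Fin n)) [DecidableRel G.Adj]
    (f : Fin n → Fin k → ℝ) (α : ℝ) (d : ℕ) (Et : Fin n → Fin k → Finset (Sym2 (Fin n)))
    (v : Fin n) (ℓ : ℕ) (e : Sym2 (Fin n)) : Finset (Fin k) :=
  (Jset G f α d v ℓ).filter fun j => e ∈ Et v j

end

/-- Lattice (semi)norm package. -/
structure LatNorm {k : ℕ} (N : (Fin k → ℝ) → ℝ) : Prop where
  hom : ∀ (c : ℝ) (x), N (c • x) = |c| * N x
  tri : ∀ x y, N (x + y) ≤ N x + N y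
  mono : ∀ x y, (∀ j, |x j| ≤ |y j|) → N x ≤ N y

namespace LatNorm

variable {k : ℕ} {N : (Fin k → ℝ) → ℝ}

theorem zero (h : LatNorm N) : N 0 = 0 := by
  have := h.hom 0 0
  simpa using this

theorem nonneg (h : LatNorm N) (x : Fin k → ℝ) : 0 ≤ N x := by
  have := h.mono 0 x (fun j => by simp)
  rwa [h.zero] at this

theorem sum_le (h : LatNorm N) {ι : Type*} (s : Finset ι) (y : ι → Fin k → ℝ) :
    N (∑ i ∈ s, y i) ≤ ∑ i ∈ s, N (y i) := by
  induction s using Finset.induction_on with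
  | empty => simp [h.zero]
  | insert a s ha ih =>
    rw [Finset.sum_insert ha, Finset.sum_insert ha]
    exact (h.tri _ _).trans (by linarith)

theorem congr_abs (h : LatNorm N) {x y : Fin k → ℝ} (hxy : ∀ j, |x j| = |y j|) : N x = N y :=
  le_antisymm (h.mono _ _ fun j => (hxy j).le) (h.mono _ _ fun j => (hxy j).ge)

theorem of_isNorm (hN : IsNorm k N) (hunc : OneUnconditional k N) : LatNorm N := by
  obtain ⟨h0, hom, tri⟩ := hN
  refine ⟨hom, tri, ?_⟩
  -- one coordinate
  have one : ∀ (y : Fin k → ℝ) (j : Fin k) (c : ℝ), |c| ≤ |y j| → N (Function.update y j c) ≤ N y := by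
    intro y j c hc
    by_cases hy : y j = 0
    · have : c = 0 := by simpa [hy] using hc
      rw [this, ← hy, Function.update_eq_self]
    · set z : Fin k → ℝ := Function.update y j (- y j) with hz
      have hzN : N z = N y := by
        rw [hunc z, hunc y]
        congr 1
        funext i
        by_cases hi : i = j
        · subst hi; simp [hz]
        · simp [hz, hi]
      set θ : ℝ := c / y j with hθ
      have hθ1 : |θ| ≤ 1 := by
        rw [hθ, abs_div]
        exact div_le_one_of_le₀ hc (abs_nonneg _)
      have hθ2 := abs_le.1 hθ1
      have : Function.update y j c = ((1 + θ) / 2) • y + ((1 - θ) / 2) • z := by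
        funext i
        by_cases hi : i = j
        · subst hi
          simp [hz, hθ]
          field_simp
          ring
        · simp [hz, hi]; ring
      rw [this]
      refine (tri _ _).trans ?_
      rw [hom, hom, hzN, abs_of_nonneg (by linarith), abs_of_nonneg (by linarith)]
      apply le_of_eq; ring
  intro x y hxy
  have key : ∀ S : Finset (Fin k), N (fun j => if j ∈ S then x j else y j) ≤ N y := by
    intro S
    induction S using Finset.induction_on with
    | empty => simp
    | insert a s ha ih =>
      refine le_trans ?_ ih
      have : (fun j => if j ∈ insert a s then x j else y j)
          = Function.update (fun j => if j ∈ s then x j else y j) a (x a) := by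
        funext i
        by_cases hi : i = a
        · subst hi; simp
        · simp [hi]
      rw [this]
      apply one
      simp [ha, hxy a]
  simpa using key univ

/-- Norming functional. -/
theorem norming (h : LatNorm N) (x : Fin k → ℝ) :
    ∃ s : Fin k → ℝ, (∀ y : Fin k → ℝ, ∑ j, y j * s j ≤ N y) ∧ ∑ j, x j * s j = N x := by
  by_cases hx : x = 0
  · refine ⟨0, fun y => by simpa using h.nonneg y, by simp [hx, h.zero]⟩
  let f : (Fin k → ℝ) →ₗ.[ℝ] ℝ := LinearPMap.mkSpanSingleton x (N x) hx
  obtain ⟨g, hg1, hg2⟩ := exists_extension_of_le_sublinear f N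
    (fun c hc y => by rw [h.hom, abs_of_pos hc]) h.tri (by
      rintro ⟨z, hz⟩
      obtain ⟨c, rfl⟩ := Submodule.mem_span_singleton.1 hz
      have : f ⟨c • x, hz⟩ = c • N x := LinearPMap.mkSpanSingleton'_apply _ _ _ _ _
      rw [this, h.hom]
      exact mul_le_mul_of_nonneg_right (le_abs_self c) (h.nonneg x))
  have hrep : ∀ y : Fin k → ℝ, ∑ j, y j * g (Pi.single j 1) = g y := by
    intro y
    conv_rhs => rw [← Finset.univ_sum_single y]
    rw [map_sum]
    refine Finset.sum_congr rfl fun j _ => ?_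
    have : Pi.single j (y j) = y j • (Pi.single j (1:ℝ) : Fin k → ℝ) := by
      funext i; by_cases hi : i = j
      · subst hi; simp
      · simp [hi]
    rw [this, map_smul, smul_eq_mul]
  refine ⟨fun j => g (Pi.single j 1), fun y => by rw [hrep]; exact hg2 y, ?_⟩
  rw [hrep]
  have hxm : x ∈ f.domain := Submodule.mem_span_singleton_self x
  have := hg1 ⟨x, hxm⟩
  rw [this]
  exact LinearPMap.mkSpanSingleton_apply ℝ ℝ hx (N x)

/-- Coordinates of a norming functional have the right sign. -/
theorem norming_sign (h : LatNorm N) {x s : Fin k → ℝ} (h1 : ∀ y : Fin k → ℝ, ∑ j, y j * s j ≤ N y)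
    (h2 : ∑ j, x j * s j = N x) (j : Fin k) : 0 ≤ x j * s j := by
  have a := h1 (Function.update x j 0)
  have b : N (Function.update x j 0) ≤ N x := by
    apply h.mono; intro i
    by_cases hi : i = j
    · subst hi; simp
    · simp [hi]
  have c : ∑ i, Function.update x j 0 i * s i = ∑ i, x i * s i - x j * s j := by
    rw [eq_sub_iff_add_eq, ← Finset.add_sum_erase _ _ (Finset.mem_univ j),
      ← Finset.add_sum_erase univ (fun i => x i * s i) (Finset.mem_univ j)]
    have : ∑ i ∈ univ.erase j, Function.update x j 0 i * s i = ∑ i ∈ univ.erase j, x i * s i := by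
      refine Finset.sum_congr rfl fun i hi => ?_
      simp [Finset.ne_of_mem_erase hi]
    rw [this]; simp
  linarith

theorem abs_pair (h : LatNorm N) {s : Fin k → ℝ} (h1 : ∀ y : Fin k → ℝ, ∑ j, y j * s j ≤ N y)
    (y : Fin k → ℝ) : ∑ j, |y j| * |s j| ≤ N y := by
  have := h1 (fun j => |y j| * (if 0 ≤ s j then 1 else -1))
  have e : N (fun j => |y j| * (if 0 ≤ s j then 1 else -1)) = N y := by
    apply h.congr_abs; intro j; split_ifs <;> simp
  rw [e] at this
  refine le_trans (le_of_eq (Finset.sum_congr rfl fun j _ => ?_)) this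
  split_ifs with hs
  · rw [abs_of_nonneg hs]; ring
  · rw [abs_of_neg (not_le.1 hs)]; ring

end LatNorm

/-- Pisier-type domination of a lattice norm with a lower `q`-estimate by a measure. -/
theorem LatNorm.domination {k : ℕ} {N : (Fin k → ℝ) → ℝ} (h : LatNorm N) {q K : ℝ} (hq : 1 ≤ q)
    (x : Fin k → ℝ)
    (hlow : ∀ c : Fin k → Fin (k + 1),
      ∑ i, N (proj (univ.filter fun j => c j = i) x) ^ q ≤ K) :
    ∃ l : Fin k → ℝ, (∀ j, 0 ≤ l j) ∧ ∑ j, l j ≤ q * K ∧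
      ∀ A : Finset (Fin k), N (proj A x) ^ q ≤ ∑ j ∈ A, l j := by
  obtain ⟨c, hc⟩ := Finite.exists_max
    (fun c : Fin k → Fin (k + 1) => ∑ i, N (proj (univ.filter fun j => c j = i) x) ^ q)
  set X : Fin (k + 1) → Fin k → ℝ := fun i => proj (univ.filter fun j => c j = i) x with hX
  choose s hs1 hs2 using fun i => h.norming (X i)
  have hsign : ∀ i j, 0 ≤ X i j * s i j := fun i j => h.norming_sign (hs1 i) (hs2 i) j
  have hXv : ∀ i j, X i j = if c j = i then x j else 0 := by
    intro i j; simp [hX, proj]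
  set l : Fin k → ℝ := fun j => ∑ i, q * N (X i) ^ (q - 1) * (X i j * s i j) with hl
  have hw : ∀ i, 0 ≤ q * N (X i) ^ (q - 1) := fun i =>
    mul_nonneg (by linarith) (Real.rpow_nonneg (h.nonneg _) _)
  have hpow : ∀ a : ℝ, 0 ≤ a → a ^ (q - 1) * a = a ^ q := by
    intro a ha
    rcases ha.eq_or_lt with rfl | ha
    · rw [mul_zero, Real.zero_rpow (by linarith)]
    · rw [← Real.rpow_add_one ha.ne']; congr 1; ring
  refine ⟨l, fun j => Finset.sum_nonneg fun i _ => mul_nonneg (hw i) (hsign i j), ?_, ?_⟩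
  · rw [hl, Finset.sum_comm]
    calc ∑ i, ∑ j, q * N (X i) ^ (q - 1) * (X i j * s i j)
        = ∑ i, q * N (X i) ^ q := by
          refine Finset.sum_congr rfl fun i _ => ?_
          rw [← Finset.mul_sum, hs2, mul_assoc, hpow _ (h.nonneg _)]
      _ = q * ∑ i, N (X i) ^ q := by rw [Finset.mul_sum]
      _ ≤ q * K := by
          apply mul_le_mul_of_nonneg_left (hlow c) (by linarith)
  · intro A
    obtain ⟨i0, hi0⟩ : ∃ i0, ∀ j, c j ≠ i0 := by
      by_contra! hcon
      have : Function.Surjective c := hcon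
      have := Fintype.card_le_of_surjective c this
      simp at this
    have hmax := hc (fun j => if j ∈ A then i0 else c j)
    have hX0 : X i0 = 0 := by
      funext j; simp [hXv, hi0 j]
    have hq0 : q ≠ 0 := by linarith
    set Y : Fin (k + 1) → Fin k → ℝ := fun i => proj (univ.filter fun j => j ∉ A ∧ c j = i) x with hY
    have e1 : ∀ i, i ≠ i0 → proj (univ.filter fun j => (if j ∈ A then i0 else c j) = i) x = Y i := by
      intro i hi
      funext j
      simp only [hY, proj, Finset.mem_filter, Finset.mem_univ, true_and]
      by_cases hj : j ∈ A
      · simp [hj, hi.symm]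
      · simp [hj]
    have e2 : proj (univ.filter fun j => (if j ∈ A then i0 else c j) = i0) x = proj A x := by
      funext j
      simp only [proj, Finset.mem_filter, Finset.mem_univ, true_and]
      by_cases hj : j ∈ A
      · simp [hj]
      · simp [hj, hi0 j]
    have m1 : N (proj A x) ^ q + ∑ i ∈ univ.erase i0, N (Y i) ^ q
        ≤ ∑ i ∈ univ.erase i0, N (X i) ^ q := by
      have a1 : ∑ i, N (proj (univ.filter fun j => (if j ∈ A then i0 else c j) = i) x) ^ q
          = N (proj A x) ^ q + ∑ i ∈ univ.erase i0, N (Y i) ^ q := by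
        rw [← Finset.add_sum_erase _ _ (Finset.mem_univ i0), e2]
        congr 1
        exact Finset.sum_congr rfl fun i hi => by rw [e1 i (Finset.ne_of_mem_erase hi)]
      have a2 : ∑ i, N (X i) ^ q = ∑ i ∈ univ.erase i0, N (X i) ^ q := by
        rw [← Finset.add_sum_erase _ _ (Finset.mem_univ i0), hX0, h.zero, Real.zero_rpow hq0, zero_add]
      rw [← a1, ← a2]
      exact hmax
    have bern : ∀ i, N (X i) ^ q ≤ N (Y i) ^ q + ∑ j ∈ A, q * N (X i) ^ (q - 1) * (X i j * s i j) := by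
      intro i
      have ha := h.nonneg (X i)
      have hb := h.nonneg (Y i)
      have hd : N (X i) - N (Y i) ≤ ∑ j ∈ A, X i j * s i j := by
        have := hs1 i (Y i)
        have e : ∑ j, Y i j * s i j + ∑ j ∈ A, X i j * s i j = N (X i) := by
          rw [← hs2 i, ← Finset.sum_compl_add_sum A]
          have z1 : ∑ j ∈ A, Y i j * s i j = 0 := Finset.sum_eq_zero fun j hj => by
            simp [hY, proj, hj]
          have z2 : ∑ j ∈ Aᶜ, Y i j * s i j = ∑ j ∈ Aᶜ, X i j * s i j := by
            refine Finset.sum_congr rfl fun j hj => ?_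
            have hj' : j ∉ A := by simpa using hj
            simp [hY, hXv, proj, hj']
          rw [z1, z2, add_zero, Finset.sum_compl_add_sum A]
        linarith
      rw [← Finset.mul_sum]
      have hstep : q * N (X i) ^ (q - 1) * (N (X i) - N (Y i)) ≤
          q * N (X i) ^ (q - 1) * ∑ j ∈ A, X i j * s i j :=
        mul_le_mul_of_nonneg_left hd (hw i)
      refine le_trans ?_ (add_le_add_right hstep _)
      rcases ha.eq_or_lt with h0 | hpos
      · rw [← h0, Real.zero_rpow hq0]
        have : N (Y i) ≤ N (X i) := by
          apply h.mono; intro j; rw [hXv]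
          simp only [hY, proj, Finset.mem_filter, Finset.mem_univ, true_and]
          by_cases h1 : c j = i <;> by_cases h2 : j ∈ A <;> simp [h1, h2]
        have hy0 : N (Y i) = 0 := by linarith
        rw [hy0, Real.zero_rpow hq0]; simp
      · have hb' := one_add_mul_self_le_rpow_one_add (s := N (Y i) / N (X i) - 1)
          (by have := div_nonneg hb ha; linarith) hq
        have : 1 + (N (Y i) / N (X i) - 1) = N (Y i) / N (X i) := by ring
        rw [this, Real.div_rpow hb ha] at hb'
        have hXq : 0 < N (X i) ^ q := Real.rpow_pos_of_pos hpos q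
        have := mul_le_mul_of_nonneg_left hb' hXq.le
        rw [mul_div_cancel₀ _ hXq.ne'] at this
        have e3 : N (X i) ^ q * (1 + q * (N (Y i) / N (X i) - 1))
          = N (X i) ^ q - q * N (X i) ^ (q - 1) * (N (X i) - N (Y i)) := by
          rw [← hpow _ ha]; field_simp; ring
        linarith
    have tot : ∑ i ∈ univ.erase i0, N (X i) ^ q ≤ ∑ i ∈ univ.erase i0, N (Y i) ^ q
        + ∑ i ∈ univ.erase i0, ∑ j ∈ A, q * N (X i) ^ (q - 1) * (X i j * s i j) := by
      rw [← Finset.sum_add_distrib]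
      exact Finset.sum_le_sum fun i _ => bern i
    have fin : ∑ i ∈ univ.erase i0, ∑ j ∈ A, q * N (X i) ^ (q - 1) * (X i j * s i j)
        ≤ ∑ j ∈ A, l j := by
      rw [hl, Finset.sum_comm]
      refine Finset.sum_le_sum fun j _ => ?_
      exact Finset.sum_le_sum_of_subset_of_nonneg (Finset.erase_subset _ _)
        fun i _ _ => mul_nonneg (hw i) (hsign i j)
    linarith

theorem LatNorm.dyadic {k : ℕ} {N : (Fin k → ℝ) → ℝ} (h : LatNorm N) (x u : Fin k → ℝ)
    (hu0 : ∀ j, 0 ≤ u j) (hu1 : ∀ j, u j ≤ 1) (L : ℕ) :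
    N (fun j => x j * u j) ≤ ∑ l ∈ range L, (1 / 2 : ℝ) ^ l *
      N (proj (univ.filter fun j => (1 / 2 : ℝ) ^ (l + 1) < u j) x) + (1 / 2 : ℝ) ^ L * N x := by
  have pt : ∀ j, u j ≤ ∑ l ∈ range L, (1 / 2 : ℝ) ^ l *
      (if (1 / 2 : ℝ) ^ (l + 1) < u j then 1 else 0) + (1 / 2 : ℝ) ^ L := by
    intro j
    induction L with
    | zero => simpa using hu1 j
    | succ L ih =>
      have hnn : 0 ≤ ∑ l ∈ range L, (1 / 2 : ℝ) ^ l *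
        (if (1 / 2 : ℝ) ^ (l + 1) < u j then 1 else 0) :=
        Finset.sum_nonneg fun l _ => mul_nonneg (by positivity) (by split_ifs <;> norm_num)
      rw [Finset.sum_range_succ]
      have hp : (0:ℝ) < (1 / 2 : ℝ) ^ (L + 1) := by positivity
      by_cases hj : (1 / 2 : ℝ) ^ (L + 1) < u j
      · rw [if_pos hj]; linarith
      · rw [if_neg hj]; linarith [not_lt.1 hj]
  have m : N (fun j => x j * u j) ≤ N (∑ l ∈ range L, ((1 / 2 : ℝ) ^ l) •
      (proj (univ.filter fun j => (1 / 2 : ℝ) ^ (l + 1) < u j) x) + ((1 / 2 : ℝ) ^ L) • x) := by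
    apply h.mono
    intro j
    have e : (∑ l ∈ range L, ((1 / 2 : ℝ) ^ l) •
      (proj (univ.filter fun j => (1 / 2 : ℝ) ^ (l + 1) < u j) x) + ((1 / 2 : ℝ) ^ L) • x) j
      = x j * (∑ l ∈ range L, (1 / 2 : ℝ) ^ l *
      (if (1 / 2 : ℝ) ^ (l + 1) < u j then 1 else 0) + (1 / 2 : ℝ) ^ L) := by
      rw [Pi.add_apply, Finset.sum_apply, mul_add, Finset.mul_sum]
      congr 1
      · refine Finset.sum_congr rfl fun l _ => ?_
        simp only [Pi.smul_apply, smul_eq_mul, proj, Finset.mem_filter, Finset.mem_univ, true_and]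
        split_ifs <;> ring
      · simp; ring
    rw [e, abs_mul, abs_mul]
    apply mul_le_mul_of_nonneg_left _ (abs_nonneg _)
    rw [abs_of_nonneg (hu0 j)]
    exact (pt j).trans (le_abs_self _)
  refine m.trans ((h.tri _ _).trans ?_)
  refine add_le_add ((h.sum_le _ _).trans (Finset.sum_le_sum fun l _ => ?_)) ?_
  · rw [h.hom, abs_of_nonneg (by positivity)]
  · rw [h.hom, abs_of_nonneg (by positivity)]

theorem dyadic_opt {n J P : ℝ} (hn : 0 ≤ n) (hJ : 0 ≤ J) (hP : J ≤ P)
    (hL : ∀ L : ℕ, n ≤ 4 * 2 ^ L * J + (1 / 2 : ℝ) ^ L * P) : n ^ 2 ≤ 36 * (P * J) := by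
  rcases hJ.eq_or_lt with h0 | hJ
  · subst h0
    have t : Filter.Tendsto (fun L : ℕ => (1 / 2 : ℝ) ^ L * P) Filter.atTop (nhds (0 * P)) :=
      (tendsto_pow_atTop_nhds_zero_of_lt_one (by norm_num) (by norm_num)).mul_const P
    have : n ≤ 0 * P := ge_of_tendsto' t fun L => by simpa using hL L
    have : n = 0 := by linarith
    simp [this]
  · obtain ⟨L, h1, h2⟩ := exists_nat_pow_near (x := P / J) (y := 4)
      ((one_le_div hJ).2 hP) (by norm_num)
    have hl := hL L
    rw [le_div_iff₀ hJ] at h1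
    rw [div_lt_iff₀ hJ] at h2
    set a : ℝ := 2 ^ L with ha
    have ha0 : 0 < a := by positivity
    have e4 : (4:ℝ) ^ L = a ^ 2 := by rw [ha, ← pow_mul, mul_comm, pow_mul]; norm_num
    have e2 : (1 / 2 : ℝ) ^ L = 1 / a := by rw [ha]; simp
    rw [pow_succ, e4] at h2
    rw [e4] at h1
    rw [e2] at hl
    have hPJ : 0 < P := hJ.trans_le hP
    set b : ℝ := 1 / a * P with hb
    have hb0 : 0 ≤ b := by positivity
    have hab : a * b = P := by rw [hb]; field_simp
    have hb1 : b ≤ 4 * a * J := by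
      by_contra! hc
      have : a * (4 * a * J) < a * b := mul_lt_mul_of_pos_left hc ha0
      nlinarith
    have hb2 : b * b ≤ 4 * (P * J) := by
      calc b * b ≤ b * (4 * a * J) := mul_le_mul_of_nonneg_left hb1 hb0
        _ = 4 * (P * J) := by rw [← hab]; ring
    have h3 : (a * J) * (a * J) ≤ P * J := by nlinarith
    have h4 : (a * J) * b = P * J := by rw [← hab]; ring
    calc n ^ 2 ≤ (4 * a * J + b) ^ 2 := by gcongr
      _ ≤ 36 * (P * J) := by nlinarith [mul_pos hPJ hJ]

theorem LatNorm.conc_one {k : ℕ} {N : (Fin k → ℝ) → ℝ} (h : LatNorm N) {q Λ : ℝ} (hq : 1 ≤ q)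
    (x u l : Fin k → ℝ) (hu0 : ∀ j, 0 ≤ u j) (hu1 : ∀ j, u j ≤ 1)
    (hl0 : ∀ j, 0 ≤ l j) (hl1 : ∑ j, l j ≤ Λ) (hx : N x ^ q ≤ Λ)
    (hA : ∀ A : Finset (Fin k), N (proj A x) ^ q ≤ ∑ j ∈ A, l j) :
    N (fun j => x j * u j) ^ (2 * q) ≤ 36 ^ q * (Λ * ∑ j, l j * u j ^ (2 * q)) := by
  have hq0 : 0 < q := by linarith
  set I := ∑ j, l j * u j ^ (2 * q) with hI
  have hI0 : 0 ≤ I := Finset.sum_nonneg fun j _ => mul_nonneg (hl0 j) (Real.rpow_nonneg (hu0 j) _)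
  have hIΛ : I ≤ Λ := by
    refine le_trans (Finset.sum_le_sum fun j _ => ?_) hl1
    exact mul_le_of_le_one_right (hl0 j) (Real.rpow_le_one (hu0 j) (hu1 j) (by linarith))
  have hΛ0 : 0 ≤ Λ := hI0.trans hIΛ
  set J := I ^ (1 / q) with hJ
  set P := Λ ^ (1 / q) with hP
  have hJ0 : 0 ≤ J := Real.rpow_nonneg hI0 _
  have hP0 : 0 ≤ P := Real.rpow_nonneg hΛ0 _
  have hJq : J ^ q = I := by rw [hJ, ← Real.rpow_mul hI0, one_div_mul_cancel hq0.ne', Real.rpow_one]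
  have hPq : P ^ q = Λ := by rw [hP, ← Real.rpow_mul hΛ0, one_div_mul_cancel hq0.ne', Real.rpow_one]
  have hJP : J ≤ P := Real.rpow_le_rpow hI0 hIΛ (by positivity)
  have hxP : N x ≤ P := by
    rw [← Real.rpow_le_rpow_iff (h.nonneg _) hP0 hq0, hPq]; exact hx
  have lev : ∀ l : ℕ, N (proj (univ.filter fun j => (1 / 2 : ℝ) ^ (l + 1) < u j) x)
      ≤ 4 ^ (l + 1) * J := by
    intro m
    rw [← Real.rpow_le_rpow_iff (h.nonneg _) (by positivity) hq0, Real.mul_rpow (by positivity) hJ0,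
      hJq]
    refine (hA _).trans ?_
    rw [hI, Finset.mul_sum]
    refine le_trans (Finset.sum_le_sum (g := fun j => ((4:ℝ) ^ (m + 1)) ^ q * (l j * u j ^ (2 * q)))
      fun j hj => ?_)
      (Finset.sum_le_sum_of_subset_of_nonneg (Finset.subset_univ _) fun j _ _ => ?_)
    · have hj' : (1 / 2 : ℝ) ^ (m + 1) < u j := by simpa using hj
      have h1 : 1 ≤ 2 ^ (m + 1) * u j := by
        have := mul_lt_mul_of_pos_left hj' (show (0:ℝ) < 2 ^ (m + 1) by positivity)
        rw [← mul_pow] at this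
        norm_num at this
        exact this.le
      have h2 : 1 ≤ ((4:ℝ) ^ (m + 1)) ^ q * u j ^ (2 * q) := by
        have e : ((4:ℝ) ^ (m + 1)) ^ q * u j ^ (2 * q) = ((2 ^ (m + 1) * u j) ^ (2:ℝ)) ^ q := by
          rw [Real.rpow_mul (hu0 j), ← Real.mul_rpow (by positivity) (Real.rpow_nonneg (hu0 j) _)]
          congr 1
          rw [Real.rpow_two, Real.rpow_two, mul_pow, ← pow_mul, mul_comm (m + 1) 2, pow_mul]
          norm_num
        rw [e]
        exact Real.one_le_rpow (Real.one_le_rpow h1 (by norm_num)) hq0.le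
      calc l j = l j * 1 := by ring
        _ ≤ l j * (((4:ℝ) ^ (m + 1)) ^ q * u j ^ (2 * q)) := mul_le_mul_of_nonneg_left h2 (hl0 j)
        _ = _ := by ring
    · exact mul_nonneg (by positivity) (mul_nonneg (hl0 j) (Real.rpow_nonneg (hu0 j) _))
  have main : N (fun j => x j * u j) ^ 2 ≤ 36 * (P * J) := by
    apply dyadic_opt (h.nonneg _) hJ0 hJP
    intro L
    refine (h.dyadic x u hu0 hu1 L).trans (add_le_add ?_ ?_)
    · calc ∑ l ∈ range L, (1 / 2 : ℝ) ^ l *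
          N (proj (univ.filter fun j => (1 / 2 : ℝ) ^ (l + 1) < u j) x)
          ≤ ∑ l ∈ range L, 4 * J * 2 ^ l := by
            refine Finset.sum_le_sum fun m _ => ?_
            refine (mul_le_mul_of_nonneg_left (lev m) (by positivity)).trans (le_of_eq ?_)
            have : (4:ℝ) ^ m = 2 ^ m * 2 ^ m := by rw [← mul_pow]; norm_num
            rw [pow_succ, this]
            field_simp
            rw [← mul_pow]; norm_num
        _ = 4 * J * (2 ^ L - 1) := by
            rw [← Finset.mul_sum, geom_sum_eq (by norm_num)]; norm_num
        _ ≤ 4 * 2 ^ L * J := by nlinarith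
    · exact mul_le_mul_of_nonneg_left hxP (by positivity)
  have := Real.rpow_le_rpow (by positivity) main hq0.le
  rw [Real.mul_rpow (by norm_num) (by positivity), Real.mul_rpow hP0 hJ0, hPq, hJq,
    ← Real.rpow_two, ← Real.rpow_mul (h.nonneg _)] at this
  exact this

theorem LatNorm.concave {k : ℕ} {N : (Fin k → ℝ) → ℝ} (h : LatNorm N) {q C : ℝ} (hq : 1 ≤ q)
    (hC : 1 ≤ C)
    (hlow : ∀ (x : Fin k → ℝ) (c : Fin k → Fin (k + 1)),
      ∑ i, N (proj (univ.filter fun j => c j = i) x) ^ q ≤ C ^ q * N x ^ q)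
    (x : Fin k → ℝ) (m : ℕ) (y : Fin m → Fin k → ℝ)
    (hy : ∀ j, ∑ i, |y i j| ^ (2 * q) ≤ |x j| ^ (2 * q)) :
    (∑ i, N (y i) ^ (2 * q)) ^ (1 / (2 * q)) ≤ 6 * q * C * N x := by
  have hq0 : 0 < q := by linarith
  have h2q : 0 < 2 * q := by linarith
  obtain ⟨l, hl0, hl1, hA⟩ := h.domination hq x (hlow x)
  set Λ := q * (C ^ q * N x ^ q) with hΛ
  have hNx := h.nonneg x
  have hCq : 1 ≤ C ^ q := Real.one_le_rpow hC hq0.le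
  have hNq : 0 ≤ N x ^ q := Real.rpow_nonneg hNx _
  have hΛ0 : 0 ≤ Λ := by positivity
  have hx : N x ^ q ≤ Λ := by
    rw [hΛ, ← mul_assoc]
    exact le_mul_of_one_le_left hNq (by nlinarith)
  set u : Fin m → Fin k → ℝ := fun i j => |y i j| / |x j| with hu
  have hyx : ∀ i j, |y i j| ≤ |x j| := by
    intro i j
    rw [← Real.rpow_le_rpow_iff (abs_nonneg _) (abs_nonneg _) h2q]
    refine le_trans ?_ (hy j)
    exact Finset.single_le_sum (f := fun i => |y i j| ^ (2 * q))
      (fun i _ => Real.rpow_nonneg (abs_nonneg _) _) (Finset.mem_univ i)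
  have hu0 : ∀ i j, 0 ≤ u i j := fun i j => by simp only [hu]; positivity
  have hu1 : ∀ i j, u i j ≤ 1 := fun i j => div_le_one_of_le₀ (hyx i j) (abs_nonneg _)
  have hxu : ∀ i, N (y i) = N (fun j => x j * u i j) := by
    intro i
    apply h.congr_abs
    intro j
    rw [abs_mul, abs_of_nonneg (hu0 i j)]
    simp only [hu]
    by_cases hxj : x j = 0
    · have := hyx i j
      rw [hxj, abs_zero] at this
      rw [hxj]; simp; simpa using this
    · have : |x j| ≠ 0 := by simpa using hxj
      field_simp
  have hus : ∀ j, ∑ i, u i j ^ (2 * q) ≤ 1 := by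
    intro j
    simp only [hu]
    simp_rw [Real.div_rpow (abs_nonneg _) (abs_nonneg _)]
    rw [← Finset.sum_div]
    exact div_le_one_of_le₀ (hy j) (Real.rpow_nonneg (abs_nonneg _) _)
  have tot : ∑ i, N (y i) ^ (2 * q) ≤ (6 * q * C * N x) ^ (2 * q) := by
    calc ∑ i, N (y i) ^ (2 * q) ≤ ∑ i, 36 ^ q * (Λ * ∑ j, l j * u i j ^ (2 * q)) := by
          refine Finset.sum_le_sum fun i _ => ?_
          rw [hxu i]
          exact h.conc_one hq x (u i) l (hu0 i) (hu1 i) hl0 hl1 hx hA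
      _ = 36 ^ q * (Λ * ∑ j, l j * ∑ i, u i j ^ (2 * q)) := by
          rw [← Finset.mul_sum, ← Finset.mul_sum, Finset.sum_comm]
          simp_rw [Finset.mul_sum]
      _ ≤ 36 ^ q * (Λ * Λ) := by
          gcongr
          refine le_trans (Finset.sum_le_sum fun j _ => ?_) hl1
          exact mul_le_of_le_one_right (hl0 j) (hus j)
      _ ≤ 36 ^ q * ((q * C * N x) ^ q * (q * C * N x) ^ q) := by
          have : Λ ≤ (q * C * N x) ^ q := by
            rw [Real.mul_rpow (by positivity) hNx, Real.mul_rpow hq0.le (by linarith), hΛ, ← mul_assoc]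
            gcongr
            calc q = q ^ (1:ℝ) := (Real.rpow_one q).symm
              _ ≤ q ^ q := Real.rpow_le_rpow_of_exponent_le hq hq
          gcongr
      _ = (6 * q * C * N x) ^ (2 * q) := by
          rw [Real.rpow_mul (by positivity), ← Real.mul_rpow (by positivity) (by positivity),
            ← Real.mul_rpow (by positivity) (by positivity)]
          congr 1
          rw [Real.rpow_two]; ring
  calc (∑ i, N (y i) ^ (2 * q)) ^ (1 / (2 * q))
      ≤ ((6 * q * C * N x) ^ (2 * q)) ^ (1 / (2 * q)) :=
        Real.rpow_le_rpow (Finset.sum_nonneg fun i _ => Real.rpow_nonneg (h.nonneg _) _) tot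
          (by positivity)
    _ = 6 * q * C * N x := by
        rw [← Real.rpow_mul (by positivity), mul_one_div_cancel h2q.ne', Real.rpow_one]

theorem lower_est {k : ℕ} {N : (Fin k → ℝ) → ℝ} (h : LatNorm N) {q C : ℝ}
    (hC : 1 ≤ C) (hcot : HasCotype k N q C) (x : Fin k → ℝ) (c : Fin k → Fin (k + 1)) :
    ∑ i, N (proj (univ.filter fun j => c j = i) x) ^ q ≤ C ^ q * N x ^ q := by
  have := hcot (k + 1) (fun i => proj (univ.filter fun j => c j = i) x)
  have e : ∀ σ : Fin (k + 1) → Bool,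
      N (∑ i, (if σ i then (1 : ℝ) else -1) • proj (univ.filter fun j => c j = i) x) = N x := by
    intro σ
    apply h.congr_abs
    intro j
    rw [Finset.sum_apply]
    simp only [Pi.smul_apply, smul_eq_mul, proj, Finset.mem_filter, Finset.mem_univ, true_and,
      mul_ite, mul_zero, Finset.sum_ite_eq, if_true]
    split_ifs <;> simp
  simp only [e] at this
  rw [Finset.sum_const, Finset.card_univ, Fintype.card_fun, Fintype.card_bool, Fintype.card_fin,
    nsmul_eq_mul] at this
  push_cast at this
  have hCq : 0 < C ^ q := Real.rpow_pos_of_pos (by linarith) q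
  rw [← mul_assoc, one_div_mul_cancel (by positivity), one_mul, one_div, inv_mul_le_iff₀ hCq] at this
  exact this

/-- Values competing in the concavified norm. -/
def concSet {k : ℕ} (N : (Fin k → ℝ) → ℝ) (r : ℝ) (x : Fin k → ℝ) : Set ℝ :=
  {s | ∃ (m : ℕ) (y : Fin m → Fin k → ℝ), (∀ j, ∑ i, |y i j| ^ r ≤ |x j| ^ r) ∧
    s = (∑ i, N (y i) ^ r) ^ (1 / r)}

/-- The renorming with concavity constant one. -/
noncomputable def concNorm {k : ℕ} (N : (Fin k → ℝ) → ℝ) (r : ℝ) (x : Fin k → ℝ) : ℝ :=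
  sSup (concSet N r x)

section conc

variable {k : ℕ} {N : (Fin k → ℝ) → ℝ} {r M : ℝ}

theorem concSet_bdd (hM : ∀ x, ∀ s ∈ concSet N r x, s ≤ M * N x) (x : Fin k → ℝ) :
    BddAbove (concSet N r x) := ⟨M * N x, fun s hs => hM x s hs⟩

theorem mem_concSet_self (h : LatNorm N) (hr : 1 ≤ r) (x : Fin k → ℝ) : N x ∈ concSet N r x := by
  refine ⟨1, fun _ => x, fun j => by simp, ?_⟩
  rw [Fin.sum_univ_one, ← Real.rpow_mul (h.nonneg _), mul_one_div_cancel (by linarith), Real.rpow_one]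

theorem le_concNorm (h : LatNorm N) (hr : 1 ≤ r)
    (hM : ∀ x, ∀ s ∈ concSet N r x, s ≤ M * N x) (x : Fin k → ℝ) : N x ≤ concNorm N r x :=
  le_csSup (concSet_bdd hM x) (mem_concSet_self h hr x)

theorem concNorm_le (h : LatNorm N) (hr : 1 ≤ r)
    (hM : ∀ x, ∀ s ∈ concSet N r x, s ≤ M * N x) (x : Fin k → ℝ) : concNorm N r x ≤ M * N x :=
  csSup_le ⟨_, mem_concSet_self h hr x⟩ (hM x)

theorem concSet_nonneg (h : LatNorm N) {x : Fin k → ℝ} {s : ℝ} (hs : s ∈ concSet N r x) : 0 ≤ s := by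
  obtain ⟨m, y, _, rfl⟩ := hs
  exact Real.rpow_nonneg (Finset.sum_nonneg fun i _ => Real.rpow_nonneg (h.nonneg _) _) _

theorem concSet_mono (hr : 1 ≤ r) {x y : Fin k → ℝ} (hxy : ∀ j, |x j| ≤ |y j|) :
    concSet N r x ⊆ concSet N r y := by
  rintro s ⟨m, z, hz, rfl⟩
  exact ⟨m, z, fun j => (hz j).trans (Real.rpow_le_rpow (abs_nonneg _) (hxy j) (by linarith)), rfl⟩

theorem concNorm_mono (h : LatNorm N) (hr : 1 ≤ r)
    (hM : ∀ x, ∀ s ∈ concSet N r x, s ≤ M * N x) {x y : Fin k → ℝ} (hxy : ∀ j, |x j| ≤ |y j|) :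
    concNorm N r x ≤ concNorm N r y :=
  csSup_le_csSup (concSet_bdd hM y) ⟨_, mem_concSet_self h hr x⟩ (concSet_mono hr hxy)

theorem concNorm_smul_le (h : LatNorm N) (hr : 1 ≤ r)
    (hM : ∀ x, ∀ s ∈ concSet N r x, s ≤ M * N x) (c : ℝ) (hc : c ≠ 0) (x : Fin k → ℝ) :
    concNorm N r (c • x) ≤ |c| * concNorm N r x := by
  have hr0 : 0 < r := by linarith
  apply csSup_le ⟨_, mem_concSet_self h hr _⟩
  rintro s ⟨m, y, hy, rfl⟩
  have hc' : 0 < |c| := abs_pos.2 hc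
  have hmem : (∑ i, N (c⁻¹ • y i) ^ r) ^ (1 / r) ∈ concSet N r x := by
    refine ⟨m, fun i => c⁻¹ • y i, fun j => ?_, rfl⟩
    have := hy j
    simp only [Pi.smul_apply, smul_eq_mul, abs_mul, abs_inv] at this ⊢
    simp_rw [Real.mul_rpow (inv_nonneg.2 (abs_nonneg c)) (abs_nonneg _)]
    rw [← Finset.mul_sum, Real.inv_rpow (abs_nonneg _), inv_mul_le_iff₀ (Real.rpow_pos_of_pos hc' r)]
    rwa [Real.mul_rpow (abs_nonneg _) (abs_nonneg _)] at this
  have hle := le_csSup (concSet_bdd hM x) hmem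
  refine le_trans (le_of_eq ?_) (mul_le_mul_of_nonneg_left hle (abs_nonneg c))
  simp_rw [h.hom, abs_inv, Real.mul_rpow (inv_nonneg.2 (abs_nonneg c)) (h.nonneg _)]
  rw [← Finset.mul_sum, Real.mul_rpow (by positivity)
    (Finset.sum_nonneg fun i _ => Real.rpow_nonneg (h.nonneg _) _), ← Real.rpow_mul (by positivity),
    mul_one_div_cancel hr0.ne', Real.rpow_one, ← mul_assoc, mul_inv_cancel₀ hc'.ne', one_mul]

theorem concNorm_lat (h : LatNorm N) (hr : 1 ≤ r)
    (hM : ∀ x, ∀ s ∈ concSet N r x, s ≤ M * N x) : LatNorm (concNorm N r) := by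
  have hr0 : 0 < r := by linarith
  refine ⟨fun c x => ?_, fun u v => ?_, fun x y hxy => concNorm_mono h hr hM hxy⟩
  · by_cases hc : c = 0
    · subst hc
      have h1 := concNorm_le h hr hM (0 : Fin k → ℝ)
      have h2 := le_concNorm h hr hM (0 : Fin k → ℝ)
      rw [h.zero] at h1 h2
      simp; linarith
    · apply le_antisymm (concNorm_smul_le h hr hM c hc x)
      have := concNorm_smul_le h hr hM c⁻¹ (inv_ne_zero hc) (c • x)
      rw [smul_smul, inv_mul_cancel₀ hc, one_smul, abs_inv] at this
      have hc' : 0 < |c| := abs_pos.2 hc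
      rwa [inv_mul_eq_div, le_div_iff₀ hc', mul_comm] at this
  · apply csSup_le ⟨_, mem_concSet_self h hr _⟩
    rintro s ⟨m, y, hy, rfl⟩
    set D : Fin k → ℝ := fun j => |u j| + |v j| with hD
    have hD0 : ∀ j, 0 ≤ D j := fun j => by positivity
    have hyD : ∀ j, ∑ i, |y i j| ^ r ≤ D j ^ r := fun j =>
      (hy j).trans (Real.rpow_le_rpow (abs_nonneg _) (abs_add_le _ _) hr0.le)
    have part : ∀ w : Fin k → ℝ, (∀ j, |w j| ≤ D j) →
        (∑ i, N (fun j => y i j * (|w j| / D j)) ^ r) ^ (1 / r) ≤ concNorm N r w := by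
      intro w hw
      apply le_csSup (concSet_bdd hM w)
      refine ⟨m, _, fun j => ?_, rfl⟩
      simp only [abs_mul, abs_div, abs_abs]
      rw [abs_of_nonneg (hD0 j)]
      simp_rw [Real.mul_rpow (abs_nonneg _) (div_nonneg (abs_nonneg (w j)) (hD0 j))]
      rw [← Finset.sum_mul]
      refine (mul_le_mul_of_nonneg_right (hyD j) (Real.rpow_nonneg (div_nonneg (abs_nonneg _) (hD0 j)) _)).trans ?_
      rw [← Real.mul_rpow (hD0 j) (div_nonneg (abs_nonneg _) (hD0 j))]
      apply Real.rpow_le_rpow (mul_nonneg (hD0 j) (div_nonneg (abs_nonneg _) (hD0 j))) _ hr0.le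
      rcases (hD0 j).eq_or_lt with h0 | hp
      · rw [← h0]; simp
      · rw [mul_div_cancel₀ _ hp.ne']
    have p1 := part u (fun j => by simp [hD])
    have p2 := part v (fun j => by simp [hD])
    have split : ∀ i, N (y i) ≤ N (fun j => y i j * (|u j| / D j)) + N (fun j => y i j * (|v j| / D j)) := by
      intro i
      refine le_trans (le_of_eq ?_) (h.tri _ _)
      congr 1
      funext j
      rw [Pi.add_apply, ← mul_add, ← add_div]
      rcases (hD0 j).eq_or_lt with h0 | hp
      · have := hyD j
        rw [← h0, Real.zero_rpow hr0.ne'] at this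
        have h3 : |y i j| ^ r ≤ 0 := le_trans (Finset.single_le_sum (f := fun i => |y i j| ^ r)
          (fun i _ => Real.rpow_nonneg (abs_nonneg _) _) (Finset.mem_univ i)) this
        have h4 : y i j = 0 := by
          by_contra hne
          have := Real.rpow_pos_of_pos (abs_pos.2 hne) r
          linarith
        rw [h4]; simp
      · have : (|u j| + |v j|) / D j = 1 := div_self hp.ne'
        rw [this, mul_one]
    have mk := Real.Lp_add_le_of_nonneg (univ : Finset (Fin m)) hr
      (f := fun i => N (fun j => y i j * (|u j| / D j)))
      (g := fun i => N (fun j => y i j * (|v j| / D j)))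
      (fun i _ => h.nonneg _) (fun i _ => h.nonneg _)
    refine le_trans ?_ (mk.trans (add_le_add p1 p2))
    apply Real.rpow_le_rpow (Finset.sum_nonneg fun i _ => Real.rpow_nonneg (h.nonneg _) _) _
      (by positivity)
    exact Finset.sum_le_sum fun i _ => Real.rpow_le_rpow (h.nonneg _) (split i) hr0.le

theorem concNorm_conc (h : LatNorm N) (hr : 1 ≤ r)
    (hM : ∀ x, ∀ s ∈ concSet N r x, s ≤ M * N x) {a b c : Fin k → ℝ}
    (habc : ∀ j, |a j| ^ r + |b j| ^ r ≤ |c j| ^ r) :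
    concNorm N r a ^ r + concNorm N r b ^ r ≤ concNorm N r c ^ r := by
  have hr0 : 0 < r := by linarith
  have hP := concNorm_lat h hr hM
  set Q := concNorm N r c ^ r with hQ
  have pw : ∀ z : ℝ, 0 ≤ z → (z ^ (1 / r)) ^ r = z := fun z hz => by
    rw [← Real.rpow_mul hz, one_div_mul_cancel hr0.ne', Real.rpow_one]
  have base : ∀ s1 ∈ concSet N r a, ∀ s2 ∈ concSet N r b, s1 ^ r + s2 ^ r ≤ Q := by
    rintro s1 ⟨m1, y1, hy1, rfl⟩ s2 ⟨m2, y2, hy2, rfl⟩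
    have n1 : 0 ≤ ∑ i, N (y1 i) ^ r := Finset.sum_nonneg fun i _ => Real.rpow_nonneg (h.nonneg _) _
    have n2 : 0 ≤ ∑ i, N (y2 i) ^ r := Finset.sum_nonneg fun i _ => Real.rpow_nonneg (h.nonneg _) _
    have hmem : (∑ i, N (Fin.append y1 y2 i) ^ r) ^ (1 / r) ∈ concSet N r c := by
      refine ⟨m1 + m2, Fin.append y1 y2, fun j => ?_, rfl⟩
      rw [Fin.sum_univ_add]
      simp only [Fin.append_left, Fin.append_right]
      exact (add_le_add (hy1 j) (hy2 j)).trans (habc j)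
    have hle := le_csSup (concSet_bdd hM c) hmem
    have := Real.rpow_le_rpow (concSet_nonneg h hmem) hle hr0.le
    rw [Fin.sum_univ_add] at this
    simp only [Fin.append_left, Fin.append_right] at this
    rw [pw _ (by positivity)] at this
    rw [pw _ n1, pw _ n2]
    exact this
  have step : ∀ (w : Fin k → ℝ) (T : ℝ), (∀ s ∈ concSet N r w, s ^ r ≤ T) → concNorm N r w ^ r ≤ T := by
    intro w T hT
    have hT0 : 0 ≤ T := le_trans (Real.rpow_nonneg (h.nonneg w) r) (hT _ (mem_concSet_self h hr w))
    have : concNorm N r w ≤ T ^ (1 / r) := by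
      apply csSup_le ⟨_, mem_concSet_self h hr w⟩
      intro s hs
      have hs0 := concSet_nonneg h hs
      have := Real.rpow_le_rpow (Real.rpow_nonneg hs0 r) (hT s hs) (show 0 ≤ 1 / r by positivity)
      rwa [← Real.rpow_mul hs0, mul_one_div_cancel hr0.ne', Real.rpow_one] at this
    have := Real.rpow_le_rpow (hP.nonneg w) this hr0.le
    rwa [pw _ hT0] at this
  have s1 : ∀ s2 ∈ concSet N r b, concNorm N r a ^ r ≤ Q - s2 ^ r := fun s2 hs2 =>
    step a _ fun s hs => by linarith [base s hs s2 hs2]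
  have s2 : concNorm N r b ^ r ≤ Q - concNorm N r a ^ r :=
    step b _ fun s hs => by linarith [s1 s hs]
  linarith

end conc

/-- Multiplicative smoothness. -/
def MulSmooth {k : ℕ} (P : (Fin k → ℝ) → ℝ) (r : ℝ) : Prop :=
  ∀ (y s : Fin k → ℝ) (t : ℝ), (∀ j, |s j| = 1) → 0 ≤ t → t ≤ 1 →
    P (fun j => y j * (1 + t * s j)) + P (fun j => y j * (1 - t * s j))
      ≤ 2 * Real.exp (r * t ^ 2 / 2) * P y

theorem concNorm_smooth {k : ℕ} {N : (Fin k → ℝ) → ℝ} {r M : ℝ} (h : LatNorm N) (hr : 1 ≤ r)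
    (hM : ∀ x, ∀ s ∈ concSet N r x, s ≤ M * N x) : MulSmooth (concNorm N r) r := by
  intro y s t hs ht0 ht1
  have hr0 : 0 < r := by linarith
  have hP := concNorm_lat h hr hM
  set a : Fin k → ℝ := fun j => y j * (1 + t * s j) with ha
  set b : Fin k → ℝ := fun j => y j * (1 - t * s j) with hb
  set E := Real.exp (r * t ^ 2 / 2) with hE
  have hE0 : 0 < E := Real.exp_pos _
  set κ : ℝ := 2 ^ (1 / r) * E with hκ
  have hκ0 : 0 < κ := by positivity
  have hκr : κ ^ r = 2 * Real.exp ((r * t) ^ 2 / 2) := by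
    rw [hκ, Real.mul_rpow (by positivity) hE0.le, ← Real.rpow_mul (by norm_num),
      one_div_mul_cancel hr0.ne', Real.rpow_one, hE, ← Real.exp_mul]
    congr 2; ring
  have ex : ∀ z : ℝ, -1 ≤ z → (1 + z) ^ r ≤ Real.exp (r * z) := by
    intro z hz
    have := Real.rpow_le_rpow (by linarith) (show 1 + z ≤ Real.exp z by linarith [Real.add_one_le_exp z]) hr0.le
    rwa [← Real.exp_mul, mul_comm z r] at this
  have hsc : (1 + t) ^ r + (1 - t) ^ r ≤ 2 * Real.exp ((r * t) ^ 2 / 2) := by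
    have h1 := ex t (by linarith)
    have h2 := ex (-t) (by linarith)
    have h3 := Real.cosh_le_exp_half_sq (r * t)
    rw [Real.cosh_eq] at h3
    rw [mul_neg] at h2
    rw [← sub_eq_add_neg] at h2
    linarith
  have conc := concNorm_conc h hr hM (a := a) (b := b) (c := κ • y) (fun j => by
    rw [Pi.smul_apply, smul_eq_mul, abs_mul κ, abs_of_pos hκ0, Real.mul_rpow hκ0.le (abs_nonneg _), hκr]
    simp only [ha, hb]
    rw [abs_mul (y j), abs_mul (y j)]
    have : |s j| = 1 := hs j
    have hab : |1 + t * s j| ^ r + |1 - t * s j| ^ r = (1 + t) ^ r + (1 - t) ^ r := by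
      rcases (abs_eq (by norm_num : (0:ℝ) ≤ 1)).1 this with h1 | h1
      · rw [h1, mul_one, abs_of_nonneg (by linarith), abs_of_nonneg (by linarith)]
      · rw [h1]
        have e1 : 1 + t * (-1) = 1 - t := by ring
        have e2 : 1 - t * (-1) = 1 + t := by ring
        rw [e1, e2, abs_of_nonneg (by linarith), abs_of_nonneg (by linarith), add_comm]
    rw [Real.mul_rpow (abs_nonneg _) (abs_nonneg _), Real.mul_rpow (abs_nonneg _) (abs_nonneg _),
      ← mul_add, hab, mul_comm]
    exact mul_le_mul_of_nonneg_right hsc (Real.rpow_nonneg (abs_nonneg _) _))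
  rw [hP.hom, abs_of_pos hκ0] at conc
  set A := concNorm N r a
  set B := concNorm N r b
  set Y := concNorm N r y
  have hA : 0 ≤ A := hP.nonneg a
  have hB : 0 ≤ B := hP.nonneg b
  have hY : 0 ≤ Y := hP.nonneg y
  have pm := (convexOn_rpow hr).2 (Set.mem_Ici.2 hA) (Set.mem_Ici.2 hB)
    (by norm_num : (0:ℝ) ≤ 1 / 2) (by norm_num : (0:ℝ) ≤ 1 / 2) (by norm_num)
  simp only [smul_eq_mul] at pm
  have k2 : (1 / 2 * A + 1 / 2 * B) ^ r ≤ (E * Y) ^ r := by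
    have e : (κ * Y) ^ r = 2 * (E * Y) ^ r := by
      rw [hκ, mul_assoc, Real.mul_rpow (by positivity) (by positivity), ← Real.rpow_mul (by norm_num),
        one_div_mul_cancel hr0.ne', Real.rpow_one]
    rw [e] at conc
    linarith
  rw [Real.rpow_le_rpow_iff (by positivity) (by positivity) hr0] at k2
  linarith

/-- Modulus of continuity of the map `x ↦ P x • |x| x*`. -/
theorem modulus {k : ℕ} {P : (Fin k → ℝ) → ℝ} {r : ℝ} (h : LatNorm P) (hr : 0 ≤ r)
    (hsm : MulSmooth P r) {x y s s' : Fin k → ℝ}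
    (hx1 : ∀ y : Fin k → ℝ, ∑ j, y j * s j ≤ P y) (hx2 : ∑ j, x j * s j = P x)
    (hy1 : ∀ y : Fin k → ℝ, ∑ j, y j * s' j ≤ P y) (hy2 : ∑ j, y j * s' j = P y)
    {t : ℝ} (ht0 : 0 < t) (ht1 : t ≤ 1) (htr : r * t ^ 2 ≤ 2) :
    ∑ j, |P x * (|x j| * s j) - P y * (|y j| * s' j)| ≤
      P (x - y) * (P x + P y) + 2 * P y ^ 2 * r * t + 2 * P y * P (x - y) / t := by
  set a := P x with ha
  set b := P y with hb
  set ε := P (x - y) with hε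
  have ha0 : 0 ≤ a := h.nonneg x
  have hb0 : 0 ≤ b := h.nonneg y
  have hε0 : 0 ≤ ε := h.nonneg _
  have hε' : P (y - x) = ε := h.congr_abs fun j => by simp [abs_sub_comm]
  have hab : |a - b| ≤ ε := by
    rw [abs_le]
    constructor
    · have := h.tri (y - x) x
      rw [sub_add_cancel, hε'] at this
      linarith
    · have := h.tri (x - y) y
      rw [sub_add_cancel] at this
      linarith
  have pt : ∀ j, |a * (|x j| * s j) - b * (|y j| * s' j)| ≤
      ε * (x j * s j) + b * (|(x - y) j| * |s j|) + b * (|y j| * |s j - s' j|) := by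
    intro j
    have e : a * (|x j| * s j) - b * (|y j| * s' j) = (a - b) * (|x j| * s j)
      + b * ((|x j| - |y j|) * s j) + b * (|y j| * (s j - s' j)) := by ring
    rw [e]
    refine (abs_add_le _ _).trans (add_le_add ((abs_add_le _ _).trans (add_le_add ?_ ?_)) ?_)
    · rw [abs_mul, abs_mul, abs_abs, ← abs_mul (x j), abs_of_nonneg (h.norming_sign hx1 hx2 j)]
      exact mul_le_mul_of_nonneg_right hab (h.norming_sign hx1 hx2 j)
    · rw [abs_mul, abs_of_nonneg hb0, abs_mul]
      exact mul_le_mul_of_nonneg_left (mul_le_mul_of_nonneg_right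
        (abs_abs_sub_abs_le_abs_sub _ _) (abs_nonneg _)) hb0
    · rw [abs_mul, abs_of_nonneg hb0, abs_mul, abs_abs]
  have t1 : ∑ j, |(x - y) j| * |s j| ≤ ε := h.abs_pair hx1 _
  -- third term
  set σ : Fin k → ℝ := fun j => if 0 ≤ y j * (s j - s' j) then 1 else -1 with hσ
  have hσ1 : ∀ j, |σ j| = 1 := fun j => by simp only [hσ]; split_ifs <;> simp
  have e3 : ∀ j, |y j| * |s j - s' j| = y j * σ j * s j - y j * σ j * s' j := by
    intro j
    rw [← abs_mul]
    simp only [hσ]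
    split_ifs with hh
    · rw [abs_of_nonneg hh]; ring
    · rw [abs_of_neg (not_le.1 hh)]; ring
  set U := ∑ j, y j * σ j * s j with hU
  set V := ∑ j, y j * σ j * s' j with hV
  have t3 : ∑ j, |y j| * |s j - s' j| = U - V := by
    rw [hU, hV, ← Finset.sum_sub_distrib]
    exact Finset.sum_congr rfl fun j _ => e3 j
  have sm := hsm y σ t hσ1 ht0.le ht1
  have l1 := hx1 (fun j => y j * (1 + t * σ j))
  have l2 := hy1 (fun j => y j * (1 - t * σ j))
  have f1 : ∑ j, y j * (1 + t * σ j) * s j = ∑ j, y j * s j + t * U := by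
    rw [hU, Finset.mul_sum, ← Finset.sum_add_distrib]
    exact Finset.sum_congr rfl fun j _ => by ring
  have f2 : ∑ j, y j * (1 - t * σ j) * s' j = b - t * V := by
    rw [hV, Finset.mul_sum, ← hy2, ← Finset.sum_sub_distrib]
    exact Finset.sum_congr rfl fun j _ => by ring
  have f3 : a - ε ≤ ∑ j, y j * s j := by
    have := hx1 (x - y)
    have e : ∑ j, (x - y) j * s j = a - ∑ j, y j * s j := by
      rw [← hx2, ← Finset.sum_sub_distrib]
      exact Finset.sum_congr rfl fun j _ => by rw [Pi.sub_apply]; ring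
    rw [e] at this
    linarith
  have hexp : Real.exp (r * t ^ 2 / 2) ≤ 1 + r * t ^ 2 := by
    have hz0 : 0 ≤ r * t ^ 2 / 2 := by positivity
    have := Real.abs_exp_sub_one_le (x := r * t ^ 2 / 2) (by rw [abs_of_nonneg hz0]; linarith)
    rw [abs_of_nonneg hz0] at this
    linarith [le_abs_self (Real.exp (r * t ^ 2 / 2) - 1)]
  have hb2 : 2 * Real.exp (r * t ^ 2 / 2) * b ≤ 2 * (1 + r * t ^ 2) * b := by gcongr
  have hba : b - a ≤ ε := by linarith [(abs_le.1 hab).1]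
  have huv : t * (U - V) ≤ 2 * b * r * t ^ 2 + 2 * ε := by nlinarith
  have huv' : U - V ≤ 2 * b * r * t + 2 * ε / t := by
    have : U - V ≤ (2 * b * r * t ^ 2 + 2 * ε) / t := by
      rw [le_div_iff₀ ht0]; linarith
    refine this.trans (le_of_eq ?_)
    field_simp
  calc ∑ j, |a * (|x j| * s j) - b * (|y j| * s' j)|
      ≤ ∑ j, (ε * (x j * s j) + b * (|(x - y) j| * |s j|) + b * (|y j| * |s j - s' j|)) :=
        Finset.sum_le_sum fun j _ => pt j
    _ = ε * a + b * ∑ j, |(x - y) j| * |s j| + b * (U - V) := by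
        rw [Finset.sum_add_distrib, Finset.sum_add_distrib, ← Finset.mul_sum, ← Finset.mul_sum,
          ← Finset.mul_sum, hx2, t3]
    _ ≤ ε * a + b * ε + b * (2 * b * r * t + 2 * ε / t) := by gcongr
    _ = ε * (a + b) + 2 * b ^ 2 * r * t + 2 * b * ε / t := by ring

theorem modulus' {k : ℕ} {P : (Fin k → ℝ) → ℝ} {r : ℝ} (h : LatNorm P) (hr : 4 ≤ r)
    (hsm : MulSmooth P r) {x y s s' : Fin k → ℝ}
    (hx1 : ∀ y : Fin k → ℝ, ∑ j, y j * s j ≤ P y) (hx2 : ∑ j, x j * s j = P x)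
    (hy1 : ∀ y : Fin k → ℝ, ∑ j, y j * s' j ≤ P y) (hy2 : ∑ j, y j * s' j = P y)
    {t : ℝ} (ht0 : 0 < t) (ht1 : t ≤ 1) (htr : r * t ^ 2 ≤ 2) :
    ∑ j, |P x * (|x j| * s j) - P y * (|y j| * s' j)| ≤
      4 * r * t * (P x ^ 2 + P y ^ 2) + P (x - y) ^ 2 / t ^ 3 := by
  refine (modulus h (by linarith) hsm hx1 hx2 hy1 hy2 ht0 ht1 htr).trans ?_
  set a := P x with ha
  set b := P y with hb
  set ε := P (x - y) with hε
  have ha0 : 0 ≤ a := h.nonneg x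
  have hb0 : 0 ≤ b := h.nonneg y
  have hε0 : 0 ≤ ε := h.nonneg _
  set w := ε / t with hw
  have hεw : ε = w * t := by rw [hw]; field_simp
  have hw0 : 0 ≤ w := by positivity
  have e1 : 2 * b * ε / t = 2 * b * w := by rw [hw]; ring
  have e2 : ε ^ 2 / t ^ 3 = w ^ 2 / t := by rw [hw]; field_simp
  rw [e1, e2, hεw]
  set z := w / t with hz
  have hwz : w = z * t := by rw [hz]; field_simp
  have e3 : w ^ 2 / t = z ^ 2 * t := by rw [hz]; field_simp
  have hz0 : 0 ≤ z := by positivity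
  rw [e3, hwz]
  -- goal polynomial: z t t (a+b) + 2 b^2 r t + 2 b z t ≤ 4 r t (a^2+b^2) + z^2 t
  have g1 : z * t * (a + b) ≤ z * (a + b) := by
    have : z * (a + b) * t ≤ z * (a + b) * 1 := mul_le_mul_of_nonneg_left ht1 (by positivity)
    linarith
  have g2 : z * (a + b) + 2 * b ^ 2 * r + 2 * b * z ≤ 4 * r * (a ^ 2 + b ^ 2) + z ^ 2 := by
    have : 16 * a ^ 2 ≤ 4 * r * a ^ 2 := by nlinarith [sq_nonneg a]
    have : 8 * b ^ 2 ≤ 2 * r * b ^ 2 := by nlinarith [sq_nonneg b]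
    nlinarith [sq_nonneg (z / 2 - a), sq_nonneg (z - 2 * b), sq_nonneg (z - 3 * b - a),
      sq_nonneg (z / 2 - 3 * b), sq_nonneg a, sq_nonneg b, sq_nonneg (a - b)]
  calc z * t * t * (a + b) + 2 * b ^ 2 * r * t + 2 * b * (z * t)
      = t * (z * t * (a + b) + 2 * b ^ 2 * r + 2 * b * z) := by ring
    _ ≤ t * (4 * r * (a ^ 2 + b ^ 2) + z ^ 2) := mul_le_mul_of_nonneg_left (by linarith) ht0.le
    _ = _ := by ring

/-- Signed square root. -/
noncomputable def ssq (z : ℝ) : ℝ := if 0 ≤ z then √z else -√(-z)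

theorem ssq_sq (z : ℝ) : ssq z ^ 2 = |z| := by
  unfold ssq
  split_ifs with hz
  · rw [Real.sq_sqrt hz, abs_of_nonneg hz]
  · have := not_le.1 hz
    rw [neg_sq, Real.sq_sqrt (by linarith), abs_of_neg this]

theorem ssq_pos {z : ℝ} (h : 0 < ssq z) : 0 < z := by
  unfold ssq at h
  split_ifs at h with hz
  · exact Real.sqrt_pos.1 h
  · linarith [Real.sqrt_nonneg (-z)]

theorem ssq_neg {z : ℝ} (h : ssq z < 0) : z < 0 := by
  unfold ssq at h
  split_ifs at h with hz
  · linarith [Real.sqrt_nonneg z]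
  · exact not_le.1 hz

theorem ssq_sub (a b : ℝ) : (ssq a - ssq b) ^ 2 ≤ 2 * |a - b| := by
  unfold ssq
  have key : ∀ a b : ℝ, 0 ≤ a → 0 ≤ b → (√a - √b) ^ 2 ≤ |a - b| := by
    intro a b ha hb
    have h1 := Real.sqrt_nonneg a
    have h2 := Real.sqrt_nonneg b
    have h3 := Real.sq_sqrt ha
    have h4 := Real.sq_sqrt hb
    rw [← h3, ← h4, Real.sqrt_sq h1, Real.sqrt_sq h2]
    rcases le_total (√a) (√b) with h | h
    · rw [abs_of_nonpos (by nlinarith)]; nlinarith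
    · rw [abs_of_nonneg (by nlinarith)]; nlinarith
  split_ifs with ha hb hb
  · linarith [key a b ha hb, abs_nonneg (a - b)]
  · have hb' := not_le.1 hb
    have h3 := Real.sq_sqrt ha
    have h4 := Real.sq_sqrt (show 0 ≤ -b by linarith)
    rw [abs_of_nonneg (by linarith)]
    nlinarith [sq_nonneg (√a - √(-b))]
  · have ha' := not_le.1 ha
    have h3 := Real.sq_sqrt hb
    have h4 := Real.sq_sqrt (show 0 ≤ -a by linarith)
    rw [abs_of_nonpos (by linarith)]
    nlinarith [sq_nonneg (√b - √(-a))]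
  · have ha' := not_le.1 ha
    have hb' := not_le.1 hb
    have := key (-b) (-a) (by linarith) (by linarith)
    have e : -b - -a = a - b := by ring
    rw [e] at this
    have e2 : (-√(-a) - -√(-b)) = √(-b) - √(-a) := by ring
    rw [e2]
    linarith [abs_nonneg (a - b)]

/-- Medians. -/
theorem exists_median {n : ℕ} (hn : 0 < n) (y : Fin n → ℝ) :
    ∃ z : ℝ, 2 * (univ.filter fun v => z < y v).card ≤ n ∧
      2 * (univ.filter fun v => y v < z).card ≤ n := by
  haveI : Nonempty (Fin n) := ⟨⟨0, hn⟩⟩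
  set T := univ.filter fun v : Fin n => 2 * (univ.filter fun w => y v < y w).card ≤ n with hT
  have hTne : T.Nonempty := by
    obtain ⟨v, hv⟩ := Finite.exists_max y
    refine ⟨v, ?_⟩
    simp only [hT, Finset.mem_filter, Finset.mem_univ, true_and]
    rw [Finset.filter_false_of_mem (fun w _ => not_lt.2 (hv w))]
    simp
  obtain ⟨v, hvT, hv⟩ := Finset.exists_min_image T y hTne
  refine ⟨y v, by simpa [hT] using hvT, ?_⟩
  by_contra! hcon
  have hne : (univ.filter fun w => y w < y v).Nonempty := by
    rw [← Finset.card_pos]; omega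
  obtain ⟨u, huS, hu⟩ := Finset.exists_max_image _ y hne
  have huv : y u < y v := by simpa using huS
  have huT : u ∈ T := by
    simp only [hT, Finset.mem_filter, Finset.mem_univ, true_and]
    have hsub : (univ.filter fun w => y u < y w) ⊆ (univ.filter fun w => y w < y v)ᶜ := by
      intro w hw
      simp only [Finset.mem_filter, Finset.mem_univ, true_and, Finset.mem_compl, not_lt] at hw ⊢
      by_contra! hlt
      have := hu w (by simpa using hlt)
      linarith
    have := Finset.card_le_card hsub
    rw [Finset.card_compl, Fintype.card_fin] at this
    omega
  have := hv u huT
  linarith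

/-- If `y` has median zero then its second moment is at most three times the variance. -/
theorem med_var {n : ℕ} (hn : 0 < n) (y : Fin n → ℝ)
    (h1 : 2 * (univ.filter fun v => 0 < y v).card ≤ n)
    (h2 : 2 * (univ.filter fun v => y v < 0).card ≤ n) (m : ℝ) (hm : ∑ v, y v = n * m) :
    ∑ v, y v ^ 2 ≤ 3 * ∑ v, (y v - m) ^ 2 := by
  have hvar : ∑ v, (y v - m) ^ 2 = ∑ v, y v ^ 2 - n * m ^ 2 := by
    have : ∀ v, (y v - m) ^ 2 = y v ^ 2 - 2 * m * y v + m ^ 2 := fun v => by ring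
    simp_rw [this]
    rw [Finset.sum_add_distrib, Finset.sum_sub_distrib, ← Finset.mul_sum, hm]
    simp; ring
  have gen : ∀ A : Finset (Fin n), 2 * A.card ≤ n → (∀ v ∉ A, m ^ 2 ≤ (y v - m) ^ 2) →
      n * m ^ 2 ≤ 2 * ∑ v, (y v - m) ^ 2 := by
    intro A hA hv
    have s1 : ∑ v ∈ Aᶜ, m ^ 2 ≤ ∑ v, (y v - m) ^ 2 := by
      refine (Finset.sum_le_sum fun v hv' => hv v (by simpa using hv')).trans ?_
      exact Finset.sum_le_sum_of_subset_of_nonneg (Finset.subset_univ _) fun _ _ _ => sq_nonneg _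
    rw [Finset.sum_const, nsmul_eq_mul] at s1
    have hc : (n:ℝ) ≤ 2 * (Aᶜ.card : ℝ) := by
      have : n ≤ 2 * Aᶜ.card := by rw [Finset.card_compl, Fintype.card_fin]; omega
      exact_mod_cast this
    nlinarith [sq_nonneg m]
  have : n * m ^ 2 ≤ 2 * ∑ v, (y v - m) ^ 2 := by
    rcases le_total 0 m with h | h
    · refine gen _ h1 fun v hv => ?_
      have : y v ≤ 0 := by simpa using hv
      nlinarith
    · refine gen _ h2 fun v hv => ?_
      have : 0 ≤ y v := by simpa using hv
      nlinarith
  linarith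

theorem edge_sum {n : ℕ} (G : SimpleGraph (Fin n)) [DecidableRel G.Adj] (F : Sym2 (Fin n) → ℝ) :
    ∑ v, ∑ w, (if G.Adj v w then F s(v, w) else 0) = 2 * ∑ e ∈ G.edgeFinset, F e := by
  rw [← Fintype.sum_prod_type' (f := fun v w => if G.Adj v w then F s(v, w) else 0)]
  rw [← Finset.sum_filter]
  rw [← Finset.sum_fiberwise_of_maps_to (t := G.edgeFinset) (g := fun p : Fin n × Fin n => s(p.1, p.2))
    (by intro p hp; simpa using hp), Finset.mul_sum]
  refine Finset.sum_congr rfl fun e he => ?_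
  induction e using Sym2.ind with
  | _ a b =>
    have hab : G.Adj a b := by simpa using he
    have : (univ.filter fun p : Fin n × Fin n => G.Adj p.1 p.2).filter (fun p => s(p.1, p.2) = s(a, b))
        = {(a, b), (b, a)} := by
      ext ⟨u, w⟩
      simp only [Finset.mem_filter, Finset.mem_univ, true_and, Sym2.eq_iff, Finset.mem_insert,
        Finset.mem_singleton, Prod.mk.injEq]
      constructor
      · rintro ⟨_, h⟩; exact h
      · rintro (⟨rfl, rfl⟩ | ⟨rfl, rfl⟩)
        · exact ⟨hab, Or.inl ⟨rfl, rfl⟩⟩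
        · exact ⟨hab.symm, Or.inr ⟨rfl, rfl⟩⟩
    rw [this, Finset.sum_pair (by simp [hab.ne])]
    rw [Sym2.eq_swap (a := b) (b := a)]
    ring

theorem deg_sum {n d : ℕ} (G : SimpleGraph (Fin n)) [DecidableRel G.Adj]
    (hreg : ∀ v, G.degree v = d) (v : Fin n) (c : ℝ) :
    ∑ w, (if G.Adj v w then c else 0) = d * c := by
  rw [← Finset.sum_filter, Finset.sum_const, nsmul_eq_mul, ← hreg v, ← SimpleGraph.card_neighborFinset_eq_degree,
    SimpleGraph.neighborFinset_eq_filter]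

theorem dirichlet {n d : ℕ} (G : SimpleGraph (Fin n)) [DecidableRel G.Adj]
    (hreg : ∀ v, G.degree v = d) (y : Fin n → ℝ) :
    ∑ v, ∑ w, (if G.Adj v w then (y v - y w) ^ 2 else 0) =
      2 * (d * ∑ v, y v ^ 2) - 2 * ∑ i, (G.adjMatrix ℝ).mulVec y i * y i := by
  have e1 : ∀ v w, (if G.Adj v w then (y v - y w) ^ 2 else 0) =
      (if G.Adj v w then y v ^ 2 else 0) + (if G.Adj w v then y w ^ 2 else 0)
        - 2 * ((if G.Adj v w then 1 else 0) * y w * y v) := by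
    intro v w
    by_cases h : G.Adj v w
    · simp [h, h.symm]; ring
    · have h' : ¬ G.Adj w v := fun hh => h hh.symm
      simp [h, h']
  simp_rw [e1, Finset.sum_sub_distrib, Finset.sum_add_distrib]
  rw [Finset.sum_comm (f := fun v w => if G.Adj w v then y w ^ 2 else 0)]
  simp_rw [deg_sum G hreg, ← Finset.mul_sum]
  have e2 : ∀ i, (G.adjMatrix ℝ).mulVec y i * y i = ∑ w, (if G.Adj i w then 1 else 0) * y w * y i := by
    intro i
    simp only [Matrix.mulVec, dotProduct, SimpleGraph.adjMatrix_apply]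
    rw [Finset.sum_mul]
  simp_rw [e2]
  ring

theorem scalar_poinc {n d : ℕ} (hn : 0 < n) (G : SimpleGraph (Fin n)) [DecidableRel G.Adj]
    (hreg : ∀ v, G.degree v = d) (lam2 : ℝ) (hlam : lam2 < d)
    (hspec : ∀ y : Fin n → ℝ, ∑ i, y i = 0 →
      ∑ i, (G.adjMatrix ℝ).mulVec y i * y i ≤ lam2 * ∑ i, y i ^ 2)
    (y : Fin n → ℝ) (h1 : 2 * (univ.filter fun v => 0 < y v).card ≤ n)
    (h2 : 2 * (univ.filter fun v => y v < 0).card ≤ n) :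
    (d - lam2) * ∑ v, y v ^ 2 ≤ 3 / 2 * ∑ v, ∑ w, (if G.Adj v w then (y v - y w) ^ 2 else 0) := by
  have hn' : (n : ℝ) ≠ 0 := by positivity
  set m : ℝ := (∑ v, y v) / n with hm
  have hm' : ∑ v, y v = n * m := by rw [hm]; field_simp
  have a := med_var hn y h1 h2 m hm'
  have b := hspec (fun v => y v - m) (by simp [Finset.sum_sub_distrib, hm'])
  have c := dirichlet G hreg (fun v => y v - m)
  simp only [sub_sub_sub_cancel_right] at c
  rw [c]
  have := mul_le_mul_of_nonneg_left a (sub_nonneg.2 hlam.le)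
  nlinarith

theorem lam2_ge {n d : ℕ} (hn : 0 < n) (hd : 3 ≤ d) (G : SimpleGraph (Fin n)) [DecidableRel G.Adj]
    (hreg : ∀ v, G.degree v = d) (lam2 : ℝ)
    (hspec : ∀ y : Fin n → ℝ, ∑ i, y i = 0 →
      ∑ i, (G.adjMatrix ℝ).mulVec y i * y i ≤ lam2 * ∑ i, y i ^ 2) : -1 ≤ lam2 := by
  have hu : 0 < G.degree ⟨0, hn⟩ := by rw [hreg]; omega
  obtain ⟨w, hw⟩ := (G.degree_pos_iff_exists_adj _).1 hu
  set u : Fin n := ⟨0, hn⟩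
  have hne := hw.ne
  have b := hspec (Pi.single u 1 - Pi.single w 1) (by simp)
  have e1 : ∑ i, ((Pi.single u (1:ℝ) - Pi.single w 1 : Fin n → ℝ) i) ^ 2 = 2 := by
    have : ∀ i, ((Pi.single u (1:ℝ) - Pi.single w 1 : Fin n → ℝ) i) ^ 2 =
        (Pi.single u (1:ℝ) : Fin n → ℝ) i + (Pi.single w (1:ℝ) : Fin n → ℝ) i := by
      intro i
      simp only [Pi.sub_apply, Pi.single_apply]
      by_cases h1 : i = u <;> by_cases h2 : i = w <;> simp [h1, h2]
      · exact absurd (h1.symm.trans h2) hne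
      · simp [hne]
      · simp [hne.symm]
    simp_rw [this, Finset.sum_add_distrib]
    simp; norm_num
  have e2 : ∑ i, (G.adjMatrix ℝ).mulVec (Pi.single u 1 - Pi.single w 1) i *
      (Pi.single u (1:ℝ) - Pi.single w 1 : Fin n → ℝ) i = -2 := by
    have : ∀ i, (G.adjMatrix ℝ).mulVec (Pi.single u 1 - Pi.single w 1) i = 
       (if G.Adj i u then 1 else 0) - (if G.Adj i w then 1 else 0) := by
      intro i
      rw [Matrix.mulVec_sub]
      simp [SimpleGraph.adjMatrix_apply]
    simp_rw [this, Pi.sub_apply, mul_sub, Finset.sum_sub_distrib, Pi.single_apply]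
    simp [hw, hw.symm]; norm_num
  rw [e1, e2] at b
  linarith

theorem edgeNorm_mk {n k : ℕ} {N : (Fin k → ℝ) → ℝ} (h : LatNorm N) (f : Fin n → Fin k → ℝ)
    (a b : Fin n) : edgeNorm N f s(a, b) = N (f a - f b) := by
  have : N (f b - f a) = N (f a - f b) := h.congr_abs (fun j => by simp [abs_sub_comm])
  simp [edgeNorm, this]


theorem core {n d k : ℕ} (hn : 0 < n) (hd : 3 ≤ d) (G : SimpleGraph (Fin n)) [DecidableRel G.Adj]
    (hreg : ∀ v, G.degree v = d) (lam2 : ℝ) (hlam : lam2 < d)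
    (hspec : ∀ y : Fin n → ℝ, ∑ i, y i = 0 →
      ∑ i, (G.adjMatrix ℝ).mulVec y i * y i ≤ lam2 * ∑ i, y i ^ 2)
    {P : (Fin k → ℝ) → ℝ} {r : ℝ} (h : LatNorm P) (hr : 4 ≤ r) (hsm : MulSmooth P r)
    (f : Fin n → Fin k → ℝ) :
    ∃ z : Fin k → ℝ, (d - lam2) * ∑ v, P (f v - z) ^ 2 ≤
      6 * (48 * r * (d / (d - lam2))) ^ 3 *
        ∑ v, ∑ w, (if G.Adj v w then P (f v - f w) ^ 2 else 0) := by
  have hlam1 := lam2_ge hn hd G hreg lam2 hspec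
  have hd' : (3 : ℝ) ≤ d := by exact_mod_cast hd
  have hdl : 0 < (d : ℝ) - lam2 := by linarith
  set γ : ℝ := d / (d - lam2) with hγ
  have hγ1 : 3 / 4 ≤ γ := by
    rw [hγ, le_div_iff₀ hdl]; linarith
  have hγd : γ * (d - lam2) = d := by rw [hγ]; field_simp
  choose z hz1 hz2 using fun j => exists_median hn (fun v => f v j)
  refine ⟨z, ?_⟩
  choose s hs1 hs2 using fun v => h.norming (f v - z)
  set φ : Fin n → Fin k → ℝ := fun v j => P (f v - z) * (|(f v - z) j| * s v j) with hφ
  have hsg : ∀ v j, 0 ≤ (f v - z) j * s v j := fun v j => h.norming_sign (hs1 v) (hs2 v) j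
  have hP0 : ∀ v, 0 ≤ P (f v - z) := fun v => h.nonneg _
  have hpos : ∀ v j, 0 < φ v j → z j < f v j := by
    intro v j hv
    have h2 : 0 < s v j := by
      by_contra hc
      have : φ v j ≤ 0 := mul_nonpos_of_nonneg_of_nonpos (hP0 v)
        (mul_nonpos_of_nonneg_of_nonpos (abs_nonneg _) (not_lt.1 hc))
      linarith
    have h3 : (f v - z) j ≠ 0 := by
      intro hc; simp only [hφ] at hv; rw [hc] at hv; simp at hv
    have h4 := nonneg_of_mul_nonneg_left (hsg v j) h2
    have h5 := lt_of_le_of_ne h4 h3.symm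
    simpa using h5
  have hneg : ∀ v j, φ v j < 0 → f v j < z j := by
    intro v j hv
    have h2 : s v j < 0 := by
      by_contra hc
      have : 0 ≤ φ v j := mul_nonneg (hP0 v) (mul_nonneg (abs_nonneg _) (not_lt.1 hc))
      linarith
    have h3 : (f v - z) j ≠ 0 := by
      intro hc; simp only [hφ] at hv; rw [hc] at hv; simp at hv
    have h4 : (f v - z) j ≤ 0 := by
      by_contra hc
      have := mul_neg_of_pos_of_neg (not_le.1 hc) h2
      linarith [hsg v j]
    have h5 := lt_of_le_of_ne h4 h3
    simpa using h5
  have hsum : ∀ v, ∑ j, ssq (φ v j) ^ 2 = P (f v - z) ^ 2 := by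
    intro v
    have : ∀ j, ssq (φ v j) ^ 2 = P (f v - z) * ((f v - z) j * s v j) := by
      intro j
      rw [ssq_sq, abs_mul, abs_mul, abs_abs, abs_of_nonneg (hP0 v), ← abs_mul, abs_of_nonneg (hsg v j)]
    simp_rw [this, ← Finset.mul_sum]
    rw [hs2 v]; ring
  have hsc : ∀ j, (d - lam2) * ∑ v, ssq (φ v j) ^ 2 ≤
      3 / 2 * ∑ v, ∑ w, (if G.Adj v w then (ssq (φ v j) - ssq (φ w j)) ^ 2 else 0) := by
    intro j
    apply scalar_poinc hn G hreg lam2 hlam hspec (fun v => ssq (φ v j))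
    · refine le_trans (Nat.mul_le_mul_left 2 (Finset.card_le_card ?_)) (hz1 j)
      intro v hv
      simp only [Finset.mem_filter, Finset.mem_univ, true_and] at hv ⊢
      exact hpos v j (ssq_pos hv)
    · refine le_trans (Nat.mul_le_mul_left 2 (Finset.card_le_card ?_)) (hz2 j)
      intro v hv
      simp only [Finset.mem_filter, Finset.mem_univ, true_and] at hv ⊢
      exact hneg v j (ssq_neg hv)
  set K : ℝ := 48 * r * γ with hK
  have hK1 : 36 * r ≤ K := by rw [hK]; nlinarith
  have hK0 : 0 < K := by linarith
  set t : ℝ := 1 / K with ht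
  have ht0 : 0 < t := by positivity
  have hrt : r * t ≤ 1 := by
    rw [ht, mul_one_div, div_le_one hK0]; linarith
  have ht1 : t ≤ 1 := by nlinarith
  have htr : r * t ^ 2 ≤ 2 := by nlinarith
  have hpair : ∀ v w, ∑ j, (ssq (φ v j) - ssq (φ w j)) ^ 2 ≤
      8 * r * t * (P (f v - z) ^ 2 + P (f w - z) ^ 2) + 2 * K ^ 3 * P (f v - f w) ^ 2 := by
    intro v w
    have := modulus' h hr hsm (hs1 v) (hs2 v) (hs1 w) (hs2 w) ht0 ht1 htr
    rw [sub_sub_sub_cancel_right] at this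
    have e : P (f v - f w) ^ 2 / t ^ 3 = K ^ 3 * P (f v - f w) ^ 2 := by
      rw [ht]; field_simp
    rw [e] at this
    calc _ ≤ ∑ j, 2 * |φ v j - φ w j| := Finset.sum_le_sum fun j _ => ssq_sub _ _
      _ = 2 * ∑ j, |φ v j - φ w j| := by rw [Finset.mul_sum]
      _ ≤ _ := by linarith
  set S := ∑ v, P (f v - z) ^ 2 with hS
  set A := ∑ v, ∑ w, (if G.Adj v w then P (f v - f w) ^ 2 else 0) with hA
  have t1 : (d - lam2) * S ≤ 3 / 2 * ∑ v, ∑ w,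
      (if G.Adj v w then ∑ j, (ssq (φ v j) - ssq (φ w j)) ^ 2 else 0) := by
    have e1 : (d - lam2) * S = ∑ j, (d - lam2) * ∑ v, ssq (φ v j) ^ 2 := by
      rw [← Finset.mul_sum, Finset.sum_comm]; simp_rw [hsum]; rfl
    have e2 : ∑ v, ∑ w, (if G.Adj v w then ∑ j, (ssq (φ v j) - ssq (φ w j)) ^ 2 else 0) =
       ∑ j, ∑ v, ∑ w, (if G.Adj v w then (ssq (φ v j) - ssq (φ w j)) ^ 2 else 0) := by
      rw [Finset.sum_comm (s := (univ : Finset (Fin k)))]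
      refine Finset.sum_congr rfl fun v _ => ?_
      rw [Finset.sum_comm (s := (univ : Finset (Fin k)))]
      refine Finset.sum_congr rfl fun w _ => ?_
      split_ifs <;> simp
    rw [e1, e2, Finset.mul_sum]
    exact Finset.sum_le_sum fun j _ => hsc j
  have t2 : ∑ v, ∑ w, (if G.Adj v w then ∑ j, (ssq (φ v j) - ssq (φ w j)) ^ 2 else 0) ≤
      16 * r * t * d * S + 2 * K ^ 3 * A := by
    calc _ ≤ ∑ v, ∑ w, ((if G.Adj v w then 8 * r * t * P (f v - z) ^ 2 else 0)
          + (if G.Adj w v then 8 * r * t * P (f w - z) ^ 2 else 0)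
          + 2 * K ^ 3 * (if G.Adj v w then P (f v - f w) ^ 2 else 0)) := by
          refine Finset.sum_le_sum fun v _ => Finset.sum_le_sum fun w _ => ?_
          by_cases hvw : G.Adj v w
          · simp only [hvw, hvw.symm, if_true]
            linarith [hpair v w]
          · have h' : ¬ G.Adj w v := fun hh => hvw hh.symm
            simp [hvw, h']
      _ = _ := by
          simp_rw [Finset.sum_add_distrib]
          rw [Finset.sum_comm (f := fun v w => if G.Adj w v then 8 * r * t * P (f w - z) ^ 2 else 0)]
          simp_rw [deg_sum G hreg, ← Finset.mul_sum]
          rw [← hS, ← hA]; ring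
  have t3 : 48 * r * t * d = d - lam2 := by
    have : d = γ * (d - lam2) := hγd.symm
    have hKt : K * t = 1 := by rw [ht]; field_simp
    calc 48 * r * t * d = (48 * r * γ) * t * (d - lam2) := by
          linear_combination (-(48 * r * t)) * hγd
      _ = _ := by rw [← hK, hKt, one_mul]
  have t4 : 16 * r * t * d * S = (d - lam2) * S / 3 := by rw [← t3]; ring
  linarith

theorem final_const {q C γ : ℝ} (hq : 2 ≤ q) (hC : 1 ≤ C) (hγ : 3 / 4 ≤ γ) :
    24 * 48 ^ 3 * 8 * 36 * q ^ 5 * C ^ 2 * γ ^ 4 ≤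
      (2 : ℝ) ^ (3616 * q + 450) * q ^ (384 * q + 104) * C ^ (129 * q + 4) * γ ^ 8 := by
  have h1 : (2 : ℝ) ^ 32 ≤ (2 : ℝ) ^ (3616 * q + 450) := by
    rw [← Real.rpow_natCast]
    exact Real.rpow_le_rpow_of_exponent_le (by norm_num) (by push_cast; linarith)
  have h2 : q ^ 5 ≤ q ^ (384 * q + 104) := by
    rw [← Real.rpow_natCast]
    exact Real.rpow_le_rpow_of_exponent_le (by linarith) (by push_cast; linarith)
  have h3 : C ^ 2 ≤ C ^ (129 * q + 4) := by
    rw [← Real.rpow_natCast]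
    exact Real.rpow_le_rpow_of_exponent_le (by linarith) (by push_cast; linarith)
  have h4 : (3 / 4 : ℝ) ^ 4 ≤ γ ^ 4 := by gcongr
  have hq0 : 0 < q := by linarith
  have hC0 : 0 < C := by linarith
  have hγ0 : 0 < γ := by linarith
  calc 24 * 48 ^ 3 * 8 * 36 * q ^ 5 * C ^ 2 * γ ^ 4
      ≤ (2 ^ 32 * (3 / 4 : ℝ) ^ 4) * q ^ 5 * C ^ 2 * γ ^ 4 := by
        have : (24 * 48 ^ 3 * 8 * 36 : ℝ) ≤ 2 ^ 32 * (3 / 4 : ℝ) ^ 4 := by norm_num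
        gcongr
    _ ≤ (2 ^ 32 * γ ^ 4) * q ^ 5 * C ^ 2 * γ ^ 4 := by gcongr
    _ = 2 ^ 32 * q ^ 5 * C ^ 2 * γ ^ 8 := by ring
    _ ≤ _ := by gcongr

/-- Theorem A.2(i) (Odell–Schlumprecht/Naor): nonlinear spectral gap for `1`-unconditional
norms with cotype `q`, in terms of the second adjacency eigenvalue. -/
theorem stmt_16 {n d k : ℕ} (hd : 3 ≤ d) (hk : 1 ≤ k)
    (G : SimpleGraph (Fin n)) [DecidableRel G.Adj]
    (hreg : ∀ v, G.degree v = d)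
    (lam2 : ℝ) (hlam : lam2 < d)
    (hspec : ∀ y : Fin n → ℝ, ∑ i, y i = 0 →
      ∑ i, (G.adjMatrix ℝ).mulVec y i * y i ≤ lam2 * ∑ i, y i ^ 2)
    (q C : ℝ) (hq : 2 ≤ q) (hC : 1 ≤ C)
    (N : (Fin k → ℝ) → ℝ)
    (hN : IsNorm k N) (hunc : OneUnconditional k N) (hcot : HasCotype k N q C)
    (f : Fin n → Fin k → ℝ) :
    1 / (n : ℝ) ^ 2 * ∑ v, ∑ w, N (f v - f w) ^ 2 ≤
      (2 : ℝ) ^ (3616 * q + 450) * q ^ (384 * q + 104) * C ^ (129 * q + 4) *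
          ((d : ℝ) / ((d : ℝ) - lam2)) ^ 8 / (G.edgeFinset.card : ℝ) *
        ∑ e ∈ G.edgeFinset, edgeNorm N f e ^ 2 := by
  rcases Nat.eq_zero_or_pos n with hn0 | hn
  · subst hn0
    have : G.edgeFinset.card = 0 := by
      have := G.sum_degrees_eq_twice_card_edges
      simp at this
      simpa using this
    simp [this]
  have h := LatNorm.of_isNorm hN hunc
  have hr : (1 : ℝ) ≤ 2 * q := by linarith
  have hM : ∀ x, ∀ s ∈ concSet N (2 * q) x, s ≤ 6 * q * C * N x := by
    rintro x s ⟨m, y, hy, rfl⟩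
    exact h.concave (by linarith) hC (lower_est h hC hcot) x m y hy
  have hP := concNorm_lat h hr hM
  have hsm := concNorm_smooth h hr hM
  have hle := le_concNorm h hr hM
  have hge := concNorm_le h hr hM
  set P := concNorm N (2 * q) with hPdef
  obtain ⟨z, hz⟩ := core hn hd G hreg lam2 hlam hspec hP (by linarith) hsm f
  have hlam1 := lam2_ge hn hd G hreg lam2 hspec
  have hd' : (3 : ℝ) ≤ d := by exact_mod_cast hd
  have hdl : 0 < (d : ℝ) - lam2 := by linarith
  set γ : ℝ := d / (d - lam2) with hγ
  have hγ1 : 3 / 4 ≤ γ := by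
    rw [hγ, le_div_iff₀ hdl]; linarith
  have hγd : γ * (d - lam2) = d := by rw [hγ]; field_simp
  have hn' : (0 : ℝ) < n := by exact_mod_cast hn
  have hE : (G.edgeFinset.card : ℝ) = n * d / 2 := by
    have := edge_sum G (fun _ => 1)
    simp_rw [deg_sum G hreg] at this
    simp at this
    linarith
  have hB : ∑ v, ∑ w, (if G.Adj v w then P (f v - f w) ^ 2 else 0) ≤
      2 * ((6 * q * C) ^ 2 * ∑ e ∈ G.edgeFinset, edgeNorm N f e ^ 2) := by
    have := edge_sum G (fun e => edgeNorm N f e ^ 2)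
    rw [mul_left_comm, ← this, Finset.mul_sum]
    refine Finset.sum_le_sum fun v _ => ?_
    rw [Finset.mul_sum]
    refine Finset.sum_le_sum fun w _ => ?_
    rw [edgeNorm_mk h]
    split_ifs
    · rw [← mul_pow]
      exact pow_le_pow_left₀ (hP.nonneg _) (hge _) 2
    · simp
  set B := ∑ e ∈ G.edgeFinset, edgeNorm N f e ^ 2 with hBdef
  have hB0 : 0 ≤ B := Finset.sum_nonneg fun e _ => sq_nonneg _
  set S := ∑ v, P (f v - z) ^ 2 with hS
  have hL : ∑ v, ∑ w, N (f v - f w) ^ 2 ≤ 4 * n * S := by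
    calc _ ≤ ∑ v, ∑ w, (2 * P (f v - z) ^ 2 + 2 * P (f w - z) ^ 2) := by
          refine Finset.sum_le_sum fun v _ => Finset.sum_le_sum fun w _ => ?_
          have a1 : N (f v - f w) ≤ P (f v - z) + P (f w - z) := by
            have e1 : P (z - f w) = P (f w - z) := hP.congr_abs (fun j => by simp [abs_sub_comm])
            have e2 := hP.tri (f v - z) (z - f w)
            rw [sub_add_sub_cancel, e1] at e2
            exact (hle _).trans e2
          have a2 := h.nonneg (f v - f w)
          nlinarith [sq_nonneg (P (f v - z) - P (f w - z))]
      _ = _ := by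
          simp_rw [Finset.sum_add_distrib, ← Finset.mul_sum]
          simp [← hS]
          rw [← Finset.mul_sum, ← hS]; ring
  have hconst := final_const hq hC hγ1
  set Γ := (2 : ℝ) ^ (3616 * q + 450) * q ^ (384 * q + 104) * C ^ (129 * q + 4) * γ ^ 8 with hΓ
  have hq0 : 0 < q := by linarith
  have hγ0 : 0 < γ := by linarith
  have hd0 : (0 : ℝ) < d := by linarith
  have hS1 : d * S ≤ 12 * 48 ^ 3 * 8 * 36 * q ^ 5 * C ^ 2 * γ ^ 4 * B := by
    have := mul_le_mul_of_nonneg_left hB (show 0 ≤ γ * (6 * (48 * (2 * q) * γ) ^ 3) by positivity)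
    have h2 := mul_le_mul_of_nonneg_left hz hγ0.le
    rw [← mul_assoc, hγd] at h2
    linarith
  have hS2 : 2 * d * S ≤ Γ * B := by
    have := mul_le_mul_of_nonneg_right hconst hB0
    linarith
  rw [hE]
  calc 1 / (n : ℝ) ^ 2 * ∑ v, ∑ w, N (f v - f w) ^ 2 ≤ 1 / (n : ℝ) ^ 2 * (4 * n * S) := by gcongr
    _ = (2 * d * S) / (n * d / 2) := by field_simp; ring
    _ ≤ (Γ * B) / (n * d / 2) := by gcongr
    _ = _ := by ring
end

section
/- Let q ≥ 2, C ≥ 1, let n ≥ 1, and let ‖·‖_X be a 1-unconditional norm on ℝ^n that has cotype q with constant C. Let B(X) := {x ∈ ℝ^n : ‖x‖_X ≤ 1} and let B(ℓ_2^n) be the closed Euclidean unit ball of ℝ^n. Then there exists a bijection Φ : B(X) → B(ℓ_2^n) such that for every x_1, x_2 ∈ B(X): ‖x_1−x_2‖_X^{24q} / ((1−e^{−1})^{−24q} · 2^{190q+20} · q^{24q+6} · C^{12q}) ≤ ‖Φ(x_1)−Φ(x_2)‖_2 ≤ (8√5/√(1−e^{−1})) · √q · C^{1/4} · ‖x_1−x_2‖_X^{1/8}.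 -/
open Finset

attribute [local instance] Classical.propDecidable

/-- Lattice norm on `ℝ^n`. -/
structure LN (n : ℕ) (M : (Fin n → ℝ) → ℝ) : Prop where
  nonneg : ∀ x, 0 ≤ M x
  zero : ∀ x, M x = 0 → x = 0
  smul : ∀ (c : ℝ) (x : Fin n → ℝ), M (c • x) = |c| * M x
  add : ∀ x y, M (x + y) ≤ M x + M y
  mono : ∀ x y : Fin n → ℝ, (∀ j, |x j| ≤ |y j|) → M x ≤ M y

theorem LN_of {n : ℕ} {N : (Fin n → ℝ) → ℝ} (hN : IsNorm n N) (hunc : OneUnconditional n N) :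
    LN n N := by
  obtain ⟨h0, hs, ha⟩ := hN
  have hnn : ∀ x, 0 ≤ N x := by
    intro x
    have h1 := ha x ((-1 : ℝ) • x)
    rw [hs] at h1
    have h2 : x + (-1 : ℝ) • x = 0 := by simp
    rw [h2, (h0 0).2 rfl] at h1
    simp at h1
    linarith
  refine ⟨hnn, fun x => (h0 x).1, hs, ha, ?_⟩
  have key : ∀ (θ y : Fin n → ℝ), (∀ j, |θ j| ≤ 1) → ∀ S : Finset (Fin n),
      N (fun j => if j ∈ S then θ j * y j else y j) ≤ N y := by
    intro θ y hθ S
    induction S using Finset.induction_on with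
    | empty => simp
    | insert i S hi ih =>
      set a : Fin n → ℝ := fun j => if j ∈ S then θ j * y j else y j with ha'
      set b : Fin n → ℝ := fun j => if j = i then - a j else a j with hb
      have hba : N b = N a := by
        rw [hunc b, hunc a]
        congr 1
        ext j
        simp only [hb]
        split_ifs <;> simp
      have e : (fun j => if j ∈ insert i S then θ j * y j else y j) =
          ((1 + θ i) / 2) • a + ((1 - θ i) / 2) • b := by
        ext j
        by_cases hj : j = i
        · subst hj
          simp [hb, ha', hi]
          ring
        · simp [hb, ha', hj]
          split_ifs <;> ring
      rw [e]
      have hθi := abs_le.1 (hθ i)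
      calc _ ≤ _ := ha _ _
        _ = (1 + θ i) / 2 * N a + (1 - θ i) / 2 * N a := by
            rw [hs, hs, hba, abs_of_nonneg (by linarith), abs_of_nonneg (by linarith)]
        _ = N a := by ring
        _ ≤ _ := ih
  intro x y hxy
  have := key (fun j => x j / y j) y (by
    intro j
    rw [abs_div]
    exact div_le_one_of_le₀ (hxy j) (abs_nonneg _)) Finset.univ
  convert this using 2
  ext j
  simp
  by_cases hy : y j = 0
  · have := hxy j
    rw [hy] at this
    simp at this
    simp [this]
  · field_simp

/-- Admissible lists of multipliers. -/
def Adm {n : ℕ} (t : ℝ) (L : List (Fin n → ℝ)) : Prop :=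
  (∀ φ ∈ L, ∀ j, 0 ≤ φ j) ∧ ∀ j, (L.map fun φ => φ j ^ t).sum ≤ 1

/-- The value of a list. -/
noncomputable def lval {n : ℕ} (N : (Fin n → ℝ) → ℝ) (s : ℝ) (L : List (Fin n → ℝ)) (x : Fin n → ℝ) : ℝ :=
  (L.map fun φ => N (φ * x) ^ s).sum

/-- The concave hull functional. -/
noncomputable def W {n : ℕ} (N : (Fin n → ℝ) → ℝ) (t s : ℝ) (x : Fin n → ℝ) : ℝ :=
  sSup {r | ∃ L, Adm t L ∧ r = lval N s L x}

theorem adm_nil {n : ℕ} (t : ℝ) : Adm t ([] : List (Fin n → ℝ)) := by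
  constructor <;> simp

theorem adm_one {n : ℕ} (t : ℝ) : Adm t ([1] : List (Fin n → ℝ)) := by
  constructor <;> simp

section W
variable {n : ℕ} {N : (Fin n → ℝ) → ℝ} {t s B : ℝ}

theorem lval_le_W (hB : ∀ L x, Adm t L → lval N s L x ≤ B * N x ^ s) (L) (x) (hL : Adm t L) :
    lval N s L x ≤ W N t s x := by
  apply le_csSup
  · refine ⟨B * N x ^ s, ?_⟩
    rintro r ⟨L, hL, rfl⟩
    exact hB L x hL
  · exact ⟨L, hL, rfl⟩

theorem W_le (x) (b : ℝ) (h : ∀ L, Adm t L → lval N s L x ≤ b) : W N t s x ≤ b := by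
  apply csSup_le
  · exact ⟨_, [], adm_nil t, rfl⟩
  · rintro r ⟨L, hL, rfl⟩
    exact h L hL

theorem le_W (hB : ∀ L x, Adm t L → lval N s L x ≤ B * N x ^ s) (x) : N x ^ s ≤ W N t s x := by
  have := lval_le_W hB [1] x (adm_one t)
  simpa [lval] using this

theorem W_super (ht : 0 < t) (hB : ∀ L x, Adm t L → lval N s L x ≤ B * N x ^ s)
    (φ ψ x : Fin n → ℝ) (hφ : ∀ j, 0 ≤ φ j) (hψ : ∀ j, 0 ≤ ψ j)
    (h : ∀ j, φ j ^ t + ψ j ^ t ≤ 1) :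
    W N t s (φ * x) + W N t s (ψ * x) ≤ W N t s x := by
  have : ∀ L₁, Adm t L₁ → ∀ L₂, Adm t L₂ → 
      lval N s L₁ (φ * x) + lval N s L₂ (ψ * x) ≤ W N t s x := by
    intro L₁ h₁ L₂ h₂
    have := lval_le_W hB (L₁.map (· * φ) ++ L₂.map (· * ψ)) x ?_
    · convert this using 1
      simp only [lval, List.map_append, List.map_map, List.sum_append, Function.comp_def, mul_assoc]
    · constructor
      · intro χ hχ j
        simp only [List.mem_append, List.mem_map] at hχ
        rcases hχ with ⟨a, ha, rfl⟩ | ⟨a, ha, rfl⟩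
        · exact mul_nonneg (h₁.1 a ha j) (hφ j)
        · exact mul_nonneg (h₂.1 a ha j) (hψ j)
      · intro j
        have aux : ∀ (L : List (Fin n → ℝ)) (χ : Fin n → ℝ), Adm t L → (∀ j, 0 ≤ χ j) →
            ((L.map (· * χ)).map fun φ => φ j ^ t).sum ≤ χ j ^ t := by
          intro L χ hL hχ
          have e : ((L.map (· * χ)).map fun φ => φ j ^ t) = L.map fun φ => φ j ^ t * χ j ^ t := by
            rw [List.map_map]
            apply List.map_congr_left
            intro a ha
            simp [Real.mul_rpow (hL.1 a ha j) (hχ j)]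
          rw [e, List.sum_map_mul_right]
          exact mul_le_of_le_one_left (Real.rpow_nonneg (hχ j) _) (hL.2 j)
        rw [List.map_append, List.sum_append]
        linarith [aux L₁ φ h₁ hφ, aux L₂ ψ h₂ hψ, h j]
  have h2 : W N t s (φ * x) ≤ W N t s x - W N t s (ψ * x) := by
    apply W_le
    intro L₁ h₁
    have : W N t s (ψ * x) ≤ W N t s x - lval N s L₁ (φ * x) := by
      apply W_le
      intro L₂ h₂
      linarith [this L₁ h₁ L₂ h₂]
    linarith
  linarith

theorem lval_mono (hN : LN n N) (hs : 0 < s) (L) (x y : Fin n → ℝ) (h : ∀ j, |x j| ≤ |y j|) :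
    lval N s L x ≤ lval N s L y := by
  apply List.sum_le_sum
  intro φ _
  apply Real.rpow_le_rpow (hN.nonneg _) _ hs.le
  apply hN.mono
  intro j
  simp only [Pi.mul_apply, abs_mul]
  exact mul_le_mul_of_nonneg_left (h j) (abs_nonneg _)

theorem W_mono (hN : LN n N) (hs : 0 < s) (hB : ∀ L x, Adm t L → lval N s L x ≤ B * N x ^ s)
    (x y : Fin n → ℝ) (h : ∀ j, |x j| ≤ |y j|) : W N t s x ≤ W N t s y := by
  apply W_le
  intro L hL
  exact (lval_mono hN hs L x y h).trans (lval_le_W hB L y hL)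

theorem W_convex (hN : LN n N) (hs : 1 ≤ s) (hB : ∀ L x, Adm t L → lval N s L x ≤ B * N x ^ s)
    (x y : Fin n → ℝ) (a b : ℝ) (ha : 0 ≤ a) (hb : 0 ≤ b) (hab : a + b = 1) :
    W N t s (a • x + b • y) ≤ a * W N t s x + b * W N t s y := by
  apply W_le
  intro L hL
  have : lval N s L (a • x + b • y) ≤ a * lval N s L x + b * lval N s L y := by
    unfold lval
    rw [← List.sum_map_mul_left, ← List.sum_map_mul_left, ← List.sum_map_add]
    apply List.sum_le_sum
    intro φ _
    have h1 : N (φ * (a • x + b • y)) ≤ a * N (φ * x) + b * N (φ * y) := by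
      rw [mul_add, mul_smul_comm, mul_smul_comm]
      refine (hN.add _ _).trans ?_
      rw [hN.smul, hN.smul, abs_of_nonneg ha, abs_of_nonneg hb]
    refine (Real.rpow_le_rpow (hN.nonneg _) h1 (by linarith)).trans ?_
    have := (convexOn_rpow hs).2 (hN.nonneg (φ * x)) (hN.nonneg (φ * y)) ha hb hab
    simpa using this
  have h1 := mul_le_mul_of_nonneg_left (lval_le_W hB L x hL) ha
  have h2 := mul_le_mul_of_nonneg_left (lval_le_W hB L y hL) hb
  linarith

theorem W_smul (hN : LN n N) (c : ℝ) (x : Fin n → ℝ) (hc : 0 < c) 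
    (hB : ∀ L x, Adm t L → lval N s L x ≤ B * N x ^ s) :
    W N t s (c • x) = c ^ s * W N t s x := by
  have hv : ∀ (c : ℝ) (_ : 0 < c) (L) (x : Fin n → ℝ), lval N s L (c • x) = c ^ s * lval N s L x := by
    intro c hc L x
    unfold lval
    rw [← List.sum_map_mul_left]
    congr 1
    apply List.map_congr_left
    intro φ _
    rw [mul_smul_comm, hN.smul, abs_of_pos hc, Real.mul_rpow hc.le (hN.nonneg _)]
  have hcs : 0 < c ^ s := Real.rpow_pos_of_pos hc s
  apply le_antisymm
  · apply W_le
    intro L hL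
    rw [hv c hc]
    exact mul_le_mul_of_nonneg_left (lval_le_W hB L x hL) hcs.le
  · rw [← le_div_iff₀' hcs]
    apply W_le
    intro L hL
    rw [le_div_iff₀' hcs, ← hv c hc]
    exact lval_le_W hB L _ hL

theorem M_LN (hN : LN n N) (hs : 1 ≤ s) (hB : ∀ L x, Adm t L → lval N s L x ≤ B * N x ^ s) :
    LN n (fun x => W N t s x ^ (1 / s)) := by
  have hs0 : 0 < s := by linarith
  have hW0 : ∀ x, 0 ≤ W N t s x := fun x => (Real.rpow_nonneg (hN.nonneg x) s).trans (le_W hB x)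
  have hNM : ∀ x, N x ≤ W N t s x ^ (1 / s) := by
    intro x
    rw [one_div, Real.le_rpow_inv_iff_of_pos (hN.nonneg x) (hW0 x) hs0]
    exact le_W hB x
  have hz : ∀ x, N x = 0 → W N t s x = 0 := by
    intro x hx
    apply le_antisymm _ (hW0 x)
    apply W_le
    intro L hL
    have := hB L x hL
    rwa [hx, Real.zero_rpow hs0.ne', mul_zero] at this
  have hz0 : N 0 = 0 := by
    have := hN.smul 0 0
    simpa using this
  have hsm : ∀ (c : ℝ) (x : Fin n → ℝ), 0 < c →
      W N t s (c • x) ^ (1 / s) = c * W N t s x ^ (1 / s) := by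
    intro c x hc
    rw [W_smul hN c x hc hB, Real.mul_rpow (by positivity) (hW0 x), ← Real.rpow_mul hc.le]
    rw [mul_one_div_cancel hs0.ne', Real.rpow_one]
  have hmono : ∀ x y : Fin n → ℝ, (∀ j, |x j| ≤ |y j|) → 
      W N t s x ^ (1 / s) ≤ W N t s y ^ (1 / s) := fun x y h => 
    Real.rpow_le_rpow (hW0 x) (W_mono hN hs0 hB x y h) (by positivity)
  have hnz : ∀ x : Fin n → ℝ, x ≠ 0 → 0 < W N t s x ^ (1 / s) := by
    intro x hx
    refine lt_of_lt_of_le ?_ (hNM x)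
    exact lt_of_le_of_ne (hN.nonneg x) (fun h => hx (hN.zero x h.symm))
  have hM0 : W N t s 0 ^ (1 / s) = 0 := by
    rw [hz 0 hz0, Real.zero_rpow (by positivity)]
  refine ⟨fun x => Real.rpow_nonneg (hW0 x) _, ?_, ?_, ?_, hmono⟩
  · intro x hx
    apply hN.zero
    exact le_antisymm (hx ▸ hNM x) (hN.nonneg x)
  · intro c x
    rcases eq_or_ne c 0 with rfl | hc
    · simp only [zero_smul, abs_zero, zero_mul]
      exact hM0
    · rw [← hsm _ _ (abs_pos.2 hc)]
      apply le_antisymm <;> apply hmono <;> intro j <;> simp [abs_mul]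
  · intro x y
    rcases eq_or_ne x 0 with rfl | hx
    · rw [zero_add]
      simp only [hM0, zero_add, le_refl]
    rcases eq_or_ne y 0 with rfl | hy
    · rw [add_zero]
      simp only [hM0, add_zero, le_refl]
    have ha := hnz x hx
    have hb := hnz y hy
    set a := W N t s x ^ (1 / s) with hadef
    set b := W N t s y ^ (1 / s) with hbdef
    have has : a ^ s = W N t s x := by
      rw [hadef, ← Real.rpow_mul (hW0 x), one_div_mul_cancel hs0.ne', Real.rpow_one]
    have hbs : b ^ s = W N t s y := by
      rw [hbdef, ← Real.rpow_mul (hW0 y), one_div_mul_cancel hs0.ne', Real.rpow_one]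
    have hc := W_convex hN hs hB (a⁻¹ • x) (b⁻¹ • y) (a / (a + b)) (b / (a + b))
      (by positivity) (by positivity) (by field_simp)
    rw [W_smul hN _ _ (inv_pos.2 ha) hB, W_smul hN _ _ (inv_pos.2 hb) hB, ← has, ← hbs,
      ← Real.mul_rpow (by positivity) ha.le, ← Real.mul_rpow (by positivity) hb.le,
      inv_mul_cancel₀ ha.ne', inv_mul_cancel₀ hb.ne', Real.one_rpow] at hc
    have e : x + y = (a + b) • ((a / (a + b)) • a⁻¹ • x + (b / (a + b)) • b⁻¹ • y) := by
      ext j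
      simp
      field_simp
    show W N t s (x + y) ^ (1 / s) ≤ a + b
    rw [e, hsm _ _ (by positivity)]
    refine mul_le_of_le_one_right (by positivity) ?_
    apply Real.rpow_le_one (hW0 _) _ (by positivity)
    refine hc.trans (le_of_eq ?_)
    field_simp

end W

theorem cot_bound {n : ℕ} {N : (Fin n → ℝ) → ℝ} {q C : ℝ} (hq : 2 ≤ q) (hC : 1 ≤ C)
    (hN : LN n N) (hcot : HasCotype n N q C) (L : List (Fin n → ℝ)) (x : Fin n → ℝ)
    (hL : Adm 1 L) : lval N q L x ≤ C ^ q * N x ^ q := by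
  have h := hcot L.length (fun i => L[i] * x)
  have hCq : 0 < C ^ q := Real.rpow_pos_of_pos (by linarith) q
  have e1 : ∑ i : Fin L.length, N (L[i] * x) ^ q = lval N q L x := by
    unfold lval
    exact Fin.sum_univ_fun_getElem L (fun φ => N (φ * x) ^ q)
  have hb : ∀ σ : Fin L.length → Bool,
      N (∑ i, (if σ i then (1 : ℝ) else -1) • (L[i] * x)) ^ q ≤ N x ^ q := by
    intro σ
    apply Real.rpow_le_rpow (hN.nonneg _) _ (by linarith)
    apply hN.mono
    intro j
    have : (∑ i, (if σ i then (1 : ℝ) else -1) • (L[i] * x)) j =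
        (∑ i : Fin L.length, (if σ i then (1 : ℝ) else -1) * L[i] j) * x j := by
      rw [Finset.sum_apply, Finset.sum_mul]
      apply Finset.sum_congr rfl
      intro i _
      simp [mul_assoc]
    rw [this, abs_mul]
    refine mul_le_of_le_one_left (abs_nonneg _) ?_
    refine (Finset.abs_sum_le_sum_abs _ _).trans ?_
    have h2 := hL.2 j
    rw [← Fin.sum_univ_fun_getElem L (fun φ => φ j ^ (1 : ℝ))] at h2
    refine le_trans (Finset.sum_le_sum ?_) h2
    intro i _
    have : 0 ≤ L[i] j := hL.1 _ (List.getElem_mem _) j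
    rw [Real.rpow_one, abs_mul]
    have e3 : |(if σ i then (1 : ℝ) else -1)| = 1 := by split_ifs <;> simp
    rw [e3, one_mul, abs_of_nonneg this]
    rfl
  have h2 : ∑ σ : Fin L.length → Bool, 
      N (∑ i, (if σ i then (1 : ℝ) else -1) • (L[i] * x)) ^ q ≤ 2 ^ L.length * N x ^ q := by
    refine (Finset.sum_le_sum (fun σ _ => hb σ)).trans (le_of_eq ?_)
    simp
  rw [e1] at h
  have h3 : 1 / C ^ q * lval N q L x ≤ N x ^ q := by
    refine h.trans ?_
    rw [one_div, inv_mul_le_iff₀ (by positivity)]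
    exact h2
  rw [one_div, inv_mul_le_iff₀ hCq] at h3
  exact h3

section V
variable {n : ℕ} {N : (Fin n → ℝ) → ℝ} {q B : ℝ}

theorem V_step (hq : 1 ≤ q) (hN : LN n N) (hB : ∀ L x, Adm 1 L → lval N q L x ≤ B * N x ^ q)
    (x f : Fin n → ℝ) (p : ℝ) (hp : 0 ≤ p) (hp1 : p ≤ 1) (hf : ∀ j, 0 ≤ f j) (hf1 : ∀ j, f j ≤ 1) :
    p * W N 1 q (f * x) + W N 1 q ((1 - p • f) * x) ≤ W N 1 q x := by
  have h1 := W_super one_pos hB f (1 - f) x hf (fun j => by simp [hf1 j]) (fun j => by simp)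
  have h2 := W_convex hN hq hB ((1 - f) * x) x p (1 - p) hp (by linarith) (by ring)
  have e : (1 - p • f) * x = p • ((1 - f) * x) + (1 - p) • x := by
    ext j
    simp
    ring
  rw [e]
  nlinarith [mul_le_mul_of_nonneg_left h1 hp]

theorem V_list (hq : 1 ≤ q) (hN : LN n N) (hB : ∀ L x, Adm 1 L → lval N q L x ≤ B * N x ^ q)
    (x : Fin n → ℝ) (κ : ℝ) (hκ : 0 ≤ κ) (P : (Fin n → ℝ) → ℝ) (F : (Fin n → ℝ) → (Fin n → ℝ))
    (L : List (Fin n → ℝ)) :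
    (∀ φ ∈ L, 0 ≤ P φ ∧ P φ ≤ 1 ∧ ∀ j, 0 ≤ F φ j ∧ F φ j ≤ 1) → ∀ ψ : Fin n → ℝ,
    (∀ j, ψ j ≤ 1) → (∀ j, κ + (L.map fun φ => P φ * F φ j).sum ≤ ψ j) →
    (L.map fun φ => P φ * W N 1 q (κ • (F φ * x))).sum ≤ W N 1 q (ψ * x) := by
  induction L with
  | nil =>
    intro _ ψ _ _
    simp
    exact (Real.rpow_nonneg (hN.nonneg _) q).trans (le_W hB _)
  | cons φ L ih =>
    intro h ψ hψ1 hψ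
    obtain ⟨hp, hp1, hf⟩ := h φ (by simp)
    have hsum : ∀ j, 0 ≤ (L.map fun φ => P φ * F φ j).sum := by
      intro j
      apply List.sum_nonneg
      intro a ha
      obtain ⟨b, hb, rfl⟩ := List.mem_map.1 ha
      obtain ⟨h1, _, h2⟩ := h b (by simp [hb])
      exact mul_nonneg h1 (h2 j).1
    have hψ' : ∀ j, κ + (P φ * F φ j + (L.map fun φ => P φ * F φ j).sum) ≤ ψ j := by
      intro j
      simpa using hψ j
    have hpf : ∀ j, 0 ≤ P φ * F φ j := fun j => mul_nonneg hp (hf j).1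
    have hψκ : ∀ j, κ ≤ ψ j := fun j => by linarith [hψ' j, hsum j, hpf j]
    have h1 := ih (fun a ha => h a (by simp [ha])) ((1 - P φ • F φ) * ψ) (by
      intro j
      simp
      nlinarith [hpf j, hψ1 j, hψκ j]) (by
      intro j
      simp
      nlinarith [hpf j, hψ1 j, hψκ j, hψ' j])
    have h2 := V_step hq hN hB (ψ * x) (F φ) (P φ) hp hp1 (fun j => (hf j).1) (fun j => (hf j).2)
    have h3 : W N 1 q (κ • (F φ * x)) ≤ W N 1 q (F φ * (ψ * x)) := by
      apply W_mono hN (by linarith) hB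
      intro j
      simp only [Pi.smul_apply, Pi.mul_apply, smul_eq_mul, abs_mul]
      rw [abs_of_nonneg hκ, abs_of_nonneg (hκ.trans (hψκ j))]
      have : 0 ≤ |F φ j| * |x j| := by positivity
      nlinarith [hψκ j]
    rw [List.map_cons, List.sum_cons]
    rw [← mul_assoc] at h2
    have e : F φ * (ψ * x) = F φ * ψ * x := by rw [mul_assoc]
    rw [← mul_assoc] at h2
    rw [e] at h3
    nlinarith [mul_le_mul_of_nonneg_left h3 hp]

theorem layer (hN : LN n N) (hq : 2 ≤ q) (x : Fin n → ℝ) (hx : N x ≤ 1) (φ : Fin n → ℝ)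
    (hφ : ∀ j, 0 ≤ φ j) (hφ1 : ∀ j, φ j ≤ 1) (ha : 0 < N (φ * x)) :
    ∃ τ : ℝ, 0 < τ ∧ N (φ * x) ^ 2 / 8 ≤ τ ^ 2 * N ((fun j => if τ ≤ φ j then 1 else 0) * x) := by
  by_contra! hcon
  set a := N (φ * x) with hadef
  set f : ℝ → Fin n → ℝ := fun τ j => if τ ≤ φ j then 1 else 0 with hf
  have key : ∀ m : ℕ, ∀ j, φ j < a / 2 * 2 ^ m →
      φ j ≤ a / 2 + ∑ k ∈ Finset.range m, a / 2 * 2 ^ k * f (a / 2 * 2 ^ k) j := by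
    intro m j
    induction m with
    | zero =>
      intro h
      simp at h ⊢
      linarith
    | succ m ih =>
      intro h
      rw [Finset.sum_range_succ]
      by_cases h2 : φ j < a / 2 * 2 ^ m
      · have h3 : f (a / 2 * 2 ^ m) j = 0 := by simp [hf, not_le.2 h2]
        rw [h3]
        linarith [ih h2]
      · push Not at h2
        have h4 : ∀ k ∈ Finset.range (m + 1), a / 2 * 2 ^ k * f (a / 2 * 2 ^ k) j = 
            a / 2 * 2 ^ k := by
          intro k hk
          have : a / 2 * 2 ^ k ≤ a / 2 * 2 ^ m := by
            apply mul_le_mul_of_nonneg_left _ (by linarith)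
            exact pow_le_pow_right₀ (by norm_num) (by simpa [Nat.lt_succ_iff] using hk)
          simp [hf, this.trans h2]
        rw [← Finset.sum_range_succ, Finset.sum_congr rfl h4, ← Finset.mul_sum,
          geom_sum_eq (by norm_num)]
        have : (2:ℝ) ^ (m+1) - 1 = ((2:ℝ) ^ (m+1) - 1)/(2-1) := by norm_num
        rw [← this]
        linarith
  have hNs : ∀ (m : ℕ), N ((fun j => a / 2 + ∑ k ∈ Finset.range m, 
      a / 2 * 2 ^ k * f (a / 2 * 2 ^ k) j) * x) ≤ a / 2 + a / 2 * (1 - (1/2) ^ m) := by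
    intro m
    induction m with
    | zero =>
      have : (fun j => a / 2 + ∑ k ∈ Finset.range 0, 
        a / 2 * 2 ^ k * f (a / 2 * 2 ^ k) j) * x = (a / 2) • x := by ext j; simp
      rw [this, hN.smul, abs_of_pos (by linarith)]
      nlinarith
    | succ m ih =>
      have : (fun j => a / 2 + ∑ k ∈ Finset.range (m + 1), 
        a / 2 * 2 ^ k * f (a / 2 * 2 ^ k) j) * x = (fun j => a / 2 + ∑ k ∈ Finset.range m, 
        a / 2 * 2 ^ k * f (a / 2 * 2 ^ k) j) * x + (a / 2 * 2 ^ m) • (f (a / 2 * 2 ^ m) * x) := by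
        ext j
        simp [Finset.sum_range_succ]
        ring
      rw [this]
      refine (hN.add _ _).trans ?_
      rw [hN.smul, abs_of_pos (by positivity)]
      have h1 := hcon (a / 2 * 2 ^ m) (by positivity)
      set b := N (f (a / 2 * 2 ^ m) * x)
      have h2 : a / 2 * 2 ^ m * b ≤ a / 2 * (1/2) ^ (m + 1) := by
        have hT : 0 < a / 2 * (2:ℝ) ^ m := by positivity
        rw [← mul_le_mul_iff_right₀ hT]
        have : a / 2 * 2 ^ m * (a / 2 * (1 / 2) ^ (m + 1)) = a ^ 2 / 8 := by
          rw [pow_succ]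
          have : (2:ℝ)^m * (1/2)^m = 1 := by rw [← mul_pow]; norm_num
          linear_combination a^2/8 * this
        rw [this]
        have h1' : a ^ 2 / 8 > (a / 2 * 2 ^ m) ^ 2 * b := h1
        nlinarith
      have h3 : ((1:ℝ)/2)^m = 2 * (1/2)^(m+1) := by rw [pow_succ]; ring
      rw [h3] at ih
      nlinarith
  obtain ⟨m, hm⟩ := pow_unbounded_of_one_lt (2 / a) (by norm_num : (1:ℝ) < 2)
  have hm' : 1 < a / 2 * 2 ^ m := by
    rw [div_lt_iff₀ ha] at hm
    linarith
  have hle : a ≤ N ((fun j => a / 2 + ∑ k ∈ Finset.range m, 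
      a / 2 * 2 ^ k * f (a / 2 * 2 ^ k) j) * x) := by
    apply hN.mono
    intro j
    simp only [Pi.mul_apply, abs_mul]
    apply mul_le_mul_of_nonneg_right _ (abs_nonneg _)
    rw [abs_of_nonneg (hφ j)]
    exact (key m j (by linarith [hφ1 j])).trans (le_abs_self _)
  have hp : 0 < a / 2 * (1/2)^m := by positivity
  linarith [hNs m]

theorem pick (hN : LN n N) (hq : 2 ≤ q) (x : Fin n → ℝ) (hx : N x ≤ 1) (φ : Fin n → ℝ)
    (hφ : ∀ j, 0 ≤ φ j) (hφ1 : ∀ j, φ j ≤ 1) :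
    ∃ (p : ℝ) (f : Fin n → ℝ), (0 ≤ p ∧ p ≤ 1 ∧ ∀ j, 0 ≤ f j ∧ f j ≤ 1) ∧
      (∀ j, p * f j ≤ φ j ^ (2 * q) / 2) ∧
      N (φ * x) ^ (2 * q) ≤ 2 * 8 ^ q * (p * N (f * x) ^ q) := by
  rcases (hN.nonneg (φ * x)).eq_or_lt with h0 | h0
  · refine ⟨0, 0, by simp, fun j => ?_, ?_⟩
    · have := Real.rpow_nonneg (hφ j) (2 * q)
      simp
      linarith
    · rw [← h0, Real.zero_rpow (by linarith)]
      simp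
  · obtain ⟨τ, hτ, h⟩ := layer hN hq x hx φ hφ hφ1 h0
    set f : Fin n → ℝ := fun j => if τ ≤ φ j then 1 else 0 with hf
    have hτ1 : τ ≤ 1 := by
      by_contra hτ1
      push Not at hτ1
      have : f * x = 0 := by
        ext j
        simp [hf, not_le.2 (lt_of_le_of_lt (hφ1 j) hτ1)]
      rw [this] at h
      have hz0 : N 0 = 0 := by
        have := hN.smul 0 0
        simpa using this
      rw [hz0] at h
      nlinarith [pow_pos h0 2]
    refine ⟨τ ^ (2 * q) / 2, f, ⟨by positivity, ?_, ?_⟩, ?_, ?_⟩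
    · have := Real.rpow_le_one hτ.le hτ1 (by linarith : 0 ≤ 2 * q)
      linarith
    · intro j
      simp only [hf]
      split_ifs <;> norm_num
    · intro j
      simp only [hf]
      split_ifs with h1
      · have := Real.rpow_le_rpow hτ.le h1 (by linarith : 0 ≤ 2 * q)
        linarith
      · have := Real.rpow_nonneg (hφ j) (2 * q)
        linarith
    · have h2 := Real.rpow_le_rpow (by positivity) h (by linarith : 0 ≤ q)
      rw [Real.div_rpow (by positivity) (by norm_num), Real.mul_rpow (by positivity) (hN.nonneg _),
        ← Real.rpow_natCast, ← Real.rpow_natCast, ← Real.rpow_mul h0.le, ← Real.rpow_mul hτ.le,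
        div_le_iff₀ (by positivity)] at h2
      push_cast at h2
      linarith

theorem conc_bound1 {C : ℝ} (hC : 1 ≤ C) (hN : LN n N) (hq : 2 ≤ q)
    (hB : ∀ L x, Adm 1 L → lval N q L x ≤ C ^ q * N x ^ q) (L : List (Fin n → ℝ)) (x : Fin n → ℝ)
    (hL : Adm (2 * q) L) (hx : N x ≤ 1) : lval N (2 * q) L x ≤ 2 * 8 ^ q * (2 ^ q * C ^ q) := by
  have hpick : ∀ φ : Fin n → ℝ, ∃ (p : ℝ) (f : Fin n → ℝ), φ ∈ L → 
      (0 ≤ p ∧ p ≤ 1 ∧ ∀ j, 0 ≤ f j ∧ f j ≤ 1) ∧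
      (∀ j, p * f j ≤ φ j ^ (2 * q) / 2) ∧
      N (φ * x) ^ (2 * q) ≤ 2 * 8 ^ q * (p * N (f * x) ^ q) := by
    intro φ
    by_cases hφ : φ ∈ L
    · have h1 : ∀ j, φ j ≤ 1 := by
        intro j
        have h3 : φ j ^ (2 * q) ≤ (L.map fun φ => φ j ^ (2 * q)).sum := by
          apply List.single_le_sum
          · intro a ha
            obtain ⟨b, hb, rfl⟩ := List.mem_map.1 ha
            exact Real.rpow_nonneg (hL.1 b hb j) _
          · exact List.mem_map.2 ⟨φ, hφ, rfl⟩
        by_contra hlt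
        push Not at hlt
        have := Real.one_lt_rpow hlt (by linarith : 0 < 2 * q)
        linarith [hL.2 j]
      obtain ⟨p, f, h⟩ := pick hN hq x hx φ (hL.1 φ hφ) h1
      exact ⟨p, f, fun _ => h⟩
    · exact ⟨0, 0, fun h => absurd h hφ⟩
  choose P F hPF using hpick
  have h1 := V_list (by linarith) hN hB x (1/2) (by norm_num) P F L (fun φ hφ => (hPF φ hφ).1) 1
    (by simp) (by
      intro j
      have : (L.map fun φ => P φ * F φ j).sum ≤ (L.map fun φ => φ j ^ (2 * q) * (1/2)).sum := by
        apply List.sum_le_sum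
        intro φ hφ
        have := (hPF φ hφ).2.1 j
        linarith
      rw [List.sum_map_mul_right] at this
      have h2 := hL.2 j
      simp only [Pi.one_apply]
      linarith)
  rw [one_mul] at h1
  have h2 : W N 1 q x ≤ C ^ q := by
    apply W_le
    intro L hL
    refine (hB L x hL).trans ?_
    exact mul_le_of_le_one_right (by positivity) (Real.rpow_le_one (hN.nonneg _) hx (by linarith))
  have h3 : lval N (2 * q) L x ≤ 
      (L.map fun φ => 2 * 8 ^ q * 2 ^ q * (P φ * W N 1 q ((1/2 : ℝ) • (F φ * x)))).sum := by
    apply List.sum_le_sum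
    intro φ hφ
    refine (hPF φ hφ).2.2.trans ?_
    have h4 := le_W hB ((1/2 : ℝ) • (F φ * x))
    rw [hN.smul, Real.mul_rpow (by positivity) (hN.nonneg _), abs_of_pos (by norm_num)] at h4
    have h5 : (1/2 : ℝ) ^ q * 2 ^ q = 1 := by
      rw [← Real.mul_rpow (by norm_num) (by norm_num)]
      norm_num
    have h6 : N (F φ * x) ^ q ≤ 2 ^ q * W N 1 q ((1/2 : ℝ) • (F φ * x)) := by
      have h7 : (0:ℝ) ≤ 2 ^ q := by positivity
      have := mul_le_mul_of_nonneg_left h4 h7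
      calc _ = ((1/2 : ℝ) ^ q * 2 ^ q) * N (F φ * x) ^ q := by rw [h5, one_mul]
        _ ≤ _ := by linarith
    have h8 := mul_le_mul_of_nonneg_left h6 (hPF φ hφ).1.1
    have h9 : (0:ℝ) ≤ 2 * 8 ^ q := by positivity
    have := mul_le_mul_of_nonneg_left h8 h9
    linarith
  rw [List.sum_map_mul_left] at h3
  refine h3.trans ?_
  rw [← mul_assoc]
  exact mul_le_mul_of_nonneg_left (h1.trans h2) (by positivity)

theorem conc_bound {C : ℝ} (hC : 1 ≤ C) (hN : LN n N) (hq : 2 ≤ q)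
    (hB : ∀ L x, Adm 1 L → lval N q L x ≤ C ^ q * N x ^ q) (L : List (Fin n → ℝ)) (x : Fin n → ℝ)
    (hL : Adm (2 * q) L) : lval N (2 * q) L x ≤ (6 * √C) ^ (2 * q) * N x ^ (2 * q) := by
  have hK : (2:ℝ) * 8 ^ q * (2 ^ q * C ^ q) ≤ (6 * √C) ^ (2 * q) := by
    rw [Real.mul_rpow (by norm_num) (by positivity), Real.rpow_mul (by positivity),
      Real.rpow_mul (by positivity)]
    have : (√C) ^ (2:ℝ) = C := by
      rw [Real.rpow_two, Real.sq_sqrt (by linarith)]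
    rw [this]
    have h2 : (2:ℝ) ≤ 2 ^ q := by
      calc (2:ℝ) = 2 ^ (1:ℝ) := by simp
        _ ≤ _ := Real.rpow_le_rpow_of_exponent_le (by norm_num) (by linarith)
    have h3 : (6 ^ (2:ℝ)) ^ q = (36/32:ℝ) ^ q * (2 ^ q * (8 ^ q * 2 ^ q)) := by
      rw [← Real.mul_rpow, ← Real.mul_rpow, ← Real.mul_rpow] <;> norm_num
    rw [h3]
    have h4 : 1 ≤ (36/32:ℝ) ^ q := Real.one_le_rpow (by norm_num) (by linarith)
    have h5 : (0:ℝ) ≤ 8 ^ q * 2 ^ q * C ^ q := by positivity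
    calc (2:ℝ) * 8 ^ q * (2 ^ q * C ^ q) = 2 * (8 ^ q * 2 ^ q * C ^ q) := by ring
      _ ≤ 2 ^ q * (8 ^ q * 2 ^ q * C ^ q) := mul_le_mul_of_nonneg_right h2 h5
      _ = 1 * (2 ^ q * (8 ^ q * 2 ^ q * C ^ q)) := by ring
      _ ≤ (36/32:ℝ) ^ q * (2 ^ q * (8 ^ q * 2 ^ q * C ^ q)) := 
          mul_le_mul_of_nonneg_right h4 (by positivity)
      _ = _ := by ring
  have hsm : ∀ c : ℝ, 0 < c → lval N (2 * q) L (c • x) = c ^ (2 * q) * lval N (2 * q) L x := by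
    intro c hc
    unfold lval
    rw [← List.sum_map_mul_left]
    congr 1
    apply List.map_congr_left
    intro φ _
    rw [mul_smul_comm, hN.smul, abs_of_pos hc, Real.mul_rpow hc.le (hN.nonneg _)]
  rcases (hN.nonneg x).eq_or_lt with h0 | h0
  · have hx := hN.zero x h0.symm
    have h00 : N 0 = 0 := by rw [← hx]; exact h0.symm
    subst hx
    rw [h00, Real.zero_rpow (by linarith), mul_zero]
    unfold lval
    simp [h00, Real.zero_rpow (by linarith : 2 * q ≠ 0)]
  · have h1 := conc_bound1 hC hN hq hB L ((N x)⁻¹ • x) hL (by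
      rw [hN.smul, abs_of_pos (by positivity), inv_mul_cancel₀ h0.ne'])
    have h2 := hsm (N x) h0 
    rw [hsm _ (by positivity), Real.inv_rpow h0.le, inv_mul_le_iff₀ (by positivity)] at h1
    refine h1.trans ?_
    rw [mul_comm]
    exact mul_le_mul_of_nonneg_right hK (by positivity)

end V

/-- `s`-concavity for pairs. -/
def Conc (n : ℕ) (M : (Fin n → ℝ) → ℝ) (s : ℝ) : Prop :=
  ∀ φ ψ x : Fin n → ℝ, (∀ j, 0 ≤ φ j) → (∀ j, 0 ≤ ψ j) → (∀ j, φ j ^ s + ψ j ^ s ≤ 1) →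
    M (φ * x) ^ s + M (ψ * x) ^ s ≤ M x ^ s

theorem exists_renorm {n : ℕ} {N : (Fin n → ℝ) → ℝ} {q C : ℝ} (hq : 2 ≤ q) (hC : 1 ≤ C)
    (hN : LN n N) (hcot : HasCotype n N q C) :
    ∃ M : (Fin n → ℝ) → ℝ, LN n M ∧ Conc n M (2 * q) ∧ (∀ x, N x ≤ M x) ∧
      ∀ x, M x ≤ 6 * √C * N x := by
  have hB := conc_bound hC hN hq (cot_bound hq hC hN hcot)
  have hs0 : 0 < 2 * q := by linarith
  have hW0 : ∀ x, 0 ≤ W N (2 * q) (2 * q) x := 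
    fun x => (Real.rpow_nonneg (hN.nonneg x) _).trans (le_W hB x)
  refine ⟨fun x => W N (2 * q) (2 * q) x ^ (1 / (2 * q)), M_LN hN (by linarith) hB, ?_, ?_, ?_⟩
  · intro φ ψ x hφ hψ h
    have := W_super hs0 hB φ ψ x hφ hψ h
    simp only
    rw [← Real.rpow_mul (hW0 _), ← Real.rpow_mul (hW0 _), ← Real.rpow_mul (hW0 _),
      one_div_mul_cancel hs0.ne', Real.rpow_one, Real.rpow_one, Real.rpow_one]
    exact this
  · intro x
    simp only
    rw [one_div, Real.le_rpow_inv_iff_of_pos (hN.nonneg x) (hW0 x) hs0]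
    exact le_W hB x
  · intro x
    simp only
    have hn := hN.nonneg x
    rw [one_div, Real.rpow_inv_le_iff_of_pos (hW0 x) (by positivity) hs0,
      Real.mul_rpow (by positivity) hn]
    exact W_le _ _ (fun L hL => hB L x hL)

/-- `u` norms `y` for `M` (in absolute value). -/
def Fac (n : ℕ) (M : (Fin n → ℝ) → ℝ) (y u : Fin n → ℝ) : Prop :=
  (∀ j, 0 ≤ u j) ∧ (∀ z : Fin n → ℝ, ∑ j, |z j| * u j ≤ M z) ∧ ∑ j, |y j| * u j = 1

section A
variable {n : ℕ} {M : (Fin n → ℝ) → ℝ} {s : ℝ}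

theorem LN.map_zero (hM : LN n M) : M 0 = 0 := by
  have := hM.smul 0 0
  simpa using this

theorem LN.neg (hM : LN n M) (x : Fin n → ℝ) : M (-x) = M x := by
  apply le_antisymm <;> apply hM.mono <;> intro j <;> simp

theorem LN.sub_comm (hM : LN n M) (x y : Fin n → ℝ) : M (x - y) = M (y - x) := by
  rw [← hM.neg, neg_sub]

theorem exists_fac (hM : LN n M) (y : Fin n → ℝ) (hy : M y = 1) : ∃ u, Fac n M y u := by
  have hy0 : y ≠ 0 := by
    rintro rfl
    rw [hM.map_zero] at hy
    norm_num at hy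
  obtain ⟨g, hg1, hg2⟩ := exists_extension_of_le_sublinear
    (LinearPMap.mkSpanSingleton (K := ℝ) y (1 : ℝ) hy0) M
    (fun c hc x => by rw [hM.smul, abs_of_pos hc]) hM.add (by
      rintro ⟨x, hx⟩
      obtain ⟨c, rfl⟩ := Submodule.mem_span_singleton.1 hx
      rw [LinearPMap.mkSpanSingleton'_apply]
      simp only [smul_eq_mul, mul_one]
      rw [hM.smul, hy, mul_one]
      exact le_abs_self c)
  have hgy : g y = 1 := by
    have := hg1 ⟨y, Submodule.mem_span_singleton_self y⟩
    rw [this, LinearPMap.mkSpanSingleton_apply]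
  have hgs : ∀ z : Fin n → ℝ, g z = ∑ j, z j * g (Pi.single j 1) := by
    intro z
    conv_lhs => rw [pi_eq_sum_univ' z, map_sum]
    apply Finset.sum_congr rfl
    intro j _
    rw [map_smul, smul_eq_mul]
  have hb : ∀ z : Fin n → ℝ, ∑ j, |z j| * |g (Pi.single j 1)| ≤ M z := by
    intro z
    have h1 := hg2 (fun j => if 0 ≤ g (Pi.single j 1) then |z j| else - |z j|)
    rw [hgs] at h1
    refine le_trans (le_of_eq ?_) (h1.trans ?_)
    · apply Finset.sum_congr rfl
      intro j _
      split_ifs with h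
      · rw [abs_of_nonneg h]
      · rw [abs_of_neg (not_le.1 h)]
        ring
    · apply hM.mono
      intro j
      split_ifs <;> simp
  refine ⟨fun j => |g (Pi.single j 1)|, fun j => abs_nonneg _, hb, ?_⟩
  apply le_antisymm
  · exact hy ▸ hb y
  · have h0 : (1:ℝ) = ∑ j, y j * g (Pi.single j 1) := hgy.symm.trans (hgs y)
    refine h0.le.trans ?_
    apply Finset.sum_le_sum
    intro j _
    rw [← abs_mul]
    exact le_abs_self _

theorem conc_two (hM : LN n M) (hs : 4 ≤ s) (hc : Conc n M s) (α β y : Fin n → ℝ)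
    (hα : ∀ j, 0 ≤ α j) (hβ : ∀ j, 0 ≤ β j) (h : ∀ j, α j ^ s + β j ^ s ≤ 2) (hy : M y = 1) :
    M (α * y) + M (β * y) ≤ 2 := by
  set c : ℝ := (1/2 : ℝ) ^ (1 / s) with hcdef
  have hc0 : 0 < c := by positivity
  have hcs : c ^ s = 1/2 := by
    rw [hcdef, ← Real.rpow_mul (by norm_num), one_div_mul_cancel (by linarith), Real.rpow_one]
  have h1 := hc (c • α) (c • β) y (fun j => mul_nonneg hc0.le (hα j))
    (fun j => mul_nonneg hc0.le (hβ j)) (by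
      intro j
      simp only [Pi.smul_apply, smul_eq_mul]
      rw [Real.mul_rpow hc0.le (hα j), Real.mul_rpow hc0.le (hβ j), hcs]
      linarith [h j])
  rw [smul_mul_assoc, smul_mul_assoc, hM.smul, hM.smul, abs_of_pos hc0,
    Real.mul_rpow hc0.le (hM.nonneg _), Real.mul_rpow hc0.le (hM.nonneg _), hcs, hy,
    Real.one_rpow] at h1
  have h2 := (convexOn_rpow (by linarith : 1 ≤ s)).2 (hM.nonneg (α * y)) (hM.nonneg (β * y))
    (by norm_num : (0:ℝ) ≤ 1/2) (by norm_num : (0:ℝ) ≤ 1/2) (by norm_num)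
  simp only [smul_eq_mul] at h2
  by_contra hlt
  push Not at hlt
  have := Real.one_lt_rpow (by linarith : 1 < 1/2 * M (α * y) + 1/2 * M (β * y)) 
    (by linarith : 0 < s)
  linarith

theorem coef_bound (hs : 4 ≤ s) (t : ℝ) (ht : |t| ≤ 1) :
    0 ≤ 1 + t / s - t ^ 2 / (2 * s) ∧ 0 ≤ 1 - t / s - t ^ 2 / (2 * s) ∧
    (1 + t / s - t ^ 2 / (2 * s)) ^ s + (1 - t / s - t ^ 2 / (2 * s)) ^ s ≤ 2 := by
  have hs0 : 0 < s := by linarith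
  obtain ⟨h1, h2⟩ := abs_le.1 ht
  have e1 : 0 ≤ 1 + t / s - t ^ 2 / (2 * s) := by
    have : 1 + t / s - t ^ 2 / (2 * s) = (2 * s + 2 * t - t ^ 2) / (2 * s) := by field_simp
    rw [this]
    apply div_nonneg _ (by linarith)
    nlinarith
  have e2 : 0 ≤ 1 - t / s - t ^ 2 / (2 * s) := by
    have : 1 - t / s - t ^ 2 / (2 * s) = (2 * s - 2 * t - t ^ 2) / (2 * s) := by field_simp
    rw [this]
    apply div_nonneg _ (by linarith)
    nlinarith
  refine ⟨e1, e2, ?_⟩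
  have f1 : (1 + t / s - t ^ 2 / (2 * s)) ^ s ≤ Real.exp (t - t ^ 2 / 2) := by
    have := Real.rpow_le_rpow e1 (show 1 + t / s - t ^ 2 / (2 * s) ≤ Real.exp (t / s - t ^ 2 / (2 * s)) by
      have := Real.add_one_le_exp (t / s - t ^ 2 / (2 * s))
      linarith) hs0.le
    rw [← Real.exp_mul] at this
    convert this using 2
    field_simp
  have f2 : (1 - t / s - t ^ 2 / (2 * s)) ^ s ≤ Real.exp (-t - t ^ 2 / 2) := by
    have := Real.rpow_le_rpow e2 (show 1 - t / s - t ^ 2 / (2 * s) ≤ Real.exp (-t / s - t ^ 2 / (2 * s)) by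
      have := Real.add_one_le_exp (-t / s - t ^ 2 / (2 * s))
      have h3 : -t / s = -(t / s) := by ring
      linarith) hs0.le
    rw [← Real.exp_mul] at this
    convert this using 2
    field_simp
  have f3 := Real.cosh_le_exp_half_sq t
  rw [Real.cosh_eq] at f3
  have f4 : Real.exp (t - t ^ 2 / 2) + Real.exp (-t - t ^ 2 / 2) ≤ 2 := by
    have : Real.exp (t ^ 2 / 2) * Real.exp (- (t ^ 2 / 2)) = 1 := by
      rw [← Real.exp_add]
      simp
    rw [sub_eq_add_neg, sub_eq_add_neg, Real.exp_add, Real.exp_add, ← add_mul]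
    have := mul_le_mul_of_nonneg_right f3 (Real.exp_pos (- (t ^ 2 / 2))).le
    linarith
  linarith

theorem holder_fwd (hM : LN n M) (hs : 4 ≤ s) (hc : Conc n M s) (y y' u u' : Fin n → ℝ)
    (hy : M y = 1) (hu : Fac n M y u) (hu' : Fac n M y' u') :
    ∑ j, |y j * u j - y' j * u' j| ≤ √(4 * s * M (y - y')) + M (y - y') := by
  set δ := M (y - y') with hδ
  have hs0 : 0 < s := by linarith
  have hd : ∑ j, |y j - y' j| * u' j ≤ δ := hu'.2.1 (y - y')
  set t : Fin n → ℝ := fun j => (u j - u' j) / (u j + u' j) with ht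
  have ht1 : ∀ j, |t j| ≤ 1 := by
    intro j
    have a := hu.1 j
    have b := hu'.1 j
    rw [ht]
    simp only
    rw [abs_div, abs_of_nonneg (add_nonneg a b)]
    apply div_le_one_of_le₀ _ (add_nonneg a b)
    rw [abs_le]
    constructor <;> linarith
  have h1 := conc_two hM hs hc (fun j => 1 + t j / s - t j ^ 2 / (2 * s))
    (fun j => 1 - t j / s - t j ^ 2 / (2 * s)) y (fun j => (coef_bound hs _ (ht1 j)).1)
    (fun j => (coef_bound hs _ (ht1 j)).2.1) (fun j => (coef_bound hs _ (ht1 j)).2.2) hy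
  have h2 := hu.2.1 ((fun j => 1 + t j / s - t j ^ 2 / (2 * s)) * y)
  have h3 := hu'.2.1 ((fun j => 1 - t j / s - t j ^ 2 / (2 * s)) * y)
  have h4 : ∑ j, |(((fun j => 1 + t j / s - t j ^ 2 / (2 * s)) * y : Fin n → ℝ)) j| * u j +
      ∑ j, |(((fun j => 1 - t j / s - t j ^ 2 / (2 * s)) * y : Fin n → ℝ)) j| * u' j = 
      ∑ j, |y j| * u j + ∑ j, |y j| * u' j + 
      1 / (2 * s) * ∑ j, |y j| * ((u j - u' j) ^ 2 / (u j + u' j)) := by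
    rw [Finset.mul_sum, ← Finset.sum_add_distrib, ← Finset.sum_add_distrib,
      ← Finset.sum_add_distrib]
    apply Finset.sum_congr rfl
    intro j _
    simp only [Pi.mul_apply, abs_mul]
    rw [abs_of_nonneg (coef_bound hs _ (ht1 j)).1, abs_of_nonneg (coef_bound hs _ (ht1 j)).2.1]
    by_cases hz : u j + u' j = 0
    · have a := hu.1 j
      have b := hu'.1 j
      have a0 : u j = 0 := by linarith
      have b0 : u' j = 0 := by linarith
      simp [a0, b0]
    · simp only [ht]
      field_simp
      ring
  have hyu' : 1 - δ ≤ ∑ j, |y j| * u' j := by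
    have : ∑ j, |y' j| * u' j ≤ ∑ j, |y j| * u' j + ∑ j, |y j - y' j| * u' j := by
      rw [← Finset.sum_add_distrib]
      apply Finset.sum_le_sum
      intro j _
      rw [← add_mul]
      apply mul_le_mul_of_nonneg_right _ (hu'.1 j)
      have := abs_sub_abs_le_abs_sub (y' j) (y j)
      rw [abs_sub_comm] at this
      linarith
    rw [hu'.2.2] at this
    linarith
  have hyu'1 : ∑ j, |y j| * u' j ≤ 1 := hy ▸ hu'.2.1 y
  set T := ∑ j, |y j| * ((u j - u' j) ^ 2 / (u j + u' j)) with hT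
  have hT0 : 0 ≤ T := by
    apply Finset.sum_nonneg
    intro j _
    have a := hu.1 j
    have b := hu'.1 j
    positivity
  have h5 : T ≤ 2 * s * δ := by
    have : 1 / (2 * s) * T ≤ δ := by linarith [hu.2.2]
    rw [one_div, inv_mul_le_iff₀ (by linarith)] at this
    exact this
  have h6 : (∑ j, |y j| * |u j - u' j|) ^ 2 ≤ T * ∑ j, |y j| * (u j + u' j) := by
    apply Finset.sum_sq_le_sum_mul_sum_of_sq_eq_mul
    · intro j _
      have a := hu.1 j
      have b := hu'.1 j
      positivity
    · intro j _
      have a := hu.1 j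
      have b := hu'.1 j
      positivity
    · intro j _
      by_cases hz : u j + u' j = 0
      · have a := hu.1 j
        have b := hu'.1 j
        have a0 : u j = 0 := by linarith
        have b0 : u' j = 0 := by linarith
        simp [a0, b0]
      · rw [mul_pow, sq_abs (u j - u' j)]
        field_simp
  have h7 : ∑ j, |y j| * (u j + u' j) ≤ 2 := by
    simp only [mul_add, Finset.sum_add_distrib]
    linarith [hu.2.2]
  have h8 : ∑ j, |y j| * |u j - u' j| ≤ √(4 * s * δ) := by
    apply Real.le_sqrt_of_sq_le
    nlinarith
  have h9 : ∑ j, |y j * u j - y' j * u' j| ≤ 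
      ∑ j, |y j| * |u j - u' j| + ∑ j, |y j - y' j| * u' j := by
    rw [← Finset.sum_add_distrib]
    apply Finset.sum_le_sum
    intro j _
    rw [← abs_mul]
    have e : y j * u j - y' j * u' j = y j * (u j - u' j) + (y j - y' j) * u' j := by ring
    rw [e]
    refine (abs_add_le _ _).trans ?_
    rw [abs_mul (y j - y' j), abs_of_nonneg (hu'.1 j)]
  linarith

set_option maxHeartbeats 2000000 in
theorem holder_inv (hM : LN n M) (hs : 4 ≤ s) (hc : Conc n M s) (y y' u u' : Fin n → ℝ)
    (hy : M y = 1) (hy' : M y' = 1) (hu : Fac n M y u) (hu' : Fac n M y' u') :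
    ((M (y - y') / 3) ^ 2) ^ s ≤ s * (∑ j, |y j * u j - y' j * u' j|) / 2 := by
  set ε := ∑ j, |y j * u j - y' j * u' j| with hε
  have hs0 : 0 < s := by linarith
  set z : Fin n → ℝ := fun j => (|y j| + |y' j|) / 2 with hz
  set g : Fin n → ℝ := fun j => if 0 ≤ y j * y' j then √(|y j| * |y' j|) else 0 with hg
  set w : Fin n → ℝ := fun j => z j - g j with hw
  have hg0 : ∀ j, 0 ≤ g j := by
    intro j
    simp only [hg]
    split_ifs <;> positivity
  have hgsq : ∀ j, g j ^ 2 ≤ |y j| * |y' j| := by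
    intro j
    simp only [hg]
    split_ifs
    · rw [Real.sq_sqrt (by positivity)]
    · simp; positivity
  have hz0 : ∀ j, 0 ≤ z j := fun j => by simp only [hz]; positivity
  have hgz : ∀ j, g j ≤ z j := by
    intro j
    apply abs_le_of_sq_le_sq' _ (hz0 j) |>.2
    simp only [hz]
    nlinarith [hgsq j, sq_nonneg (|y j| - |y' j|)]
  have hw0 : ∀ j, 0 ≤ w j := fun j => sub_nonneg.2 (hgz j)
  have hMz : M z ≤ 1 := by
    have e : z = (1/2 : ℝ) • (|y| + |y'|) := by
      ext j
      simp [hz]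
      ring
    rw [e, hM.smul, abs_of_pos (by norm_num)]
    have h1 := hM.add |y| |y'|
    have h2 : M |y| ≤ M y := hM.mono _ _ (fun j => by simp)
    have h3 : M |y'| ≤ M y' := hM.mono _ _ (fun j => by simp)
    linarith
  have hcz := hc (fun j => g j / z j) (fun j => w j / z j) z
    (fun j => div_nonneg (hg0 j) (hz0 j)) (fun j => div_nonneg (hw0 j) (hz0 j)) (by
      intro j
      by_cases h0 : z j = 0
      · simp [h0, Real.zero_rpow hs0.ne']
      · have hp : 0 < z j := lt_of_le_of_ne (hz0 j) (Ne.symm h0)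
        have a1 : g j / z j ≤ 1 := div_le_one_of_le₀ (hgz j) (hz0 j)
        have a2 : w j / z j ≤ 1 := div_le_one_of_le₀ (by simp only [hw]; linarith [hg0 j]) (hz0 j)
        have b1 := Real.rpow_le_rpow_of_exponent_ge' (div_nonneg (hg0 j) (hz0 j)) a1 zero_le_one
          (by linarith : 1 ≤ s)
        have b2 := Real.rpow_le_rpow_of_exponent_ge' (div_nonneg (hw0 j) (hz0 j)) a2 zero_le_one
          (by linarith : 1 ≤ s)
        rw [Real.rpow_one] at b1 b2
        have : g j / z j + w j / z j = 1 := by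
          simp only [hw]
          field_simp
          ring
        linarith)
  have hcancel : ∀ f : Fin n → ℝ, (∀ j, 0 ≤ f j) → (∀ j, f j ≤ z j) → 
      (fun j => f j / z j) * z = f := by
    intro f hf hfz
    ext j
    simp only [Pi.mul_apply]
    by_cases h0 : z j = 0
    · have := hf j
      have := hfz j
      rw [h0]
      linarith
    · field_simp
  rw [hcancel g hg0 hgz, hcancel w hw0 (fun j => by simp only [hw]; linarith [hg0 j])] at hcz
  have hMz1 : M z ^ s ≤ 1 := Real.rpow_le_one (hM.nonneg _) hMz hs0.le
  have hgu : ∑ j, g j * u j ≤ M g := by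
    refine le_trans (le_of_eq ?_) (hu.2.1 g)
    exact Finset.sum_congr rfl (fun j _ => by rw [abs_of_nonneg (hg0 j)])
  have hgu' : ∑ j, g j * u' j ≤ M g := by
    refine le_trans (le_of_eq ?_) (hu'.2.1 g)
    exact Finset.sum_congr rfl (fun j _ => by rw [abs_of_nonneg (hg0 j)])
  have hcs : (∑ j, g j * √(u j * u' j)) ^ 2 ≤ (∑ j, g j * u j) * ∑ j, g j * u' j := by
    apply Finset.sum_sq_le_sum_mul_sum_of_sq_eq_mul
    · intro j _
      exact mul_nonneg (hg0 j) (hu.1 j)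
    · intro j _
      exact mul_nonneg (hg0 j) (hu'.1 j)
    · intro j _
      rw [mul_pow, Real.sq_sqrt (mul_nonneg (hu.1 j) (hu'.1 j))]
      ring
  have hle : 1 - ε / 2 ≤ ∑ j, g j * √(u j * u' j) := by
    have e : 1 - ε / 2 = ∑ j, (|y j| * u j + |y' j| * u' j - |y j * u j - y' j * u' j|) / 2 := by
      rw [← Finset.sum_div, Finset.sum_sub_distrib, Finset.sum_add_distrib, hu.2.2, hu'.2.2]
      ring
    rw [e]
    apply Finset.sum_le_sum
    intro j _
    have a := hu.1 j
    have b := hu'.1 j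
    simp only [hg]
    split_ifs with h0
    · rw [← Real.sqrt_mul (by positivity)]
      apply Real.le_sqrt_of_sq_le
      have e2 : |y j * u j - y' j * u' j| = |(|y j| * u j - |y' j| * u' j)| := by
        rcases le_total 0 (y j) with h1 | h1 <;> rcases le_total 0 (y' j) with h2 | h2
        · rw [abs_of_nonneg h1, abs_of_nonneg h2]
        · rcases h1.eq_or_lt with h3 | h3
          · rw [← h3]; simp
          · have : y' j = 0 := by nlinarith
            rw [this]; simp
        · rcases h2.eq_or_lt with h3 | h3
          · rw [← h3]; simp
          · have : y j = 0 := by nlinarith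
            rw [this]; simp
        · rw [abs_of_nonpos h1, abs_of_nonpos h2, ← abs_neg]
          congr 1
          ring
      rw [e2]
      have p1 : 0 ≤ |y j| * u j := by positivity
      have p2 : 0 ≤ |y' j| * u' j := by positivity
      have e3 : |y j| * |y' j| * (u j * u' j) = (|y j| * u j) * (|y' j| * u' j) := by ring
      rw [e3]
      generalize |y j| * u j = A at *
      generalize |y' j| * u' j = B at *
      rcases le_total A B with h | h
      · rw [abs_of_nonpos (by linarith)]
        nlinarith
      · rw [abs_of_nonneg (by linarith)]
        nlinarith
    · push Not at h0
      have : |y j| * u j + |y' j| * u' j ≤ |y j * u j - y' j * u' j| := by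
        rcases le_total 0 (y j) with h1 | h1
        · have h2 : y' j ≤ 0 := by nlinarith
          rw [abs_of_nonneg h1, abs_of_nonpos h2]
          refine le_trans (le_of_eq ?_) (le_abs_self _)
          ring
        · have h2 : 0 ≤ y' j := by nlinarith
          rw [abs_of_nonneg h2, abs_of_nonpos h1]
          refine le_trans (le_of_eq ?_) (neg_le_abs _)
          ring
      linarith
  have hε2 : ε ≤ 2 := by
    have : ε ≤ ∑ j, (|y j| * u j + |y' j| * u' j) := by
      apply Finset.sum_le_sum
      intro j _
      refine (abs_sub _ _).trans ?_
      rw [abs_mul, abs_mul, abs_of_nonneg (hu.1 j), abs_of_nonneg (hu'.1 j)]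
    rw [Finset.sum_add_distrib, hu.2.2, hu'.2.2] at this
    linarith
  have hMg : 1 - ε / 2 ≤ M g := by
    refine hle.trans ?_
    apply abs_le_of_sq_le_sq' _ (hM.nonneg _) |>.2
    refine hcs.trans ?_
    rw [sq]
    apply mul_le_mul hgu hgu' _ (hM.nonneg _)
    exact Finset.sum_nonneg fun j _ => mul_nonneg (hg0 j) (hu'.1 j)
  have hMw : M w ^ s ≤ s * ε / 2 := by
    have h1 := one_add_mul_self_le_rpow_one_add (by linarith : -1 ≤ -(ε / 2)) 
      (by linarith : 1 ≤ s)
    have h2 := Real.rpow_le_rpow (by linarith) hMg hs0.le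
    have h3 : 1 + -(ε / 2) = 1 - ε / 2 := by ring
    rw [h3] at h1
    linarith
  have hpt : ∀ j, (y j - y' j) ^ 2 ≤ 4 * w j * (2 * z j) := by
    intro j
    simp only [hw, hz, hg]
    split_ifs with h0
    · have e : |y j| * |y' j| = y j * y' j := by rw [← abs_mul, abs_of_nonneg h0]
      have hr := Real.sq_sqrt (by positivity : 0 ≤ |y j| * |y' j|)
      have hr0 := Real.sqrt_nonneg (|y j| * |y' j|)
      set r := √(|y j| * |y' j|)
      have a1 := sq_abs (y j)
      have a2 := sq_abs (y' j)
      have a3 := abs_nonneg (y j)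
      have a4 := abs_nonneg (y' j)
      have : (y j - y' j) ^ 2 = (|y j| + |y' j|) ^ 2 - 4 * r ^ 2 := by
        rw [hr]
        nlinarith
      rw [this]
      nlinarith [sq_nonneg (|y j| + |y' j| - 2 * r)]
    · push Not at h0
      have a1 := sq_abs (y j)
      have a2 := sq_abs (y' j)
      have : |y j| * |y' j| = - (y j * y' j) := by rw [← abs_mul, abs_of_neg h0]
      nlinarith
  have hfin : M (y - y') ≤ 3 * √(M w) := by
    rcases (hM.nonneg w).eq_or_lt with h0 | h0
    · have hw00 := hM.zero w h0.symm
      have : y - y' = 0 := by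
        ext j
        have := hpt j
        rw [hw00] at this
        simp at this ⊢
        nlinarith
      rw [this, hM.map_zero]
      positivity
    · set τ := √(M w) with hτ
      have hτ0 : 0 < τ := Real.sqrt_pos.2 h0
      have hττ : τ ^ 2 = M w := Real.sq_sqrt h0.le
      have h1 : M (y - y') ≤ M (τ⁻¹ • w + (2 * τ) • z) := by
        apply hM.mono
        intro j
        simp only [Pi.sub_apply, Pi.add_apply, Pi.smul_apply, smul_eq_mul]
        have hw1 := hw0 j
        have hz1 := hz0 j
        have hq0 : 0 ≤ τ⁻¹ * w j + 2 * τ * z j := by positivity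
        apply sq_le_sq.1
        refine (hpt j).trans ?_
        have e1 : 4 * w j * (2 * z j) = 4 * (τ⁻¹ * w j) * (2 * τ * z j) := by
          field_simp
        rw [e1]
        nlinarith [sq_nonneg (τ⁻¹ * w j - 2 * τ * z j)]
      refine h1.trans ((hM.add _ _).trans ?_)
      rw [hM.smul, hM.smul, abs_of_pos (by positivity), abs_of_pos (by positivity), ← hττ]
      have e1 : τ⁻¹ * τ ^ 2 = τ := by field_simp
      rw [e1]
      nlinarith
  have h1 : (M (y - y') / 3) ^ 2 ≤ M w := by
    have h2 : M (y - y') / 3 ≤ √(M w) := by linarith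
    have h3 := pow_le_pow_left₀ (by have := hM.nonneg (y - y'); positivity) h2 2
    rwa [Real.sq_sqrt (hM.nonneg w)] at h3
  exact (Real.rpow_le_rpow (by positivity) h1 hs0.le).trans hMw

end A

section A2
variable {n : ℕ} {M : (Fin n → ℝ) → ℝ} {s : ℝ}

theorem LN.cont (hM : LN n M) : Continuous M := by
  have hb : ∀ x : Fin n → ℝ, M x ≤ M 1 * ‖x‖ := by
    intro x
    have h1 : M x ≤ M (‖x‖ • (1 : Fin n → ℝ)) := by
      apply hM.mono
      intro j
      simp only [Pi.smul_apply, Pi.one_apply, smul_eq_mul, mul_one, abs_norm]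
      exact norm_le_pi_norm x j
    rw [hM.smul, abs_norm] at h1
    linarith
  have : LipschitzWith ⟨M 1, hM.nonneg 1⟩ M := by
    apply LipschitzWith.of_le_add_mul
    intro x y
    have h1 := hM.add y (x - y)
    rw [add_sub_cancel] at h1
    rw [dist_eq_norm]
    have h2 := hb (x - y)
    exact h1.trans (add_le_add le_rfl h2)
  exact this.continuous

theorem LN.compact (hM : LN n M) : IsCompact {y : Fin n → ℝ | (∀ j, 0 ≤ y j) ∧ M y ≤ 1} := by
  apply IsCompact.of_isClosed_subset
    (isCompact_Icc (a := (0 : Fin n → ℝ)) (b := fun j => 1 / M (Pi.single j 1)))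
  · apply IsClosed.inter
    · exact isClosed_Ici (a := (0 : Fin n → ℝ))
    · exact isClosed_le hM.cont continuous_const
  · rintro y ⟨h1, h2⟩
    refine ⟨h1, fun j => ?_⟩
    have h3 : M (Pi.single j (1:ℝ)) ≠ 0 := by
      intro h
      have := congrFun (hM.zero _ h) j
      simp at this
    have h4 : 0 < M (Pi.single j (1:ℝ)) := lt_of_le_of_ne (hM.nonneg _) (Ne.symm h3)
    simp only
    rw [le_div_iff₀ h4]
    refine le_trans ?_ h2
    rw [← abs_of_nonneg (h1 j), ← hM.smul]
    apply hM.mono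
    intro i
    by_cases h : i = j
    · subst h
      simp
    · simp [Pi.single_apply, h]

theorem log_prod_rpow (h w : Fin n → ℝ) (hw : ∀ j, h j ≠ 0 → 0 < w j) :
    0 < ∏ j, w j ^ h j ∧ Real.log (∏ j, w j ^ h j) = ∑ j, h j * Real.log (w j) := by
  have h1 : ∀ j, 0 < w j ^ h j := by
    intro j
    by_cases h0 : h j = 0
    · simp [h0]
    · exact Real.rpow_pos_of_pos (hw j h0) _
  refine ⟨Finset.prod_pos fun j _ => h1 j, ?_⟩
  rw [Real.log_prod (fun j _ => (h1 j).ne')]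
  apply Finset.sum_congr rfl
  intro j _
  by_cases h0 : h j = 0
  · simp [h0]
  · rw [Real.log_rpow (hw j h0)]

theorem exists_pt (hM : LN n M) (h : Fin n → ℝ) (hh : ∀ j, 0 ≤ h j) (hs : ∑ j, h j = 1) :
    ∃ y u : Fin n → ℝ, (∀ j, 0 ≤ y j) ∧ M y = 1 ∧ Fac n M y u ∧ ∀ j, y j * u j = h j := by
  have hM1 : 0 < M 1 := by
    refine lt_of_le_of_ne (hM.nonneg _) ?_
    intro h0
    have h1 := hM.zero _ h0.symm
    have : ∀ j, h j = 0 := by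
      intro j
      have := congrFun h1 j
      simp at this
    simp [this] at hs
  obtain ⟨y, ⟨hy0, hy1⟩, hmax⟩ := hM.compact.exists_isMaxOn
    (⟨0, fun j => le_rfl, by rw [hM.map_zero]; norm_num⟩)
    (f := fun w : Fin n → ℝ => ∏ j, w j ^ h j)
    (Continuous.continuousOn (continuous_finsetProd _ fun j _ =>
      (continuous_apply j).rpow_const fun _ => Or.inr (hh j)))
  rw [isMaxOn_iff] at hmax
  have hpos : 0 < ∏ j, y j ^ h j := by
    refine lt_of_lt_of_le (log_prod_rpow h ((M 1)⁻¹ • 1) ?_).1 (hmax _ ⟨?_, ?_⟩)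
    · intro j _
      simp [hM1]
    · intro j
      simp [hM1.le]
    · rw [hM.smul, abs_of_pos (by positivity), inv_mul_cancel₀ hM1.ne']
  have hyp : ∀ j, h j ≠ 0 → 0 < y j := by
    intro j hj
    refine lt_of_le_of_ne (hy0 j) ?_
    intro h0
    rw [Finset.prod_eq_zero (Finset.mem_univ j)] at hpos
    · exact lt_irrefl _ hpos
    · rw [← h0, Real.zero_rpow hj]
  have key : ∀ z : Fin n → ℝ, (∀ j, 0 ≤ z j) → M z ≤ 1 → ∑ j, z j * (h j / y j) ≤ 1 := by
    intro z hz0 hz1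
    have h1 : ∀ t : ℝ, 0 < t → t < 1 →
        ∑ j, h j * (z j - y j) / ((1 - t) * y j + t * z j) ≤ 0 := by
      intro t ht0 ht1
      have hp : ∀ j, h j ≠ 0 → 0 < (((1 - t) • y + t • z : Fin n → ℝ)) j := by
        intro j hj
        have a := hyp j hj
        have b := hz0 j
        simp only [Pi.add_apply, Pi.smul_apply, smul_eq_mul]
        have : 0 < (1 - t) * y j := mul_pos (by linarith) a
        positivity
      have h2 := hmax ((1 - t) • y + t • z) ⟨?_, ?_⟩
      · have h3 := Real.log_le_log (log_prod_rpow h _ hp).1 h2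
        rw [(log_prod_rpow h _ hp).2, (log_prod_rpow h _ hyp).2, ← sub_nonpos,
          ← Finset.sum_sub_distrib] at h3
        have h4 : t * ∑ j, h j * (z j - y j) / ((1 - t) * y j + t * z j) ≤ 0 := by
          refine le_trans ?_ h3
          rw [Finset.mul_sum]
          apply Finset.sum_le_sum
          intro j _
          by_cases h0 : h j = 0
          · simp [h0]
          · have a := hp j h0
            have b := hyp j h0
            simp only [Pi.add_apply, Pi.smul_apply, smul_eq_mul] at a ⊢
            have h5 := Real.one_sub_inv_le_log_of_pos (div_pos a b)
            rw [Real.log_div a.ne' b.ne'] at h5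
            rw [← mul_sub]
            refine le_trans (le_of_eq ?_) (mul_le_mul_of_nonneg_left h5 (hh j))
            rw [inv_div, ← mul_div_assoc, one_sub_div a.ne', ← mul_div_assoc]
            congr 1
            ring
        by_contra hcon
        push Not at hcon
        have := mul_pos ht0 hcon
        linarith
      · intro j
        have a := hy0 j
        have b := hz0 j
        simp only [Pi.add_apply, Pi.smul_apply, smul_eq_mul]
        have : 0 ≤ (1 - t) * y j := mul_nonneg (by linarith) a
        positivity
      · refine (hM.add _ _).trans ?_
        rw [hM.smul, hM.smul, abs_of_pos ht0, abs_of_pos (by linarith)]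
        nlinarith
    have h2 : Filter.Tendsto (fun t : ℝ => ∑ j, h j * (z j - y j) / ((1 - t) * y j + t * z j))
        (nhdsWithin 0 (Set.Ioi 0)) (nhds (∑ j, h j * (z j - y j) / ((1 - 0) * y j + 0 * z j))) := by
      apply tendsto_finsetSum
      intro j _
      by_cases h0 : h j = 0
      · simp [h0]
      · apply Filter.Tendsto.mono_left _ nhdsWithin_le_nhds
        apply ContinuousAt.tendsto (f := fun t : ℝ => h j * (z j - y j) / ((1 - t) * y j + t * z j))
        apply ContinuousAt.div
        · fun_prop
        · fun_prop
        · have := hyp j h0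
          simp [this.ne']
    have h3 := le_of_tendsto h2 (by
      filter_upwards [Ioo_mem_nhdsGT (zero_lt_one (α := ℝ))] with t ht
      exact h1 t ht.1 ht.2)
    have h4 : ∑ j, h j * (z j - y j) / ((1 - 0) * y j + 0 * z j) =
        ∑ j, z j * (h j / y j) - ∑ j, h j := by
      rw [← Finset.sum_sub_distrib]
      apply Finset.sum_congr rfl
      intro j _
      by_cases h0 : h j = 0
      · simp [h0]
      · have := hyp j h0
        rw [sub_zero, one_mul, zero_mul, add_zero, mul_sub, sub_div, mul_div_assoc, mul_div_assoc,
          div_self this.ne']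
        ring
    rw [h4, hs] at h3
    linarith
  have hyu : ∀ j, y j * (h j / y j) = h j := by
    intro j
    by_cases h0 : h j = 0
    · simp [h0]
    · have := hyp j h0
      field_simp
  have hb : ∀ z : Fin n → ℝ, ∑ j, |z j| * (h j / y j) ≤ M z := by
    intro z
    rcases (hM.nonneg z).eq_or_lt with h0 | h0
    · rw [hM.zero z h0.symm, hM.map_zero]
      simp
    · have h1 := key (fun j => (M z)⁻¹ * |z j|) (fun j => by positivity) (by
        have : M (fun j => (M z)⁻¹ * |z j|) ≤ M ((M z)⁻¹ • z) := by
          apply hM.mono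
          intro j
          simp [abs_mul]
        rw [hM.smul, abs_of_pos (by positivity), inv_mul_cancel₀ h0.ne'] at this
        exact this)
      simp only [mul_assoc] at h1
      rw [← Finset.mul_sum, inv_mul_le_iff₀ h0, mul_one] at h1
      exact h1
  have hone : ∑ j, |y j| * (h j / y j) = 1 := by
    rw [← hs]
    apply Finset.sum_congr rfl
    intro j _
    rw [abs_of_nonneg (hy0 j), hyu]
  refine ⟨y, fun j => h j / y j, hy0, le_antisymm hy1 ?_, ⟨fun j => div_nonneg (hh j) (hy0 j), hb, hone⟩,
    hyu⟩
  rw [← hone]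
  exact hb y

end A2

/-- Euclidean norm. -/
noncomputable def Eu (n : ℕ) (v : Fin n → ℝ) : ℝ := √(∑ j, v j ^ 2)

/-- The relation between the spheres. -/
def Qr (n : ℕ) (M : (Fin n → ℝ) → ℝ) (y v : Fin n → ℝ) : Prop :=
  ∃ u, Fac n M y u ∧ ∀ j, v j * |v j| = y j * u j

section A3
variable {n : ℕ} {M N F : (Fin n → ℝ) → ℝ} {s D : ℝ}

theorem Eu_LN : LN n (Eu n) := by
  have he : ∀ x : Fin n → ℝ, Eu n x = ‖(WithLp.toLp 2 x : EuclideanSpace ℝ (Fin n))‖ := by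
    intro x
    rw [EuclideanSpace.norm_eq]
    simp [Eu]
  refine ⟨fun x => Real.sqrt_nonneg _, ?_, ?_, ?_, ?_⟩
  · intro x hx
    rw [he, norm_eq_zero] at hx
    simpa using hx
  · intro c x
    rw [he, he, WithLp.toLp_smul, norm_smul, Real.norm_eq_abs]
  · intro x y
    rw [he, he, he, WithLp.toLp_add]
    exact norm_add_le _ _
  · intro x y h
    apply Real.sqrt_le_sqrt
    exact Finset.sum_le_sum fun j _ => sq_le_sq.2 (h j)

theorem Eu_sq (v : Fin n → ℝ) : Eu n v ^ 2 = ∑ j, v j ^ 2 :=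
  Real.sq_sqrt (Finset.sum_nonneg fun _ _ => sq_nonneg _)

theorem Q_exists (hM : LN n M) (y : Fin n → ℝ) (hy : M y = 1) : ∃ v, Qr n M y v := by
  obtain ⟨u, hu⟩ := exists_fac hM y hy
  refine ⟨fun j => (y j * u j) / √|y j * u j|, u, hu, fun j => ?_⟩
  simp only
  generalize y j * u j = h
  by_cases h0 : h = 0
  · simp [h0]
  · have h1 : 0 < |h| := abs_pos.2 h0
    simp only [abs_div, abs_of_nonneg (Real.sqrt_nonneg _)]
    rw [div_mul_div_comm, Real.mul_self_sqrt h1.le]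
    field_simp

theorem Q_unit {y v : Fin n → ℝ} (h : Qr n M y v) : Eu n v = 1 := by
  obtain ⟨u, hu, hv⟩ := h
  have : ∑ j, v j ^ 2 = 1 := by
    rw [← hu.2.2]
    apply Finset.sum_congr rfl
    intro j _
    have := congrArg abs (hv j)
    rw [abs_mul, abs_mul, abs_abs, abs_of_nonneg (hu.1 j), abs_mul_abs_self] at this
    rw [← this]
    ring
  rw [Eu, this, Real.sqrt_one]

theorem Q_surj (hM : LN n M) (v : Fin n → ℝ) (hv : Eu n v = 1) : ∃ y, M y = 1 ∧ Qr n M y v := by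
  obtain ⟨y, u, hy0, hy1, hu, hyu⟩ := exists_pt hM (fun j => v j ^ 2) (fun j => sq_nonneg _)
    (by rw [← Eu_sq, hv]; norm_num)
  have hab : ∀ j, |(if 0 ≤ v j then y j else - y j)| = |y j| := by
    intro j
    split_ifs <;> simp
  have hyy : M (fun j => if 0 ≤ v j then y j else - y j) = M y := by
    apply le_antisymm <;> apply hM.mono <;> intro j <;> rw [hab]
  refine ⟨fun j => if 0 ≤ v j then y j else - y j, by rw [hyy, hy1], u, ⟨hu.1, hu.2.1, ?_⟩, ?_⟩
  · rw [← hu.2.2]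
    exact Finset.sum_congr rfl fun j _ => by rw [hab]
  · intro j
    have := hyu j
    simp only
    split_ifs with h
    · rw [this, abs_of_nonneg h]
      ring
    · rw [neg_mul, this, abs_of_neg (not_le.1 h)]
      ring

theorem pt1 (a b : ℝ) : (a - b) ^ 2 ≤ 2 * |(a * |a| - b * |b|)| := by
  rcases le_total 0 a with ha | ha <;> rcases le_total 0 b with hb | hb
  · rw [abs_of_nonneg ha, abs_of_nonneg hb]
    rcases le_total a b with h | h
    · rw [abs_of_nonpos (by nlinarith)]
      nlinarith
    · rw [abs_of_nonneg (by nlinarith)]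
      nlinarith
  · rw [abs_of_nonneg ha, abs_of_nonpos hb, abs_of_nonneg (by nlinarith)]
    nlinarith [sq_nonneg (a + b)]
  · rw [abs_of_nonpos ha, abs_of_nonneg hb, abs_of_nonpos (by nlinarith)]
    nlinarith [sq_nonneg (a + b)]
  · rw [abs_of_nonpos ha, abs_of_nonpos hb]
    rcases le_total a b with h | h
    · rw [abs_of_nonpos (by nlinarith)]
      nlinarith
    · rw [abs_of_nonneg (by nlinarith)]
      nlinarith

theorem pt2 (a b : ℝ) : |(a * |a| - b * |b|)| ≤ |a - b| * (|a| + |b|) := by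
  have : a * |a| - b * |b| = (a - b) * |a| + b * (|a| - |b|) := by ring
  rw [this]
  refine (abs_add_le _ _).trans ?_
  rw [abs_mul, abs_mul, abs_abs, mul_add, mul_comm |b|]
  have := abs_abs_sub_abs_le a b
  have := mul_le_mul_of_nonneg_right this (abs_nonneg b)
  linarith

theorem Q_fwd (hM : LN n M) (hs : 4 ≤ s) (hc : Conc n M s) {y y' v v' : Fin n → ℝ}
    (hy : M y = 1) (hv : Qr n M y v) (hv' : Qr n M y' v') :
    Eu n (v - v') ^ 2 ≤ 2 * (√(4 * s * M (y - y')) + M (y - y')) := by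
  obtain ⟨u, hu, hvu⟩ := hv
  obtain ⟨u', hu', hvu'⟩ := hv'
  have h1 := holder_fwd hM hs hc y y' u u' hy hu hu'
  refine le_trans ?_ (mul_le_mul_of_nonneg_left h1 (by norm_num))
  rw [Eu_sq, Finset.mul_sum]
  apply Finset.sum_le_sum
  intro j _
  rw [← hvu, ← hvu']
  exact pt1 _ _

theorem Q_inv (hM : LN n M) (hs : 4 ≤ s) (hc : Conc n M s) {y y' v v' : Fin n → ℝ}
    (hy : M y = 1) (hy' : M y' = 1) (hv : Qr n M y v) (hv' : Qr n M y' v') :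
    ((M (y - y') / 3) ^ 2) ^ s ≤ s * Eu n (v - v') := by
  have hv1 := Q_unit hv
  have hv1' := Q_unit hv'
  obtain ⟨u, hu, hvu⟩ := hv
  obtain ⟨u', hu', hvu'⟩ := hv'
  have h1 := holder_inv hM hs hc y y' u u' hy hy' hu hu'
  refine h1.trans ?_
  have h2 : ∑ j, |y j * u j - y' j * u' j| ≤ 2 * Eu n (v - v') := by
    have h3 : ∑ j, |y j * u j - y' j * u' j| ≤ ∑ j, |v j - v' j| * (|v j| + |v' j|) := by
      apply Finset.sum_le_sum
      intro j _
      rw [← hvu, ← hvu']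
      exact pt2 _ _
    refine h3.trans ?_
    apply (abs_le_of_sq_le_sq' _ (mul_nonneg (by norm_num) (Eu_LN.nonneg _))).2
    refine (Finset.sum_mul_sq_le_sq_mul_sq _ _ _).trans ?_
    have h4 : ∑ j, |v j - v' j| ^ 2 = Eu n (v - v') ^ 2 := by
      rw [Eu_sq]
      simp
    have h5 : ∑ j, (|v j| + |v' j|) ^ 2 ≤ 4 := by
      have h6 : ∑ j, (|v j| + |v' j|) ^ 2 ≤ ∑ j, (2 * v j ^ 2 + 2 * v' j ^ 2) := by
        apply Finset.sum_le_sum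
        intro j _
        nlinarith [sq_nonneg (|v j| - |v' j|), sq_abs (v j), sq_abs (v' j)]
      rw [Finset.sum_add_distrib, ← Finset.mul_sum, ← Finset.mul_sum, ← Eu_sq v, ← Eu_sq v', hv1,
        hv1'] at h6
      linarith
    rw [h4]
    nlinarith [sq_nonneg (Eu n (v - v'))]
  nlinarith

/-- The sphere map. -/
theorem exists_om (hM : LN n M) (hs : 4 ≤ s) (hc : Conc n M s) :
    ∃ ω : (Fin n → ℝ) → (Fin n → ℝ), (∀ y, M y = 1 → Eu n (ω y) = 1) ∧
      (∀ y y', M y = 1 → M y' = 1 →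
        Eu n (ω y - ω y') ^ 2 ≤ 2 * (√(4 * s * M (y - y')) + M (y - y'))) ∧
      (∀ y y', M y = 1 → M y' = 1 → ((M (y - y') / 3) ^ 2) ^ s ≤ s * Eu n (ω y - ω y')) ∧
      ∀ v, Eu n v = 1 → ∃ y, M y = 1 ∧ ω y = v := by
  have : ∀ y : Fin n → ℝ, ∃ v, M y = 1 → Qr n M y v := by
    intro y
    by_cases h : M y = 1
    · obtain ⟨v, hv⟩ := Q_exists hM y h
      exact ⟨v, fun _ => hv⟩
    · exact ⟨0, fun h' => absurd h' h⟩
  choose ω hω using this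
  refine ⟨ω, fun y hy => Q_unit (hω y hy), fun y y' hy hy' => Q_fwd hM hs hc hy (hω y hy) (hω y' hy'),
    fun y y' hy hy' => Q_inv hM hs hc hy hy' (hω y hy) (hω y' hy'), ?_⟩
  intro v hv
  obtain ⟨y, hy, hq⟩ := Q_surj hM v hv
  refine ⟨y, hy, ?_⟩
  have h := Q_fwd hM hs hc hy (hω y hy) hq
  rw [sub_self, hM.map_zero] at h
  simp only [mul_zero, Real.sqrt_zero, add_zero] at h
  have h0 : Eu n (ω y - v) = 0 := by
    have := sq_nonneg (Eu n (ω y - v))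
    exact pow_eq_zero_iff (two_ne_zero) |>.1 (le_antisymm h this)
  exact sub_eq_zero.1 (Eu_LN.zero _ h0)

theorem LN.rev (hF : LN n F) (x y : Fin n → ℝ) : F x - F y ≤ F (x - y) := by
  have := hF.add (x - y) y
  rw [sub_add_cancel] at this
  linarith

theorem LN.R1 (hF : LN n F) (a a' : Fin n → ℝ) (ha : F a = 1) {ρ ρ' : ℝ} (h0 : 0 ≤ ρ')
    (h : ρ' ≤ ρ) : F (ρ • a - ρ' • a') ≤ ρ - ρ' + ρ' * F (a - a') := by
  have e : ρ • a - ρ' • a' = (ρ - ρ') • a + ρ' • (a - a') := by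
    rw [sub_smul, smul_sub]
    abel
  rw [e]
  refine (hF.add _ _).trans ?_
  rw [hF.smul, hF.smul, abs_of_nonneg h0, abs_of_nonneg (by linarith), ha, mul_one]

theorem LN.R2 (hF : LN n F) (x x' : Fin n → ℝ) (hx : 0 < F x) (hx' : 0 < F x') :
    F x * F ((F x)⁻¹ • x - (F x')⁻¹ • x') ≤ 2 * F (x - x') := by
  have e : F x • ((F x)⁻¹ • x - (F x')⁻¹ • x') = (x - x') + ((F x' - F x) * (F x')⁻¹) • x' := by
    ext j
    simp only [Pi.smul_apply, Pi.sub_apply, Pi.add_apply, smul_eq_mul]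
    field_simp
    ring
  have h1 := hF.add (x - x') (((F x' - F x) * (F x')⁻¹) • x')
  rw [← e, hF.smul, hF.smul, abs_of_pos hx, abs_mul, abs_of_pos (inv_pos.2 hx'), mul_assoc,
    inv_mul_cancel₀ hx'.ne', mul_one] at h1
  have h2 : |F x' - F x| ≤ F (x - x') := by
    rw [abs_le]
    have a := hF.rev x x'
    have b := hF.rev x' x
    rw [hF.sub_comm] at b
    constructor <;> linarith
  linarith

end A3

section C
variable {n : ℕ} {M N : (Fin n → ℝ) → ℝ} {s D : ℝ}

theorem geo (hN : LN n N) (hM : LN n M) (hs : 4 ≤ s) (hD : 1 ≤ D) (hNM : ∀ x, N x ≤ M x)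
    (hMN : ∀ x, M x ≤ D * N x) (ω : (Fin n → ℝ) → (Fin n → ℝ))
    (h1 : ∀ y, M y = 1 → Eu n (ω y) = 1)
    (h2 : ∀ y y', M y = 1 → M y' = 1 →
        Eu n (ω y - ω y') ^ 2 ≤ 2 * (√(4 * s * M (y - y')) + M (y - y')))
    (h3 : ∀ y y', M y = 1 → M y' = 1 → ((M (y - y') / 3) ^ 2) ^ s ≤ s * Eu n (ω y - ω y'))
    (Φ : (Fin n → ℝ) → (Fin n → ℝ)) (hΦ : ∀ x, Φ x = N x • ω ((M x)⁻¹ • x))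
    (x x' : Fin n → ℝ) (hx1 : N x ≤ 1) (hxx : N x' ≤ N x) :
    (∃ b, 0 ≤ b ∧ Eu n (Φ x - Φ x') ≤ N (x - x') + b ∧ b ^ 4 ≤ 72 * s * D * N (x - x')) ∧
    (N (x - x') ≤ 2 * Eu n (Φ x - Φ x') ∨
      (N (x - x') ^ 2) ^ s ≤ ((12 * D) ^ 2) ^ s * (2 * s * Eu n (Φ x - Φ x'))) := by
  have hs0 : 0 < s := by linarith
  have hMp : ∀ x, 0 < N x → 0 < M x := fun x h => lt_of_lt_of_le h (hNM x)
  have hMy : ∀ x, 0 < N x → M ((M x)⁻¹ • x) = 1 := by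
    intro x hx
    rw [hM.smul, abs_of_pos (inv_pos.2 (hMp x hx)), inv_mul_cancel₀ (hMp x hx).ne']
  have hEΦ : ∀ x, 0 < N x → Eu n (Φ x) = N x := by
    intro x hx
    rw [hΦ, Eu_LN.smul, h1 _ (hMy x hx), abs_of_pos hx, mul_one]
  have hδ0 := hN.nonneg (x - x')
  rcases (hN.nonneg x').eq_or_lt with h0 | h0
  · have hx' : x' = 0 := hN.zero _ h0.symm
    have hΦ' : Φ x' = 0 := by rw [hΦ, ← h0, zero_smul]
    have hE : Eu n (Φ x - Φ x') = N (x - x') := by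
      rw [hΦ', hx', sub_zero, sub_zero]
      rcases (hN.nonneg x).eq_or_lt with h4 | h4
      · rw [hΦ, ← h4, zero_smul, Eu_LN.map_zero]
      · exact hEΦ x h4
    rw [hE]
    refine ⟨⟨0, le_rfl, by linarith, ?_⟩, Or.inl (by linarith)⟩
    rw [zero_pow (by norm_num)]
    positivity
  have h0x : 0 < N x := lt_of_lt_of_le h0 hxx
  set y := (M x)⁻¹ • x with hy
  set y' := (M x')⁻¹ • x' with hy'
  have my : M y = 1 := hMy x h0x
  have my' : M y' = 1 := hMy x' h0
  set δ := N (x - x') with hδ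
  set Δ := Eu n (Φ x - Φ x') with hΔ
  set κ := M (y - y') with hκ
  set η := Eu n (ω y - ω y') with hη
  set ρ := N x with hρ
  set ρ' := N x' with hρ'
  have hκ0 : 0 ≤ κ := hM.nonneg _
  have hη0 : 0 ≤ η := Eu_LN.nonneg _
  have hΔ0 : 0 ≤ Δ := Eu_LN.nonneg _
  have hκ2 : κ ≤ 2 := by
    have a := hM.add y (-y')
    rw [hM.neg, my, my', ← sub_eq_add_neg] at a
    linarith
  have hκδ : ρ * κ ≤ 2 * D * δ := by
    have a := hM.R2 x x' (hMp x h0x) (hMp x' h0)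
    have b := hMN (x - x')
    have c := mul_le_mul_of_nonneg_right (hNM x) hκ0
    change M x * κ ≤ _ at a
    nlinarith
  have hΦx : Φ x = ρ • ω y := hΦ x
  have hΦx' : Φ x' = ρ' • ω y' := hΦ x'
  have hρd : ρ - ρ' ≤ δ := hN.rev x x'
  constructor
  · refine ⟨ρ' * η, by positivity, ?_, ?_⟩
    · have := Eu_LN.R1 (ω y) (ω y') (h1 y my) h0.le hxx
      rw [← hΦx, ← hΦx'] at this
      linarith
    · have a : η ^ 2 ≤ 6 * √(s * κ) := by
        refine (h2 y y' my my').trans ?_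
        have e : √(4 * s * κ) = 2 * √(s * κ) := by
          rw [mul_assoc, Real.sqrt_mul (by norm_num)]
          congr 1
          rw [show (4:ℝ) = 2 ^ 2 by norm_num, Real.sqrt_sq (by norm_num)]
        have e2 : κ ≤ √(s * κ) := by
          apply Real.le_sqrt_of_sq_le
          nlinarith
        rw [e]
        linarith
      have b : η ^ 4 ≤ 36 * (s * κ) := by
        have := pow_le_pow_left₀ (sq_nonneg _) a 2
        rw [mul_pow, Real.sq_sqrt (by positivity)] at this
        calc η ^ 4 = (η ^ 2) ^ 2 := by ring
          _ ≤ _ := this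
          _ = _ := by norm_num
      have c : ρ' ^ 4 ≤ ρ := by
        calc ρ' ^ 4 ≤ ρ ^ 4 := pow_le_pow_left₀ h0.le hxx 4
          _ ≤ ρ ^ 1 := pow_le_pow_of_le_one h0x.le hx1 (by norm_num)
          _ = ρ := pow_one _
      rw [mul_pow]
      calc ρ' ^ 4 * η ^ 4 ≤ ρ * (36 * (s * κ)) := mul_le_mul c b (by positivity) h0x.le
        _ = 36 * s * (ρ * κ) := by ring
        _ ≤ 36 * s * (2 * D * δ) := by gcongr
        _ = _ := by ring
  · by_cases hcase : δ ≤ 2 * Δ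
    · exact Or.inl hcase
    · right
      push Not at hcase
      have a : ρ - ρ' ≤ Δ := by
        have := Eu_LN.rev (Φ x) (Φ x')
        rwa [hEΦ x h0x, hEΦ x' h0] at this
      have b : ρ * η ≤ 2 * Δ := by
        have := Eu_LN.R2 (Φ x) (Φ x') (by rw [hEΦ x h0x]; exact h0x) (by rw [hEΦ x' h0]; exact h0)
        rw [hEΦ x h0x, hEΦ x' h0] at this
        rw [← hρ, ← hρ', hΦx, hΦx', smul_smul, smul_smul, inv_mul_cancel₀ h0x.ne',
          inv_mul_cancel₀ h0.ne', one_smul, one_smul, ← hΦx, ← hΦx'] at this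
        exact this
      have hNy : ∀ x, 0 < N x → 0 < N ((M x)⁻¹ • x) ∧ 1 ≤ D * N ((M x)⁻¹ • x) := by
        intro x hx
        have e := hMy x hx
        have f := hMN ((M x)⁻¹ • x)
        rw [e] at f
        refine ⟨?_, f⟩
        by_contra hh
        push Not at hh
        nlinarith
      have hyh : ∀ x, 0 < N x → (N ((M x)⁻¹ • x))⁻¹ • ((M x)⁻¹ • x) = (N x)⁻¹ • x := by
        intro x hx
        have := hMp x hx
        rw [hN.smul, abs_of_pos (inv_pos.2 this), smul_smul]
        congr 1
        field_simp
      have c : N ((N x)⁻¹ • x - (N x')⁻¹ • x') ≤ 2 * D * κ := by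
        have e := hN.R2 y y' (hNy x h0x).1 (hNy x' h0).1
        rw [hyh x h0x, hyh x' h0] at e
        have f := hNM (y - y')
        have g := (hNy x h0x).2
        have i := hN.nonneg ((N x)⁻¹ • x - (N x')⁻¹ • x')
        calc N ((N x)⁻¹ • x - (N x')⁻¹ • x') ≤ (D * N y) * N ((N x)⁻¹ • x - (N x')⁻¹ • x') :=
              le_mul_of_one_le_left i g
          _ = D * (N y * N ((N x)⁻¹ • x - (N x')⁻¹ • x')) := by ring
          _ ≤ D * (2 * κ) := by
              apply mul_le_mul_of_nonneg_left _ (by linarith)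
              linarith
          _ = _ := by ring
      have d : δ ≤ ρ - ρ' + ρ' * (2 * D * κ) := by
        have e := hN.R1 ((N x)⁻¹ • x) ((N x')⁻¹ • x') (by
          rw [hN.smul, abs_of_pos (inv_pos.2 h0x), inv_mul_cancel₀ h0x.ne']) h0.le hxx
        rw [← hρ, ← hρ', smul_smul, smul_smul, mul_inv_cancel₀ h0x.ne', mul_inv_cancel₀ h0.ne',
          one_smul, one_smul] at e
        refine e.trans ?_
        have := mul_le_mul_of_nonneg_left c h0.le
        linarith
      have e : δ ≤ 12 * D * (ρ * (κ / 3)) := by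
        have f : ρ' * (2 * D * κ) ≤ ρ * (2 * D * κ) := mul_le_mul_of_nonneg_right hxx (by positivity)
        nlinarith
      have f : (δ ^ 2) ^ s ≤ ((12 * D) ^ 2) ^ s * ((ρ ^ 2) ^ s * ((κ / 3) ^ 2) ^ s) := by
        rw [← Real.mul_rpow (by positivity) (by positivity),
          ← Real.mul_rpow (by positivity) (by positivity), ← mul_pow, ← mul_pow]
        apply Real.rpow_le_rpow (by positivity) _ hs0.le
        exact pow_le_pow_left₀ hδ0 e 2
      refine f.trans ?_
      apply mul_le_mul_of_nonneg_left _ (by positivity)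
      have g : (ρ ^ 2) ^ s ≤ ρ := by
        have i : ρ ^ 2 ≤ 1 := pow_le_one₀ h0x.le hx1
        have j := Real.rpow_le_rpow_of_exponent_ge' (sq_nonneg ρ) i zero_le_one
          (by linarith : 1 ≤ s)
        rw [Real.rpow_one] at j
        nlinarith
      calc (ρ ^ 2) ^ s * ((κ / 3) ^ 2) ^ s ≤ ρ * (s * η) :=
            mul_le_mul g (h3 y y' my my') (by positivity) h0x.le
        _ = s * (ρ * η) := by ring
        _ ≤ s * (2 * Δ) := by gcongr
        _ = _ := by ring

theorem ar_up {q C δ b Δ : ℝ} (hq : 2 ≤ q) (hC : 1 ≤ C) (hδ0 : 0 ≤ δ) (hδ2 : δ ≤ 2) (hb : 0 ≤ b)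
    (hΔ : Δ ≤ δ + b) (hb4 : b ^ 4 ≤ 72 * (2 * q) * (6 * √C) * δ) :
    Δ ≤ 8 * √5 / √(1 - Real.exp (-1)) * √q * C ^ ((1 : ℝ) / 4) * δ ^ ((1 : ℝ) / 8) := by
  set X := √q * C ^ ((1 : ℝ) / 4) * δ ^ ((1 : ℝ) / 8) with hX
  have hX0 : 0 ≤ X := by positivity
  have hX8 : X ^ 8 = q ^ 4 * C ^ 2 * δ := by
    have e1 : √q ^ 8 = q ^ 4 := by
      calc √q ^ 8 = (√q ^ 2) ^ 4 := by ring
        _ = _ := by rw [Real.sq_sqrt (by linarith)]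
    have e2 : (C ^ ((1 : ℝ) / 4)) ^ 8 = C ^ 2 := by
      rw [← Real.rpow_natCast, ← Real.rpow_mul (by linarith), ← Real.rpow_natCast]
      norm_num
    have e3 : (δ ^ ((1 : ℝ) / 8)) ^ 8 = δ := by
      rw [← Real.rpow_natCast, ← Real.rpow_mul hδ0]
      norm_num
    rw [hX, mul_pow, mul_pow, e1, e2, e3]
  have hq2 : q ^ 2 ≤ q ^ 4 := pow_le_pow_right₀ (by linarith) (by norm_num)
  have hC2 : C ≤ C ^ 2 := by nlinarith
  have hqC : q ^ 2 * C ≤ q ^ 4 * C ^ 2 := mul_le_mul hq2 hC2 (by linarith) (by positivity)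
  have k1 : b ≤ 6 * X := by
    apply (pow_le_pow_iff_left₀ hb (by positivity) (by norm_num : (8:ℕ) ≠ 0)).1
    rw [mul_pow, hX8]
    have h1 := pow_le_pow_left₀ (by positivity) hb4 2
    have e : (72 * (2 * q) * (6 * √C) * δ) ^ 2 = 746496 * (q ^ 2 * C) * δ ^ 2 := by
      have := Real.sq_sqrt (by linarith : 0 ≤ C)
      calc (72 * (2 * q) * (6 * √C) * δ) ^ 2 = 746496 * (q ^ 2 * √C ^ 2) * δ ^ 2 := by ring
        _ = _ := by rw [this]
    rw [e] at h1
    have h2 : δ ^ 2 ≤ 2 * δ := by nlinarith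
    calc b ^ 8 = (b ^ 4) ^ 2 := by ring
      _ ≤ 746496 * (q ^ 2 * C) * δ ^ 2 := h1
      _ ≤ 746496 * (q ^ 4 * C ^ 2) * (2 * δ) := by gcongr
      _ ≤ _ := by
        have : 0 ≤ q ^ 4 * C ^ 2 * δ := by positivity
        nlinarith
  have k2 : δ ≤ 2 * X := by
    apply (pow_le_pow_iff_left₀ hδ0 (by positivity) (by norm_num : (8:ℕ) ≠ 0)).1
    rw [mul_pow, hX8]
    have h1 : δ ^ 7 ≤ 2 ^ 7 := pow_le_pow_left₀ hδ0 hδ2 7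
    have h2 : 1 ≤ q ^ 4 * C ^ 2 := by
      have a : (1:ℝ) ≤ q ^ 4 := one_le_pow₀ (by linarith)
      have b : (1:ℝ) ≤ C ^ 2 := one_le_pow₀ (by linarith)
      nlinarith
    calc δ ^ 8 = δ ^ 7 * δ := by ring
      _ ≤ 2 ^ 7 * δ := by gcongr
      _ ≤ 2 ^ 8 * (1 * δ) := by nlinarith
      _ ≤ 2 ^ 8 * (q ^ 4 * C ^ 2 * δ) := by gcongr
  have k3 : 8 ≤ 8 * √5 / √(1 - Real.exp (-1)) := by
    have a : Real.exp (-1) < 1 := by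
      rw [Real.exp_lt_one_iff]
      norm_num
    have a' := Real.exp_pos (-1)
    rw [le_div_iff₀ (Real.sqrt_pos.2 (by linarith))]
    have b : √(1 - Real.exp (-1)) ≤ √5 := Real.sqrt_le_sqrt (by linarith)
    linarith
  calc Δ ≤ 8 * X := by linarith
    _ ≤ 8 * √5 / √(1 - Real.exp (-1)) * X := by gcongr
    _ = _ := by rw [hX]; ring

theorem ar_low {q C δ Δ : ℝ} (hq : 2 ≤ q) (hC : 1 ≤ C) (hδ0 : 0 ≤ δ) (hδ2 : δ ≤ 2) (hΔ : 0 ≤ Δ)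
    (h : δ ≤ 2 * Δ ∨ (δ ^ 2) ^ (2 * q) ≤ ((12 * (6 * √C)) ^ 2) ^ (2 * q) * (2 * (2 * q) * Δ)) :
    δ ^ (24 * q) / ((1 - Real.exp (-1)) ^ (-(24 * q)) * 2 ^ (190 * q + 20) * q ^ (24 * q + 6) *
              C ^ (12 * q)) ≤ Δ := by
  have e0 : (δ ^ 2) ^ (2 * q) = δ ^ (4 * q) := by
    rw [← Real.rpow_natCast, ← Real.rpow_mul hδ0]
    congr 1
    push_cast
    ring
  have hC1 : 1 ≤ C ^ (2 * q) := Real.one_le_rpow hC (by linarith)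
  have h2q : (1:ℝ) ≤ 2 ^ (26 * q) := Real.one_le_rpow (by norm_num) (by linarith)
  have k1 : δ ^ (4 * q) ≤ 2 ^ (26 * q) * C ^ (2 * q) * (4 * q) * Δ := by
    rcases h with h | h
    · have a : δ ^ (4 * q) ≤ 2 ^ (26 * q) * Δ := by
        rcases hδ0.eq_or_lt with h0 | h0
        · rw [← h0, Real.zero_rpow (by linarith)]
          positivity
        · calc δ ^ (4 * q) = δ ^ (4 * q - 1) * δ := by
                rw [Real.rpow_sub_one h0.ne']
                field_simp
            _ ≤ 2 ^ (4 * q - 1) * (2 * Δ) := by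
                apply mul_le_mul _ h hδ0 (by positivity)
                exact Real.rpow_le_rpow hδ0 hδ2 (by linarith)
            _ = 2 ^ (4 * q) * Δ := by
                rw [Real.rpow_sub_one (by norm_num)]
                ring
            _ ≤ _ := by
                apply mul_le_mul_of_nonneg_right _ hΔ
                exact Real.rpow_le_rpow_of_exponent_le (by norm_num) (by linarith)
      refine a.trans ?_
      apply mul_le_mul_of_nonneg_right _ hΔ
      have b : 1 ≤ C ^ (2 * q) * (4 * q) := by nlinarith
      rw [mul_assoc]
      exact le_mul_of_one_le_right (by positivity) b
    · rw [e0] at h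
      refine h.trans ?_
      have e1 : (12 * (6 * √C)) ^ 2 = 5184 * C := by
        have := Real.sq_sqrt (by linarith : 0 ≤ C)
        calc (12 * (6 * √C)) ^ 2 = 5184 * √C ^ 2 := by ring
          _ = _ := by rw [this]
      have e2 : (5184 : ℝ) ^ (2 * q) ≤ 2 ^ (26 * q) := by
        calc (5184 : ℝ) ^ (2 * q) ≤ (2 ^ (13:ℝ)) ^ (2 * q) := by
              apply Real.rpow_le_rpow (by norm_num) _ (by linarith)
              norm_num
          _ = _ := by
              rw [← Real.rpow_mul (by norm_num)]
              congr 1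
              ring
      rw [e1, Real.mul_rpow (by norm_num) (by linarith)]
      calc (5184 : ℝ) ^ (2 * q) * C ^ (2 * q) * (2 * (2 * q) * Δ)
          ≤ 2 ^ (26 * q) * C ^ (2 * q) * (2 * (2 * q) * Δ) := by gcongr
        _ = _ := by ring
  have k2 : δ ^ (24 * q) ≤ 2 ^ (20 * q) * δ ^ (4 * q) := by
    have e : 24 * q = 20 * q + 4 * q := by ring
    rw [e, Real.rpow_add_of_nonneg hδ0 (by linarith) (by linarith)]
    apply mul_le_mul_of_nonneg_right _ (by positivity)
    exact Real.rpow_le_rpow hδ0 hδ2 (by linarith)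
  have a : Real.exp (-1) < 1 := by
    rw [Real.exp_lt_one_iff]
    norm_num
  have a' := Real.exp_pos (-1)
  have k3 : 1 ≤ (1 - Real.exp (-1)) ^ (-(24 * q)) :=
    Real.one_le_rpow_of_pos_of_le_one_of_nonpos (by linarith) (by linarith) (by linarith)
  rw [div_le_iff₀ (by positivity)]
  have k4 : (2:ℝ) ^ (20 * q) * 2 ^ (26 * q) * 4 ≤ 2 ^ (190 * q + 20) := by
    rw [show (4:ℝ) = 2 ^ (2:ℝ) by norm_num, ← Real.rpow_add (by norm_num),
      ← Real.rpow_add (by norm_num)]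
    exact Real.rpow_le_rpow_of_exponent_le (by norm_num) (by linarith)
  have k5 : q ≤ q ^ (24 * q + 6) := by
    have := Real.rpow_le_rpow_of_exponent_le (by linarith : 1 ≤ q) (by linarith : 1 ≤ 24 * q + 6)
    rwa [Real.rpow_one] at this
  have k6 : C ^ (2 * q) ≤ C ^ (12 * q) := Real.rpow_le_rpow_of_exponent_le hC (by linarith)
  calc δ ^ (24 * q) ≤ 2 ^ (20 * q) * (2 ^ (26 * q) * C ^ (2 * q) * (4 * q) * Δ) :=
        k2.trans (by gcongr)
    _ = Δ * (1 * (2 ^ (20 * q) * 2 ^ (26 * q) * 4) * q * C ^ (2 * q)) := by ring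
    _ ≤ _ := by gcongr

end C
/-- Theorem A.3(i) (Odell–Schlumprecht, quantitative): a uniform homeomorphism between the
unit ball of a `1`-unconditional norm with cotype `q` and the Euclidean ball. -/
theorem stmt_17 {n : ℕ} (hn : 1 ≤ n) (q C : ℝ) (hq : 2 ≤ q) (hC : 1 ≤ C)
    (N : (Fin n → ℝ) → ℝ)
    (hN : IsNorm n N) (hunc : OneUnconditional n N) (hcot : HasCotype n N q C) :
    ∃ Φ : (Fin n → ℝ) → (Fin n → ℝ),
      Set.BijOn Φ {x | N x ≤ 1} {x | Real.sqrt (∑ i, x i ^ 2) ≤ 1} ∧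
      ∀ x₁ ∈ {x : Fin n → ℝ | N x ≤ 1}, ∀ x₂ ∈ {x : Fin n → ℝ | N x ≤ 1},
        N (x₁ - x₂) ^ (24 * q) /
            ((1 - Real.exp (-1)) ^ (-(24 * q)) * 2 ^ (190 * q + 20) * q ^ (24 * q + 6) *
              C ^ (12 * q)) ≤
          Real.sqrt (∑ i, (Φ x₁ i - Φ x₂ i) ^ 2) ∧
        Real.sqrt (∑ i, (Φ x₁ i - Φ x₂ i) ^ 2) ≤
          8 * Real.sqrt 5 / Real.sqrt (1 - Real.exp (-1)) * Real.sqrt q * C ^ ((1 : ℝ) / 4) *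
            N (x₁ - x₂) ^ ((1 : ℝ) / 8) := by
  have hN' : LN n N := LN_of hN hunc
  obtain ⟨M, hM, hc, hNM, hMN⟩ := exists_renorm hq hC hN' hcot
  have hs : 4 ≤ 2 * q := by linarith
  obtain ⟨ω, h1, h2, h3, h4⟩ := exists_om hM hs hc
  have hsC : 1 ≤ √C := Real.one_le_sqrt.2 hC
  have hg := geo hN' hM hs (by linarith : 1 ≤ 6 * √C) hNM hMN ω h1 h2 h3
    (fun x => N x • ω ((M x)⁻¹ • x)) (fun x => rfl)
  set Φ : (Fin n → ℝ) → (Fin n → ℝ) := fun x => N x • ω ((M x)⁻¹ • x) with hΦ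
  have hδ2 : ∀ x x', N x ≤ 1 → N x' ≤ 1 → N (x - x') ≤ 2 := by
    intro x x' hx hx'
    have := hN'.add x (-x')
    rw [hN'.neg, ← sub_eq_add_neg] at this
    linarith
  have hE : ∀ x, Eu n (Φ x) = N x := by
    intro x
    rcases (hN'.nonneg x).eq_or_lt with h | h
    · simp only [hΦ]
      rw [← h, zero_smul, Eu_LN.map_zero]
    · have hp : 0 < M x := lt_of_lt_of_le h (hNM x)
      simp only [hΦ]
      rw [Eu_LN.smul, h1, abs_of_pos h, mul_one]
      rw [hM.smul, abs_of_pos (inv_pos.2 hp), inv_mul_cancel₀ hp.ne']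
  have main : ∀ x₁ x₂, N x₁ ≤ 1 → N x₂ ≤ 1 →
      N (x₁ - x₂) ^ (24 * q) /
            ((1 - Real.exp (-1)) ^ (-(24 * q)) * 2 ^ (190 * q + 20) * q ^ (24 * q + 6) *
              C ^ (12 * q)) ≤ Eu n (Φ x₁ - Φ x₂) ∧
        Eu n (Φ x₁ - Φ x₂) ≤
          8 * Real.sqrt 5 / Real.sqrt (1 - Real.exp (-1)) * Real.sqrt q * C ^ ((1 : ℝ) / 4) *
            N (x₁ - x₂) ^ ((1 : ℝ) / 8) := by
    intro x₁ x₂ hx₁ hx₂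
    rcases le_total (N x₂) (N x₁) with h | h
    · obtain ⟨⟨b, hb0, hb1, hb2⟩, hl⟩ := hg x₁ x₂ hx₁ h
      exact ⟨ar_low hq hC (hN'.nonneg _) (hδ2 _ _ hx₁ hx₂) (Eu_LN.nonneg _) hl,
        ar_up hq hC (hN'.nonneg _) (hδ2 _ _ hx₁ hx₂) hb0 hb1 hb2⟩
    · obtain ⟨⟨b, hb0, hb1, hb2⟩, hl⟩ := hg x₂ x₁ hx₂ h
      rw [hN'.sub_comm x₁ x₂, Eu_LN.sub_comm (Φ x₁) (Φ x₂)]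
      exact ⟨ar_low hq hC (hN'.nonneg _) (hδ2 _ _ hx₂ hx₁) (Eu_LN.nonneg _) hl,
        ar_up hq hC (hN'.nonneg _) (hδ2 _ _ hx₂ hx₁) hb0 hb1 hb2⟩
  refine ⟨Φ, ⟨?_, ?_, ?_⟩, fun x₁ hx₁ x₂ hx₂ => main x₁ x₂ hx₁ hx₂⟩
  · intro x hx
    change Eu n (Φ x) ≤ 1
    rw [hE]
    exact hx
  · intro x hx x' hx' hxx
    have h := (main x x' hx hx').1
    rw [hxx, sub_self, Eu_LN.map_zero] at h
    have he : Real.exp (-1) < 1 := by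
      rw [Real.exp_lt_one_iff]
      norm_num
    have he' : 0 < 1 - Real.exp (-1) := by linarith
    rw [div_le_iff₀ (by positivity), zero_mul] at h
    have h0 : N (x - x') = 0 := by
      by_contra hne
      have := Real.rpow_pos_of_pos (lt_of_le_of_ne (hN'.nonneg (x - x')) (Ne.symm hne)) (24 * q)
      linarith
    exact sub_eq_zero.1 (hN'.zero _ h0)
  · intro w hw
    change Eu n w ≤ 1 at hw
    rcases (Eu_LN.nonneg w).eq_or_lt with h | h
    · refine ⟨0, ?_, ?_⟩
      · change N 0 ≤ 1
        rw [hN'.map_zero]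
        norm_num
      · simp only [hΦ]
        rw [hN'.map_zero, zero_smul, Eu_LN.zero w h.symm]
    · obtain ⟨y, hy, hyw⟩ := h4 ((Eu n w)⁻¹ • w) (by
        rw [Eu_LN.smul, abs_of_pos (inv_pos.2 h), inv_mul_cancel₀ h.ne'])
      have hNy : 0 < N y := by
        refine lt_of_le_of_ne (hN'.nonneg y) ?_
        intro h0
        rw [hN'.zero y h0.symm, hM.map_zero] at hy
        norm_num at hy
      have hpos : 0 < Eu n w * (N y)⁻¹ := by positivity
      have hNx : N ((Eu n w * (N y)⁻¹) • y) = Eu n w := by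
        rw [hN'.smul, abs_of_pos hpos, mul_assoc, inv_mul_cancel₀ hNy.ne', mul_one]
      refine ⟨(Eu n w * (N y)⁻¹) • y, ?_, ?_⟩
      · change N ((Eu n w * (N y)⁻¹) • y) ≤ 1
        rw [hNx]
        exact hw
      · simp only [hΦ]
        rw [hNx, hM.smul, hy, abs_of_pos hpos, mul_one, smul_smul, inv_mul_cancel₀ hpos.ne',
          one_smul, hyw, smul_smul, mul_inv_cancel₀ h.ne', one_smul]
end
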